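/- For every datum (c,d,B), the best constants in the forward-reverse Brascamp-Lieb inequality for the datum and for its dual datum coincide: D(c,d,B) = D(d,c,B*). -/

import Mathlib

open MeasureTheory LinearMap
open scoped RealInnerProductSpace BigOperators NNReal ENNReal

noncomputable section

namespace FRBL

/-- A positive semidefinite (self-adjoint) operator on a real inner product space. -/
def PosSemidef {G : Type*} [NormedAddCommGroup G] [InnerProductSpace ℝ G]
    (A : G →ₗ[ℝ] G) : Prop :=
  A.IsSymmetric ∧ ∀ x : G, 0 ≤ ⟪A x, x⟫

/-- A positive definite (self-adjoint) operator on a real inner product space. -/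
def PosDef {G : Type*} [NormedAddCommGroup G] [InnerProductSpace ℝ G]
    (A : G →ₗ[ℝ] G) : Prop :=
  A.IsSymmetric ∧ ∀ x : G, x ≠ 0 → 0 < ⟪A x, x⟫

variable {k m : ℕ}
  (E : Fin k → Type*) (F : Fin m → Type*)
  [∀ i, NormedAddCommGroup (E i)] [∀ i, InnerProductSpace ℝ (E i)]
  [∀ i, FiniteDimensional ℝ (E i)]
  [∀ i, MeasurableSpace (E i)] [∀ i, BorelSpace (E i)]
  [∀ j, NormedAddCommGroup (F j)] [∀ j, InnerProductSpace ℝ (F j)]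
  [∀ j, FiniteDimensional ℝ (F j)]
  [∀ j, MeasurableSpace (F j)] [∀ j, BorelSpace (F j)]
  (c : Fin k → ℝ) (d : Fin m → ℝ)
  (B : ∀ i j, E i →ₗ[ℝ] F j)

/-- The pointwise domination hypothesis of the forward-reverse Brascamp-Lieb inequality. -/
def Hyp (f : ∀ i, E i → ℝ≥0) (g : ∀ j, F j → ℝ≥0) : Prop :=
  ∀ x : ∀ i, E i,
    (∏ i, f i (x i) ^ c i) ≤ ∏ j, g j (∑ i, c i • B i j (x i)) ^ d j

/-- `D₀` is an admissible constant for the forward-reverse Brascamp-Lieb inequality. -/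
def IsBound (D₀ : ℝ) : Prop :=
  ∀ (f : ∀ i, E i → ℝ≥0) (g : ∀ j, F j → ℝ≥0),
    (∀ i, Measurable (f i)) → (∀ j, Measurable (g j)) →
    Hyp E F c d B f g →
    (∏ i, (∫⁻ x, (f i x : ℝ≥0∞)) ^ c i) ≤
      ENNReal.ofReal (Real.exp D₀) * ∏ j, (∫⁻ y, (g j y : ℝ≥0∞)) ^ d j

/-- The best constant `D(c,d,B)` in the forward-reverse Brascamp-Lieb inequality. -/
def D : EReal :=
  sInf {x : EReal | ∃ D₀ : ℝ, x = (D₀ : EReal) ∧ IsBound E F c d B D₀}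

/-- The gaussian constraint `Λ_c B* U_d B Λ_c ≤ V_c`, written via quadratic forms. -/
def GaussCon (V : ∀ i, E i →ₗ[ℝ] E i) (U : ∀ j, F j →ₗ[ℝ] F j) : Prop :=
  ∀ x : ∀ i, E i,
    (∑ j, d j * ⟪U j (∑ i, c i • B i j (x i)), ∑ i, c i • B i j (x i)⟫) ≤
      ∑ i, c i * ⟪V i (x i), x i⟫

/-- The objective functional in the definition of the gaussian constant. -/
def gaussObj (V : ∀ i, E i →ₗ[ℝ] E i) (U : ∀ j, F j →ₗ[ℝ] F j) : ℝ :=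
  (∑ j, d j * Real.log (LinearMap.det (U j)) -
    ∑ i, c i * Real.log (LinearMap.det (V i))) / 2

/-- The gaussian best constant `D_g(c,d,B)`. -/
def Dg : EReal :=
  sSup {x : EReal | ∃ (V : ∀ i, E i →ₗ[ℝ] E i) (U : ∀ j, F j →ₗ[ℝ] F j),
    (∀ i, PosDef (V i)) ∧ (∀ j, PosDef (U j)) ∧ GaussCon E F c d B V U ∧
    x = (gaussObj E F c d V U : EReal)}

/-- The datum `(c,d,B)` is gaussian-extremizable: the supremum defining `D_g` is
finite and attained. -/
def GaussExt : Prop :=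
  ∃ (V : ∀ i, E i →ₗ[ℝ] E i) (U : ∀ j, F j →ₗ[ℝ] F j),
    (∀ i, PosDef (V i)) ∧ (∀ j, PosDef (U j)) ∧ GaussCon E F c d B V U ∧
    Dg E F c d B = (gaussObj E F c d V U : EReal)

/-- The canonical linear equivalence between `E₀ = ⊕ᵢ Eᵢ` (as `PiLp 2`) and the pi type. -/
def toPi : PiLp 2 E ≃ₗ[ℝ] ∀ i, E i := WithLp.linearEquiv 2 ℝ (∀ i, E i)

/-- Orthogonal projection `π_{E_i} : E₀ → E_i`. -/
def projL (i : Fin k) : PiLp 2 E →ₗ[ℝ] E i := (LinearMap.proj i).comp (toPi E).toLinearMap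

/-- The embedding `E_i → E₀`. -/
def singleL (i : Fin k) : E i →ₗ[ℝ] PiLp 2 E :=
  (toPi E).symm.toLinearMap.comp (LinearMap.single ℝ E i)

/-- The map `B_j : E₀ → E^j`, `x ↦ ∑ᵢ B_{ij} π_{E_i} x`. -/
def Bop (j : Fin m) : PiLp 2 E →ₗ[ℝ] F j := ∑ i, (B i j).comp (projL E i)

/-- `Λ_c = ⊕ᵢ cᵢ id_{E_i}` as an operator on `E₀`. -/
def Lam : PiLp 2 E →ₗ[ℝ] PiLp 2 E := ∑ i, c i • (singleL E i).comp (projL E i)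

/-- The set `Π(A_1, …, A_k)` of positive semidefinite "couplings". -/
def Coupling (A : ∀ i, E i →ₗ[ℝ] E i) : Set (PiLp 2 E →ₗ[ℝ] PiLp 2 E) :=
  {P | PosSemidef P ∧ ∀ (i : Fin k) (v : E i),
    ⟪P (singleL E i v), singleL E i v⟫ = ⟪A i v, v⟫}

/-- The scaling condition `∑ᵢ cᵢ dim Eᵢ = ∑ⱼ dⱼ dim E^j`. -/
def ScalingCond : Prop :=
  ∑ i, c i * (Module.finrank ℝ (E i) : ℝ) = ∑ j, d j * (Module.finrank ℝ (F j) : ℝ)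

/-- A subspace `T ⊆ E₀` is of product form, i.e. `T = ⊕ᵢ π_{E_i} T`. -/
def ProductForm (T : Submodule ℝ (PiLp 2 E)) : Prop :=
  ∀ x ∈ T, ∀ i, singleL E i (projL E i x) ∈ T

/-- The dimension condition over product-form subspaces. -/
def DimCond : Prop :=
  ∀ T : Submodule ℝ (PiLp 2 E), ProductForm E T →
    (∑ i, c i * (Module.finrank ℝ (T.map (projL E i)) : ℝ)) ≤
      ∑ j, d j * (Module.finrank ℝ (T.map (Bop E F B j)) : ℝ)

/-- A critical subspace. -/
def IsCritical (T : Submodule ℝ (PiLp 2 E)) : Prop :=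
  T ≠ ⊥ ∧ T ≠ ⊤ ∧ ProductForm E T ∧
    ∑ i, c i * (Module.finrank ℝ (T.map (projL E i)) : ℝ) =
      ∑ j, d j * (Module.finrank ℝ (T.map (Bop E F B j)) : ℝ)

/-- The datum is simple if it has no critical subspace. -/
def Simple : Prop := ∀ T : Submodule ℝ (PiLp 2 E), ¬ IsCritical E F c d B T

end FRBL

namespace FRBL

/-- `log det` with value `−∞` on operators with non-positive determinant
(in particular on singular positive-semidefinite operators). -/
def elogdet {G : Type*} [AddCommGroup G] [Module ℝ G] (A : G →ₗ[ℝ] G) : EReal :=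
  if 0 < LinearMap.det A then ((Real.log (LinearMap.det A) : ℝ) : EReal) else ⊥

variable {k m : ℕ}
  (E : Fin k → Type*) (F : Fin m → Type*)
  [∀ i, NormedAddCommGroup (E i)] [∀ i, InnerProductSpace ℝ (E i)]
  [∀ i, FiniteDimensional ℝ (E i)]
  [∀ j, NormedAddCommGroup (F j)] [∀ j, InnerProductSpace ℝ (F j)]
  [∀ j, FiniteDimensional ℝ (F j)]
  (c : Fin k → ℝ) (d : Fin m → ℝ)
  (B : ∀ i j, E i →ₗ[ℝ] F j)

/-- The map `Q_j := B_j Λ_c : E₀ → E^j`. -/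
def BLam (j : Fin m) : PiLp 2 E →ₗ[ℝ] F j := (Bop E F B j).comp (Lam E c)

/-- The optimality condition of Theorem 2 (structure of gaussian extremizers):
each `B_j Λ_c Π Λ_c B_j*` is invertible and
`∑ⱼ dⱼ Λ_c B_j* (B_j Λ_c Π Λ_c B_j*)⁻¹ B_j Λ_c ≤ V_c` in the quadratic-form sense. -/
def ExtCond (V : ∀ i, E i →ₗ[ℝ] E i) (P : PiLp 2 E →ₗ[ℝ] PiLp 2 E) : Prop :=
  (∀ j, IsUnit ((BLam E F c B j) ∘ₗ P ∘ₗ LinearMap.adjoint (BLam E F c B j))) ∧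
  ∀ x : PiLp 2 E,
    (∑ j, d j * ⟪Ring.inverse ((BLam E F c B j) ∘ₗ P ∘ₗ LinearMap.adjoint (BLam E F c B j))
        (BLam E F c B j x), BLam E F c B j x⟫) ≤
      ∑ i, c i * ⟪V i (projL E i x), projL E i x⟫

/-- A geometric datum. -/
def Geometric : Prop :=
  ScalingCond E F c d ∧
  ∃ S ∈ Coupling E (fun i => (LinearMap.id : E i →ₗ[ℝ] E i)),
    (∀ j, (BLam E F c B j) ∘ₗ S ∘ₗ LinearMap.adjoint (BLam E F c B j) = LinearMap.id) ∧
    ∀ x : PiLp 2 E, (∑ j, d j * ⟪BLam E F c B j x, BLam E F c B j x⟫) ≤ ⟪Lam E c x, x⟫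

/-- Equivalence of data: `B'_j = C_j⁻¹ B_j C⁻¹` for invertible `C, C_j`. -/
def EquivData (B' : ∀ i j, E i →ₗ[ℝ] F j) : Prop :=
  ∃ (C : PiLp 2 E ≃ₗ[ℝ] PiLp 2 E) (Cj : ∀ j, F j ≃ₗ[ℝ] F j),
    ∀ j, Bop E F B' j =
      ((Cj j).symm.toLinearMap ∘ₗ Bop E F B j) ∘ₗ C.symm.toLinearMap

/-- `V_c = ⊕ᵢ cᵢ Vᵢ` as an operator on `E₀`. -/
def blockDiag (V : ∀ i, E i →ₗ[ℝ] E i) : PiLp 2 E →ₗ[ℝ] PiLp 2 E :=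
  ∑ i, c i • ((singleL E i) ∘ₗ (V i)) ∘ₗ (projL E i)

/-- `Θ = V_c − ∑ⱼ dⱼ Λ_c B_j* U_j B_j Λ_c`. -/
def Theta (V : ∀ i, E i →ₗ[ℝ] E i) (U : ∀ j, F j →ₗ[ℝ] F j) :
    PiLp 2 E →ₗ[ℝ] PiLp 2 E :=
  blockDiag E c V -
    ∑ j, d j • (LinearMap.adjoint (BLam E F c B j) ∘ₗ (U j)) ∘ₗ (BLam E F c B j)

end FRBL

namespace FRBL

/-- Borel structure on submodules (inherited from the ambient space). -/
instance subBorel {G : Type*} [AddCommGroup G] [Module ℝ G] [TopologicalSpace G]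
    [MeasurableSpace G] [BorelSpace G] (T : Submodule ℝ G) : BorelSpace ↥T :=
  Subtype.borelSpace (T : Set G)

/-- The maximal dimension of a subspace on which the self-adjoint operator `Q` is positive
definite; by Sylvester's law of inertia this is the number of positive eigenvalues of `Q`,
counted with multiplicity. -/
def posIndex {H : Type*} [NormedAddCommGroup H] [InnerProductSpace ℝ H]
    (Q : H →ₗ[ℝ] H) : ℕ :=
  sSup {r : ℕ | ∃ W : Submodule ℝ H,
    (∀ x ∈ W, x ≠ 0 → 0 < ⟪Q x, x⟫) ∧ Module.finrank ℝ W = r}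

/-- The standard gaussian probability measure on a Euclidean space. -/
def stdGaussian (G : Type*) [NormedAddCommGroup G] [InnerProductSpace ℝ G]
    [FiniteDimensional ℝ G] [MeasurableSpace G] [BorelSpace G] :
    Measure G :=
  volume.withDensity fun x =>
    ENNReal.ofReal ((2 * Real.pi) ^ (-(Module.finrank ℝ G : ℝ) / 2) *
      Real.exp (-‖x‖ ^ 2 / 2))

/-- `K_s = (|s|^{1/s} |s'|^{1/s'})^{1/2}`. -/
def Kconst (s s' : ℝ) : ℝ := Real.sqrt (|s| ^ (1 / s) * |s'| ^ (1 / s'))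

variable {k m : ℕ}
  (E : Fin k → Type*) (F : Fin m → Type*)
  [∀ i, NormedAddCommGroup (E i)] [∀ i, InnerProductSpace ℝ (E i)]
  [∀ i, FiniteDimensional ℝ (E i)]
  [∀ j, NormedAddCommGroup (F j)] [∀ j, InnerProductSpace ℝ (F j)]
  [∀ j, FiniteDimensional ℝ (F j)]
  (c : Fin k → ℝ) (d : Fin m → ℝ)
  (B : ∀ i j, E i →ₗ[ℝ] F j)

/-- The objective functional `∑ⱼ dⱼ log det Uⱼ − ∑ᵢ cᵢ log det Vᵢ`. -/
def objective (V : ∀ i, E i →ₗ[ℝ] E i) (U : ∀ j, F j →ₗ[ℝ] F j) : ℝ :=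
  ∑ j, d j * Real.log (LinearMap.det (U j)) - ∑ i, c i * Real.log (LinearMap.det (V i))

/-- Feasibility for the optimization problem defining `D_g`: positive definiteness
together with the constraint `Θ ≥ 0`. -/
def Admissible (V : ∀ i, E i →ₗ[ℝ] E i) (U : ∀ j, F j →ₗ[ℝ] F j) : Prop :=
  (∀ i, PosDef (V i)) ∧ (∀ j, PosDef (U j)) ∧ PosSemidef (Theta E F c d B V U)

/-- Global maximality in the optimization problem defining `D_g`. -/
def IsGlobalMax (V : ∀ i, E i →ₗ[ℝ] E i) (U : ∀ j, F j →ₗ[ℝ] F j) : Prop :=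
  Admissible E F c d B V U ∧
    ∀ V' U', Admissible E F c d B V' U' →
      objective E F c d V' U' ≤ objective E F c d V U

/-- Local maximality in the optimization problem defining `D_g`. -/
def IsLocalMax (V : ∀ i, E i →ₗ[ℝ] E i) (U : ∀ j, F j →ₗ[ℝ] F j) : Prop :=
  Admissible E F c d B V U ∧
    ∃ ε : ℝ, 0 < ε ∧
      ∀ V' U', Admissible E F c d B V' U' →
        (∀ i, ‖LinearMap.toContinuousLinearMap (V' i - V i)‖ < ε) →
        (∀ j, ‖LinearMap.toContinuousLinearMap (U' j - U j)‖ < ε) →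
        objective E F c d V' U' ≤ objective E F c d V U

end FRBL

set_option linter.unusedSectionVars false

namespace FRBL

section Gaussian

variable {G : Type*} [NormedAddCommGroup G] [InnerProductSpace ℝ G]
  [FiniteDimensional ℝ G] [MeasurableSpace G] [BorelSpace G]

variable (G) in
/-- The normalizing constant of the standard gaussian density. -/
def gaussNorm : ℝ := (2 * Real.pi) ^ (-(Module.finrank ℝ G : ℝ) / 2)

lemma gaussNorm_pos : 0 < gaussNorm G := by
  unfold gaussNorm; positivity

lemma stdGaussian_eq : stdGaussian G =
    (volume : Measure G).withDensity fun x =>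
      ENNReal.ofReal (gaussNorm G * Real.exp (-‖x‖ ^ 2 / 2)) := rfl

lemma measurable_gaussDensity : Measurable fun x : G =>
    ENNReal.ofReal (gaussNorm G * Real.exp (-‖x‖ ^ 2 / 2)) := by
  fun_prop

lemma integral_stdGaussian {H : Type*} [NormedAddCommGroup H] [NormedSpace ℝ H] (f : G → H) :
    ∫ z, f z ∂(stdGaussian G) =
      ∫ z, (gaussNorm G * Real.exp (-‖z‖ ^ 2 / 2)) • f z := by
  rw [stdGaussian_eq, integral_withDensity_eq_integral_toReal_smul measurable_gaussDensity
    (by simp)]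
  refine integral_congr_ae (Filter.Eventually.of_forall fun z => ?_)
  have := gaussNorm_pos (G := G)
  simp only
  rw [ENNReal.toReal_ofReal (by positivity)]

lemma integrable_stdGaussian_iff {H : Type*} [NormedAddCommGroup H] [NormedSpace ℝ H]
    (f : G → H) : Integrable f (stdGaussian G) ↔
      Integrable fun z => (gaussNorm G * Real.exp (-‖z‖ ^ 2 / 2)) • f z := by
  rw [stdGaussian_eq, integrable_withDensity_iff_integrable_smul' measurable_gaussDensity
    (by simp)]
  refine integrable_congr (Filter.Eventually.of_forall fun z => ?_)
  have := gaussNorm_pos (G := G)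
  simp only
  rw [ENNReal.toReal_ofReal (by positivity)]

lemma integrable_exp_neg_mul_sq {b : ℝ} (hb : 0 < b) :
    Integrable fun z : G => Real.exp (-b * ‖z‖ ^ 2) := by
  have h := (GaussianFourier.integrable_cexp_neg_mul_sq_norm_add (V := G) (b := (b : ℂ))
    (by simpa using hb) 0 0).norm
  refine h.congr (Filter.Eventually.of_forall fun z => ?_)
  simp only [Complex.norm_exp]
  congr 1
  simp [← Complex.ofReal_pow]

lemma integral_exp_neg_half_sq : ∫ z : G, Real.exp (-‖z‖ ^ 2 / 2) =
    (2 * Real.pi) ^ ((Module.finrank ℝ G : ℝ) / 2) := by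
  have h := GaussianFourier.integral_rexp_neg_mul_sq_norm (V := G) (b := 1 / 2) (by norm_num)
  rw [show Real.pi / (1 / 2) = 2 * Real.pi by ring] at h
  rw [← h]
  congr 1; ext z; congr 1; ring

lemma gaussNorm_mul : gaussNorm G * (2 * Real.pi) ^ ((Module.finrank ℝ G : ℝ) / 2) = 1 := by
  rw [gaussNorm, ← Real.rpow_add (by positivity)]
  simp [neg_div]

instance : IsProbabilityMeasure (stdGaussian G) := by
  constructor
  rw [stdGaussian_eq, withDensity_apply _ MeasurableSet.univ, Measure.restrict_univ,
    ← ofReal_integral_eq_lintegral_ofReal]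
  · rw [integral_const_mul, integral_exp_neg_half_sq, gaussNorm_mul]; simp
  · refine Integrable.const_mul ?_ _
    convert integrable_exp_neg_mul_sq (G := G) (b := 1 / 2) (by norm_num) using 3
    ring
  · have := gaussNorm_pos (G := G)
    exact Filter.Eventually.of_forall fun z => by positivity

lemma charFun_stdGaussian (t : G) :
    charFun (stdGaussian G) t = Complex.exp (-(‖t‖ : ℂ) ^ 2 / 2) := by
  rw [charFun_apply, integral_stdGaussian]
  have h := GaussianFourier.integral_cexp_neg_mul_sq_norm_add (V := G) (b := (1 / 2 : ℂ))
    (by norm_num) Complex.I t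
  have h2 : ∀ z : G, (gaussNorm G * Real.exp (-‖z‖ ^ 2 / 2)) • Complex.exp (⟪z, t⟫ * Complex.I)
      = (gaussNorm G : ℂ) *
        Complex.exp (-(1 / 2) * ‖z‖ ^ 2 + Complex.I * ⟪t, z⟫) := by
    intro z
    rw [Complex.real_smul, Complex.ofReal_mul, mul_assoc, Complex.ofReal_exp, ← Complex.exp_add,
      real_inner_comm]
    congr 2
    push_cast; ring
  simp_rw [h2]
  rw [integral_const_mul, h, ← mul_assoc]
  have h3 : (gaussNorm G : ℂ) * ((Real.pi : ℂ) / (1 / 2)) ^ ((Module.finrank ℝ G : ℂ) / 2) = 1 := by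
    have := gaussNorm_mul (G := G)
    have h4 : ((Real.pi : ℂ) / (1 / 2)) = ((2 * Real.pi : ℝ) : ℂ) := by push_cast; ring
    have h5 : ((Module.finrank ℝ G : ℂ) / 2) = (((Module.finrank ℝ G : ℝ) / 2 : ℝ) : ℂ) := by
      push_cast; ring
    rw [h4, h5, ← Complex.ofReal_cpow (by positivity), ← Complex.ofReal_mul, this]
    simp
  rw [h3, one_mul]
  congr 1
  rw [Complex.I_sq]; ring

lemma integral_stdGaussian_shift (f : G → ℝ) (v : G) :
    ∫ z, f z ∂(stdGaussian G) =
      ∫ z, f (z + v) * Real.exp (-⟪v, z⟫ - ‖v‖ ^ 2 / 2) ∂(stdGaussian G) := by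
  rw [integral_stdGaussian, integral_stdGaussian, ← integral_add_right_eq_self _ v]
  congr 1; ext z
  simp only [smul_eq_mul]
  rw [norm_add_sq_real, real_inner_comm v z]
  have : Real.exp (-(‖z‖ ^ 2 + 2 * ⟪v, z⟫ + ‖v‖ ^ 2) / 2) =
      Real.exp (-‖z‖ ^ 2 / 2) * Real.exp (-⟪v, z⟫ - ‖v‖ ^ 2 / 2) := by
    rw [← Real.exp_add]; congr 1; ring
  rw [this]; ring

lemma integrable_exp_mul_sq_stdGaussian {a : ℝ} (ha : a < 1 / 2) :
    Integrable (fun z : G => Real.exp (a * ‖z‖ ^ 2)) (stdGaussian G) := by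
  rw [integrable_stdGaussian_iff]
  have := (integrable_exp_neg_mul_sq (G := G) (b := 1 / 2 - a) (by linarith)).const_mul
    (gaussNorm G)
  refine this.congr (Filter.Eventually.of_forall fun z => ?_)
  simp only [smul_eq_mul]
  rw [mul_assoc, ← Real.exp_add]
  congr 2; ring

lemma integrable_one_add_sq_pow_stdGaussian (n : ℕ) {a : ℝ} (ha : a < 1 / 2) :
    Integrable (fun z : G => (1 + ‖z‖ ^ 2) ^ n * Real.exp (a * (1 + ‖z‖ ^ 2)))
      (stdGaussian G) := by
  set δ := (1 / 2 - a) / 2 with hδ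
  have hδ0 : 0 < δ := by rw [hδ]; linarith
  have h := ((integrable_exp_mul_sq_stdGaussian (G := G) (a := a + δ)
    (by rw [hδ]; linarith)).const_mul (Real.exp (a + δ))).const_mul (n.factorial / δ ^ n)
  refine h.mono' (by fun_prop) (Filter.Eventually.of_forall fun z => ?_)
  have h0 : (0 : ℝ) ≤ 1 + ‖z‖ ^ 2 := by positivity
  rw [Real.norm_of_nonneg (by positivity)]
  have h1 := Real.pow_div_factorial_le_exp (δ * (1 + ‖z‖ ^ 2)) (by positivity) n
  have hf : (0 : ℝ) < n.factorial := by positivity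
  rw [mul_pow, div_le_iff₀ hf] at h1
  have h2 : (1 + ‖z‖ ^ 2) ^ n ≤ n.factorial / δ ^ n * Real.exp (δ * (1 + ‖z‖ ^ 2)) := by
    rw [div_mul_eq_mul_div, le_div_iff₀ (by positivity)]; linarith
  calc _ ≤ n.factorial / δ ^ n * Real.exp (δ * (1 + ‖z‖ ^ 2)) * Real.exp (a * (1 + ‖z‖ ^ 2)) := by
        gcongr
    _ = _ := by
      rw [mul_assoc, ← Real.exp_add, ← Real.exp_add]
      congr 2; ring

lemma integrable_one_add_sq_stdGaussian :
    Integrable (fun z : G => 1 + ‖z‖ ^ 2) (stdGaussian G) := by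
  simpa using integrable_one_add_sq_pow_stdGaussian (G := G) 1 (a := 0) (by norm_num)

lemma integrable_inner_stdGaussian (v : G) :
    Integrable (fun z : G => ⟪v, z⟫) (stdGaussian G) := by
  refine (integrable_one_add_sq_stdGaussian.const_mul ‖v‖).mono' (by fun_prop)
    (Filter.Eventually.of_forall fun z => ?_)
  refine (norm_inner_le_norm v z).trans ?_
  gcongr
  nlinarith [sq_nonneg (‖z‖ - 1)]

lemma integral_inner_stdGaussian (v : G) : ∫ z, ⟪v, z⟫ ∂(stdGaussian G) = 0 := by
  have h : ∫ z, ⟪v, z⟫ ∂(stdGaussian G) = -∫ z, ⟪v, z⟫ ∂(stdGaussian G) := by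
    conv_lhs => rw [integral_stdGaussian, ← integral_neg_eq_self]
    rw [integral_stdGaussian, ← integral_neg]
    congr 1; ext z
    simp
  linarith

variable {X : Type*} [NormedAddCommGroup X] [InnerProductSpace ℝ X]
  [FiniteDimensional ℝ X] [MeasurableSpace X] [BorelSpace X]

lemma charFun_map_stdGaussian (M : G →L[ℝ] X) (t : X) :
    charFun ((stdGaussian G).map M) t =
      Complex.exp (-(‖ContinuousLinearMap.adjoint M t‖ : ℂ) ^ 2 / 2) := by
  rw [← charFun_stdGaussian, charFun_apply, charFun_apply,
    integral_map (by fun_prop) (by fun_prop)]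
  simp_rw [ContinuousLinearMap.adjoint_inner_right]

lemma map_stdGaussian_eq_of_norm_adjoint {G' : Type*} [NormedAddCommGroup G']
    [InnerProductSpace ℝ G'] [FiniteDimensional ℝ G'] [MeasurableSpace G'] [BorelSpace G']
    (M : G →L[ℝ] X) (R : G' →L[ℝ] X)
    (h : ∀ x, ‖ContinuousLinearMap.adjoint M x‖ = ‖ContinuousLinearMap.adjoint R x‖) :
    (stdGaussian G).map M = (stdGaussian G').map R := by
  have := Measure.isProbabilityMeasure_map (μ := stdGaussian G) (f := M) (by fun_prop)
  have := Measure.isProbabilityMeasure_map (μ := stdGaussian G') (f := R) (by fun_prop)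
  refine Measure.ext_of_charFun (funext fun t => ?_)
  rw [charFun_map_stdGaussian, charFun_map_stdGaussian, h]

lemma conv_map_smul_stdGaussian (M : G →L[ℝ] X) {s t : ℝ} (hs : 0 ≤ s) (ht : 0 ≤ t) :
    ((stdGaussian G).map (√s • M)) ∗ ((stdGaussian G).map (√t • M)) =
      (stdGaussian G).map (√(s + t) • M) := by
  have h1 := Measure.isProbabilityMeasure_map (μ := stdGaussian G) (f := √s • M) (by fun_prop)
  have h2 := Measure.isProbabilityMeasure_map (μ := stdGaussian G) (f := √t • M) (by fun_prop)
  have h3 := Measure.isProbabilityMeasure_map (μ := stdGaussian G) (f := √(s + t) • M)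
    (by fun_prop)
  refine Measure.ext_of_charFun (funext fun u => ?_)
  rw [charFun_conv, charFun_map_stdGaussian, charFun_map_stdGaussian, charFun_map_stdGaussian,
    ← Complex.exp_add]
  congr 1
  simp only [map_smulₛₗ, _root_.smul_apply, norm_smul, conj_trivial,
    Real.norm_of_nonneg (Real.sqrt_nonneg _)]
  simp only [← Complex.ofReal_pow, mul_pow, Real.sq_sqrt hs, Real.sq_sqrt ht,
    Real.sq_sqrt (add_nonneg hs ht)]
  push_cast; ring

end Gaussian

end FRBL

namespace FRBL

section Heat

variable {G X : Type*} [NormedAddCommGroup G] [InnerProductSpace ℝ G]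
  [FiniteDimensional ℝ G] [MeasurableSpace G] [BorelSpace G]
  [NormedAddCommGroup X] [InnerProductSpace ℝ X]
  [FiniteDimensional ℝ X] [MeasurableSpace X] [BorelSpace X]

/-- The heat semigroup driven by the linear map `M`, at time `t`. -/
def heat (M : G →L[ℝ] X) (t : ℝ) (f : X → ℝ) (x : X) : ℝ :=
  ∫ z, f (x + √t • M z) ∂(stdGaussian G)

/-- Positive functions whose logarithm has uniformly bounded gradient and deviates from its
linearizations at most quadratically. -/
def SemiSmooth (L K : ℝ) (f : X → ℝ) : Prop :=
  (∀ x, 0 < f x) ∧ ∀ x, ∃ p : X, ‖p‖ ≤ L ∧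
    ∀ w, |Real.log (f (x + w)) - Real.log (f x) - ⟪p, w⟫| ≤ K * ‖w‖ ^ 2

lemma heat_zero (M : G →L[ℝ] X) (f : X → ℝ) : heat M 0 f = f := by
  ext x; simp [heat]

lemma measurable_heat (M : G →L[ℝ] X) (t : ℝ) {f : X → ℝ} (hf : Measurable f) :
    Measurable (heat M t f) := by
  have h : Measurable (Function.uncurry fun (x : X) (z : G) => f (x + √t • M z)) :=
    hf.comp (by fun_prop)
  exact (h.stronglyMeasurable.integral_prod_right (ν := stdGaussian G)).measurable

lemma integrable_of_bounded {Ω : Type*} [MeasurableSpace Ω] {μ : Measure Ω} [IsFiniteMeasure μ]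
    {f : Ω → ℝ} (hf : Measurable f) {b : ℝ} (hb : ∀ x, |f x| ≤ b) : Integrable f μ :=
  Integrable.of_bound hf.aestronglyMeasurable b (Filter.Eventually.of_forall hb)

lemma integral_pos_of_forall_pos {Ω : Type*} [MeasurableSpace Ω] {μ : Measure Ω} [NeZero μ]
    {f : Ω → ℝ} (hf : Integrable f μ) (h : ∀ x, 0 < f x) : 0 < ∫ x, f x ∂μ := by
  rw [integral_pos_iff_support_of_nonneg (fun x => (h x).le) hf]
  have : Function.support f = Set.univ := Set.eq_univ_of_forall fun x => (h x).ne'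
  rw [this]
  exact NeZero.pos (μ Set.univ)

lemma abs_heat_le (M : G →L[ℝ] X) (t : ℝ) {f : X → ℝ} {b : ℝ} (hb : ∀ x, |f x| ≤ b) (x : X) :
    |heat M t f x| ≤ b := by
  have h := norm_integral_le_of_norm_le_const (μ := stdGaussian G)
    (f := fun z => f (x + √t • M z)) (Filter.Eventually.of_forall fun z => hb _)
  rwa [probReal_univ, mul_one] at h

lemma integrable_heat (M : G →L[ℝ] X) (t : ℝ) {f : X → ℝ} (hf : Measurable f) {b : ℝ}
    (hb : ∀ x, |f x| ≤ b) (x : X) :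
    Integrable (fun z => f (x + √t • M z)) (stdGaussian G) :=
  integrable_of_bounded (hf.comp (by fun_prop)) fun _ => hb _

lemma heat_pos (M : G →L[ℝ] X) (t : ℝ) {f : X → ℝ} (hf : Measurable f) {b : ℝ}
    (hb : ∀ x, |f x| ≤ b) (h0 : ∀ x, 0 < f x) (x : X) : 0 < heat M t f x :=
  integral_pos_of_forall_pos (integrable_heat M t hf hb x) fun _ => h0 _

lemma heat_eq_integral_map (M : G →L[ℝ] X) (t : ℝ) {f : X → ℝ} (hf : Measurable f) (x : X) :
    heat M t f x = ∫ w, f (x + w) ∂((stdGaussian G).map (√t • M)) := by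
  have hm : Measurable fun w => f (x + w) := hf.comp (by fun_prop)
  rw [integral_map (by fun_prop) hm.aestronglyMeasurable]
  rfl

lemma heat_heat (M : G →L[ℝ] X) {s t : ℝ} (hs : 0 ≤ s) (ht : 0 ≤ t) {f : X → ℝ}
    (hf : Measurable f) {b : ℝ} (hb : ∀ x, |f x| ≤ b) :
    heat M s (heat M t f) = heat M (s + t) f := by
  ext x
  have h1 := Measure.isProbabilityMeasure_map (μ := stdGaussian G) (f := √s • M) (by fun_prop)
  have h2 := Measure.isProbabilityMeasure_map (μ := stdGaussian G) (f := √t • M) (by fun_prop)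
  rw [heat_eq_integral_map M _ (measurable_heat M t hf), heat_eq_integral_map M _ hf,
    ← conv_map_smul_stdGaussian M hs ht, integral_conv]
  · simp_rw [heat_eq_integral_map M t hf, add_assoc]
  · exact integrable_of_bounded (hf.comp (by fun_prop)) fun _ => hb _

lemma exp_le_one_add_add (y : ℝ) : Real.exp y ≤ 1 + y + y ^ 2 * Real.exp |y| := by
  have h := Complex.norm_exp_sub_sum_le_norm_mul_exp (y : ℂ) 2
  simp only [Finset.sum_range_succ, Finset.sum_range_zero] at h
  have h2 : (Complex.exp y - (0 + (y : ℂ) ^ 0 / (Nat.factorial 0 : ℂ) +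
      (y : ℂ) ^ 1 / (Nat.factorial 1 : ℂ))) = ((Real.exp y - (1 + y) : ℝ) : ℂ) := by
    push_cast; simp
  rw [h2, Complex.norm_real, Complex.norm_real, Real.norm_eq_abs, Real.norm_eq_abs, sq_abs] at h
  linarith [le_abs_self (Real.exp y - (1 + y))]

lemma integrable_exp_inner_stdGaussian (u : G) :
    Integrable (fun z : G => Real.exp ⟪u, z⟫) (stdGaussian G) := by
  refine ((integrable_exp_mul_sq_stdGaussian (G := G) (a := 1 / 4) (by norm_num)).const_mul
    (Real.exp (‖u‖ ^ 2))).mono' (by fun_prop) (Filter.Eventually.of_forall fun z => ?_)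
  rw [Real.norm_of_nonneg (Real.exp_pos _).le, ← Real.exp_add, Real.exp_le_exp]
  nlinarith [real_inner_le_norm u z, sq_nonneg (‖u‖ - ‖z‖ / 2)]

lemma heat_upper_step (M : G →L[ℝ] X) (L K : ℝ) :
    ∃ C : ℝ, 0 ≤ C ∧ ∀ᶠ h in nhdsWithin (0 : ℝ) (Set.Ioi 0), ∀ f : X → ℝ, Measurable f →
      SemiSmooth L K f → ∀ x, ∃ q : G,
        Integrable (fun z => Real.log (f (x + √h • M z + h • M q))) (stdGaussian G) ∧
        Real.log (heat M h f x) ≤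
          ∫ z, Real.log (f (x + √h • M z + h • M q)) ∂(stdGaussian G) - h * ‖q‖ ^ 2 / 2
            + C * h ^ 2 := by
  set C₁ : ℝ := 2 * |K| * ‖M‖ ^ 2 * (1 + ‖M‖ ^ 2 * L ^ 2) with hC₁
  have hC₁0 : 0 ≤ C₁ := by positivity
  set I : ℝ := ∫ z : G, (1 + ‖z‖ ^ 2) ^ 2 * Real.exp (1 / 4 * (1 + ‖z‖ ^ 2)) ∂(stdGaussian G)
    with hI
  have hI0 : 0 ≤ I := integral_nonneg fun z => by positivity
  refine ⟨C₁ ^ 2 * I, by positivity, ?_⟩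
  have e1 : ∀ᶠ h in nhdsWithin (0 : ℝ) (Set.Ioi 0), h * C₁ < 1 / 4 := by
    refine Filter.Tendsto.eventually_lt_const (show (0 : ℝ) < 1 / 4 by norm_num) ?_
    have : Filter.Tendsto (fun h : ℝ => h * C₁) (nhds 0) (nhds (0 * C₁)) :=
      (continuous_mul_const C₁).tendsto 0
    rw [zero_mul] at this
    exact this.mono_left nhdsWithin_le_nhds
  have e2 : ∀ᶠ h in nhdsWithin (0 : ℝ) (Set.Ioi 0), h < 1 :=
    nhdsWithin_le_nhds (gt_mem_nhds one_pos)
  filter_upwards [e1, e2, self_mem_nhdsWithin] with h hh1 hh2 hh0 f hfm hf x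
  have hh0 : 0 < h := hh0
  obtain ⟨p, hpL, hp⟩ := hf.2 x
  set q : G := ContinuousLinearMap.adjoint M p with hq
  have hqL : ‖q‖ ≤ ‖M‖ * L := by
    have := (ContinuousLinearMap.adjoint M).le_opNorm p
    rw [LinearIsometryEquiv.norm_map] at this
    exact this.trans (by gcongr)
  set Y : G → ℝ := fun z => Real.log (f (x + √h • M z + h • M q)) - Real.log (f x)
    - √h * ⟪q, z⟫ - h * ‖q‖ ^ 2 with hY
  have hYm : Measurable Y := by
    have : Measurable fun z => Real.log (f (x + √h • M z + h • M q)) :=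
      Real.measurable_log.comp (hfm.comp (by fun_prop))
    exact ((this.sub_const _).sub (by fun_prop)).sub_const _
  have hYb : ∀ z, |Y z| ≤ h * C₁ * (1 + ‖z‖ ^ 2) := by
    intro z
    have h1 := hp (√h • M z + h • M q)
    have h2 : ⟪p, √h • M z + h • M q⟫ = √h * ⟪q, z⟫ + h * ‖q‖ ^ 2 := by
      rw [inner_add_right, inner_smul_right, inner_smul_right, hq,
        ← ContinuousLinearMap.adjoint_inner_left, ← ContinuousLinearMap.adjoint_inner_left,
        real_inner_self_eq_norm_sq]
    have h3 : Y z = Real.log (f (x + (√h • M z + h • M q))) - Real.log (f x)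
        - ⟪p, √h • M z + h • M q⟫ := by
      simp only [h2, hY]; rw [add_assoc x]; ring
    rw [h3]
    refine h1.trans ?_
    have h4 : ‖√h • M z + h • M q‖ ≤ √h * (‖M‖ * ‖z‖) + h * (‖M‖ * (‖M‖ * L)) := by
      refine (norm_add_le _ _).trans ?_
      rw [norm_smul, norm_smul, Real.norm_of_nonneg (Real.sqrt_nonneg _),
        Real.norm_of_nonneg hh0.le]
      have a1 := M.le_opNorm z
      have a2 := (M.le_opNorm q).trans (mul_le_mul_of_nonneg_left hqL (norm_nonneg M))
      gcongr
    have h5 : ‖√h • M z + h • M q‖ ^ 2 ≤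
        2 * (h * (‖M‖ * ‖z‖) ^ 2 + h ^ 2 * (‖M‖ * (‖M‖ * L)) ^ 2) := by
      refine (pow_le_pow_left₀ (norm_nonneg _) h4 2).trans ?_
      have := Real.sq_sqrt hh0.le
      nlinarith [sq_nonneg (√h * (‖M‖ * ‖z‖) - h * (‖M‖ * (‖M‖ * L)))]
    have h6 : h ^ 2 ≤ h := by nlinarith
    have h7 : ‖√h • M z + h • M q‖ ^ 2 ≤
        2 * h * ‖M‖ ^ 2 * (‖z‖ ^ 2 + ‖M‖ ^ 2 * L ^ 2) := by
      have : h ^ 2 * (‖M‖ * (‖M‖ * L)) ^ 2 ≤ h * (‖M‖ * (‖M‖ * L)) ^ 2 := by gcongr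
      nlinarith
    calc K * ‖√h • M z + h • M q‖ ^ 2 ≤ |K| * ‖√h • M z + h • M q‖ ^ 2 := by
          gcongr; exact le_abs_self K
      _ ≤ |K| * (2 * h * ‖M‖ ^ 2 * (‖z‖ ^ 2 + ‖M‖ ^ 2 * L ^ 2)) := by gcongr
      _ ≤ |K| * (2 * h * ‖M‖ ^ 2 * ((1 + ‖M‖ ^ 2 * L ^ 2) * (1 + ‖z‖ ^ 2))) := by
          gcongr
          nlinarith [mul_nonneg (mul_nonneg (sq_nonneg ‖M‖) (sq_nonneg L)) (sq_nonneg ‖z‖)]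
      _ = h * C₁ * (1 + ‖z‖ ^ 2) := by rw [hC₁]; ring
  have hYi : Integrable Y (stdGaussian G) :=
    (integrable_one_add_sq_stdGaussian.const_mul (h * C₁)).mono' hYm.aestronglyMeasurable
      (Filter.Eventually.of_forall hYb)
  have hIi := integrable_one_add_sq_pow_stdGaussian (G := G) 2 (a := 1 / 4) (by norm_num)
  have hpt : ∀ z, Real.exp (Y z) ≤ 1 + Y z + h ^ 2 * C₁ ^ 2 *
      ((1 + ‖z‖ ^ 2) ^ 2 * Real.exp (1 / 4 * (1 + ‖z‖ ^ 2))) := by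
    intro z
    refine (exp_le_one_add_add (Y z)).trans ?_
    have h1 : Y z ^ 2 ≤ (h * C₁ * (1 + ‖z‖ ^ 2)) ^ 2 := by
      rw [← sq_abs]; exact pow_le_pow_left₀ (abs_nonneg _) (hYb z) 2
    have h2 : Real.exp |Y z| ≤ Real.exp (1 / 4 * (1 + ‖z‖ ^ 2)) := by
      rw [Real.exp_le_exp]
      exact (hYb z).trans (by gcongr)
    have := mul_le_mul h1 h2 (Real.exp_pos _).le (by positivity)
    linarith
  have hRi : Integrable (fun z => 1 + Y z + h ^ 2 * C₁ ^ 2 *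
      ((1 + ‖z‖ ^ 2) ^ 2 * Real.exp (1 / 4 * (1 + ‖z‖ ^ 2)))) (stdGaussian G) :=
    ((integrable_const (1 : ℝ)).add hYi).add (hIi.const_mul _)
  have hEi : Integrable (fun z => Real.exp (Y z)) (stdGaussian G) := by
    refine hRi.mono' (by fun_prop) (Filter.Eventually.of_forall fun z => ?_)
    rw [Real.norm_of_nonneg (Real.exp_pos _).le]; exact hpt z
  have hE : ∫ z, Real.exp (Y z) ∂(stdGaussian G) ≤
      1 + ∫ z, Y z ∂(stdGaussian G) + h ^ 2 * C₁ ^ 2 * I := by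
    refine (integral_mono hEi hRi hpt).trans_eq ?_
    have hA : Integrable (fun z => 1 + Y z) (stdGaussian G) := (integrable_const (1 : ℝ)).add hYi
    rw [integral_add hA (hIi.const_mul _), integral_add (integrable_const _) hYi,
      integral_const_mul]
    simp [hI]
  have hEpos : 0 < ∫ z, Real.exp (Y z) ∂(stdGaussian G) :=
    integral_pos_of_forall_pos hEi fun z => Real.exp_pos _
  have hheat : heat M h f x = f x * Real.exp (h * ‖q‖ ^ 2 / 2) *
      ∫ z, Real.exp (Y z) ∂(stdGaussian G) := by
    rw [heat, integral_stdGaussian_shift _ (√h • q), ← integral_const_mul]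
    congr 1; ext z
    have hpos := hf.1 (x + √h • M z + h • M q)
    have h1 : x + √h • M (z + √h • q) = x + √h • M z + h • M q := by
      rw [map_add, map_smul, smul_add, smul_smul, Real.mul_self_sqrt hh0.le, add_assoc]
    have h2 : ‖√h • q‖ ^ 2 = h * ‖q‖ ^ 2 := by
      rw [norm_smul, mul_pow, Real.norm_of_nonneg (Real.sqrt_nonneg _), Real.sq_sqrt hh0.le]
    simp only [hY]
    rw [h1, h2, inner_smul_left, conj_trivial]
    nth_rewrite 1 [← Real.exp_log hpos]
    nth_rewrite 1 [← Real.exp_log (hf.1 x)]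
    rw [← Real.exp_add, ← Real.exp_add, ← Real.exp_add]
    congr 1; ring
  refine ⟨q, ?_, ?_⟩
  · have := ((hYi.add (integrable_const (Real.log (f x)))).add
      ((integrable_inner_stdGaussian q).const_mul √h)).add (integrable_const (h * ‖q‖ ^ 2))
    refine this.congr (Filter.Eventually.of_forall fun z => ?_)
    simp only [hY, Pi.add_apply]
    ring
  · have hW : ∫ z, Y z ∂(stdGaussian G) =
        ∫ z, Real.log (f (x + √h • M z + h • M q)) ∂(stdGaussian G) - Real.log (f x)
          - h * ‖q‖ ^ 2 := by
      have h1 : ∀ z, Real.log (f (x + √h • M z + h • M q)) =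
          Y z + Real.log (f x) + √h * ⟪q, z⟫ + h * ‖q‖ ^ 2 := by
        intro z; simp only [hY]; ring
      simp_rw [h1]
      have hA : Integrable (fun z => Y z + Real.log (f x)) (stdGaussian G) :=
        hYi.add (integrable_const _)
      have hA' : Integrable (fun z => Y z + Real.log (f x) + √h * ⟪q, z⟫) (stdGaussian G) :=
        hA.add ((integrable_inner_stdGaussian q).const_mul √h)
      rw [integral_add hA' (integrable_const _),
        integral_add hA ((integrable_inner_stdGaussian q).const_mul √h),
        integral_add hYi (integrable_const _), integral_const_mul, integral_inner_stdGaussian]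
      simp
      ring
    rw [hheat, Real.log_mul (mul_pos (hf.1 x) (Real.exp_pos _)).ne' hEpos.ne',
      Real.log_mul (hf.1 x).ne' (Real.exp_pos _).ne', Real.log_exp]
    have := Real.log_le_sub_one_of_pos hEpos
    rw [hW] at hE
    nlinarith

lemma heat_lower_step (N : G →L[ℝ] X) {h : ℝ} (hh : 0 < h) {g : X → ℝ} (hg : Measurable g)
    (hpos : ∀ y, 0 < g y) {b : ℝ} (hb : ∀ y, |g y| ≤ b) (y : X) (v : G) :
    ∃ H : G → ℝ, Integrable H (stdGaussian G) ∧
      (∀ z, Real.log (g (y + √h • N z + h • N v)) ≤ H z) ∧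
      ∫ z, H z ∂(stdGaussian G) = Real.log (heat N h g y) + h * ‖v‖ ^ 2 / 2 := by
  set W : G → ℝ := fun z => g (y + √h • N z + h • N v) *
    Real.exp (-(√h * ⟪v, z⟫) - h * ‖v‖ ^ 2 / 2) with hW
  have hWi : Integrable W (stdGaussian G) := by
    have h1 := (integrable_exp_inner_stdGaussian (-(√h • v))).const_mul b
    refine h1.mono' ?_ (Filter.Eventually.of_forall fun z => ?_)
    · exact ((hg.comp (by fun_prop)).mul (by fun_prop)).aestronglyMeasurable
    · rw [hW, norm_mul, Real.norm_eq_abs, Real.norm_of_nonneg (Real.exp_pos _).le]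
      have hb0 : 0 ≤ b := (abs_nonneg _).trans (hb 0)
      refine mul_le_mul (hb _) ?_ (Real.exp_pos _).le hb0
      rw [Real.exp_le_exp, inner_neg_left, inner_smul_left, conj_trivial]
      have : 0 ≤ h * ‖v‖ ^ 2 / 2 := by positivity
      linarith
  have hWint : ∫ z, W z ∂(stdGaussian G) = heat N h g y := by
    rw [heat, integral_stdGaussian_shift (fun z => g (y + √h • N z)) (√h • v)]
    congr 1; ext z
    have h1 : y + √h • N (z + √h • v) = y + √h • N z + h • N v := by
      rw [map_add, map_smul, smul_add, smul_smul, Real.mul_self_sqrt hh.le, add_assoc]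
    have h2 : ‖√h • v‖ ^ 2 = h * ‖v‖ ^ 2 := by
      rw [norm_smul, mul_pow, Real.norm_of_nonneg (Real.sqrt_nonneg _), Real.sq_sqrt hh.le]
    rw [h1, h2, inner_smul_left, conj_trivial]
  set e := heat N h g y with he
  have he0 : 0 < e := heat_pos N h hg hb hpos y
  refine ⟨fun z => (Real.log e - 1 + h * ‖v‖ ^ 2 / 2) + W z / e + √h * ⟪v, z⟫, ?_, ?_, ?_⟩
  · exact ((integrable_const _).add (hWi.div_const e)).add
      ((integrable_inner_stdGaussian v).const_mul _)
  · intro z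
    have h1 : 0 < W z / e := by have := hpos (y + √h • N z + h • N v); positivity
    have h2 := Real.log_le_sub_one_of_pos h1
    rw [Real.log_div (by have := hpos (y + √h • N z + h • N v); positivity) he0.ne', hW] at h2
    simp only at h2
    rw [Real.log_mul (hpos _).ne' (Real.exp_pos _).ne', Real.log_exp] at h2
    simp only [hW]
    linarith
  · have hA : Integrable (fun z => (Real.log e - 1 + h * ‖v‖ ^ 2 / 2) + W z / e)
        (stdGaussian G) := (integrable_const _).add (hWi.div_const e)
    rw [integral_add hA ((integrable_inner_stdGaussian v).const_mul _),
      integral_add (integrable_const _) (hWi.div_const e), integral_const_mul,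
      integral_inner_stdGaussian, integral_div, hWint, div_self he0.ne']
    simp only [integral_const, probReal_univ, one_smul]
    ring

end Heat

section Flow

variable {k m : ℕ}
  {E : Fin k → Type*} {F : Fin m → Type*}
  [∀ i, NormedAddCommGroup (E i)] [∀ i, InnerProductSpace ℝ (E i)]
  [∀ i, FiniteDimensional ℝ (E i)]
  [∀ i, MeasurableSpace (E i)] [∀ i, BorelSpace (E i)]
  [∀ j, NormedAddCommGroup (F j)] [∀ j, InnerProductSpace ℝ (F j)]
  [∀ j, FiniteDimensional ℝ (F j)]
  [∀ j, MeasurableSpace (F j)] [∀ j, BorelSpace (F j)]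
  {G : Type*} [NormedAddCommGroup G] [InnerProductSpace ℝ G]
  [FiniteDimensional ℝ G] [MeasurableSpace G] [BorelSpace G]

/-- The compatibility of the driving maps `M`, `N` with the weights `a`, `d`. -/
def FlowCond (a : Fin k → ℝ) (d : Fin m → ℝ) (A : ∀ i j, E i →L[ℝ] F j)
    (M : ∀ i, G →L[ℝ] E i) (N : ∀ j, G →L[ℝ] F j) : Prop :=
  (∀ j z, N j z = ∑ i, A i j (M i z)) ∧
  ∀ q : Fin k → G, ∃ v : Fin m → G, (∀ j, N j (v j) = ∑ i, A i j (M i (q i))) ∧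
    ∑ j, d j * ‖v j‖ ^ 2 ≤ ∑ i, a i * ‖q i‖ ^ 2

variable {a : Fin k → ℝ} {d : Fin m → ℝ} {A : ∀ i j, E i →L[ℝ] F j}
  {M : ∀ i, G →L[ℝ] E i} {N : ∀ j, G →L[ℝ] F j}

lemma flow_step (ha : ∀ i, 0 < a i) (hd : ∀ j, 0 < d j) (hMN : FlowCond a d A M N) (L K : ℝ) :
    ∃ C : ℝ, ∀ᶠ h in nhdsWithin (0 : ℝ) (Set.Ioi 0),
      ∀ (f : ∀ i, E i → ℝ) (g : ∀ j, F j → ℝ) (e b : ℝ),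
        (∀ i, Measurable (f i)) → (∀ i, SemiSmooth L K (f i)) →
        (∀ j, Measurable (g j)) → (∀ j y, 0 < g j y) → (∀ j y, |g j y| ≤ b) →
        (∀ x : ∀ i, E i, ∑ i, a i * Real.log (f i (x i)) ≤
          ∑ j, d j * Real.log (g j (∑ i, A i j (x i))) + e) →
        ∀ x : ∀ i, E i, ∑ i, a i * Real.log (heat (M i) h (f i) (x i)) ≤
          ∑ j, d j * Real.log (heat (N j) h (g j) (∑ i, A i j (x i))) + (e + C * h ^ 2) := by
  choose C hC0 hC using fun i => heat_upper_step (M i) L K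
  refine ⟨∑ i, a i * C i, ?_⟩
  filter_upwards [Filter.eventually_all.2 hC, self_mem_nhdsWithin] with h hF hh
    f g e b hfm hf hgm hg hgb hdom x
  have hh : 0 < h := hh
  choose q hqi hq using fun i => hF i (f i) (hfm i) (hf i) (x i)
  obtain ⟨v, hv, hvq⟩ := hMN.2 q
  choose H hHi hH hHint using fun j =>
    heat_lower_step (N j) hh (hgm j) (hg j) (hgb j) (∑ i, A i j (x i)) (v j)
  have hpt : ∀ z, ∑ i, a i * Real.log (f i (x i + √h • M i z + h • M i (q i))) ≤
      ∑ j, d j * H j z + e := by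
    intro z
    refine (hdom fun i => x i + √h • M i z + h • M i (q i)).trans ?_
    gcongr with j
    · exact (hd j).le
    · refine le_trans (le_of_eq ?_) (hH j z)
      congr 2
      rw [hv j, hMN.1 j z]
      simp only [map_add, map_smul, Finset.sum_add_distrib, Finset.smul_sum]
  have h1 : Integrable (fun z => ∑ i, a i * Real.log (f i (x i + √h • M i z + h • M i (q i))))
      (stdGaussian G) := integrable_finsetSum _ fun i _ => (hqi i).const_mul _
  have h2 : Integrable (fun z => ∑ j, d j * H j z) (stdGaussian G) :=
    integrable_finsetSum _ fun j _ => (hHi j).const_mul _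
  have h3 := integral_mono h1 (h2.add (integrable_const e)) hpt
  simp only [Pi.add_apply] at h3
  rw [integral_add h2 (integrable_const e), integral_finsetSum _ fun i _ => (hqi i).const_mul _,
    integral_finsetSum _ fun j _ => (hHi j).const_mul _] at h3
  simp only [integral_const_mul, hHint, integral_const, probReal_univ, one_smul] at h3
  have h4 : ∑ i, a i * Real.log (heat (M i) h (f i) (x i)) ≤
      ∑ i, (a i * ∫ z, Real.log (f i (x i + √h • M i z + h • M i (q i))) ∂(stdGaussian G)
        - h / 2 * (a i * ‖q i‖ ^ 2) + a i * C i * h ^ 2) := by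
    gcongr with i
    have := mul_le_mul_of_nonneg_left (hq i) (ha i).le
    linarith
  rw [Finset.sum_add_distrib, Finset.sum_sub_distrib, ← Finset.mul_sum, ← Finset.sum_mul] at h4
  have h5 : ∑ j, d j * (Real.log (heat (N j) h (g j) (∑ i, A i j (x i))) + h * ‖v j‖ ^ 2 / 2) =
      ∑ j, d j * Real.log (heat (N j) h (g j) (∑ i, A i j (x i))) +
        h / 2 * ∑ j, d j * ‖v j‖ ^ 2 := by
    rw [Finset.mul_sum, ← Finset.sum_add_distrib]
    exact Finset.sum_congr rfl fun j _ => by ring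
  rw [h5] at h3
  have h6 : h / 2 * ∑ j, d j * ‖v j‖ ^ 2 ≤ h / 2 * ∑ i, a i * ‖q i‖ ^ 2 := by gcongr
  linarith

theorem flow (ha : ∀ i, 0 < a i) (hd : ∀ j, 0 < d j) (hMN : FlowCond a d A M N)
    {L K b e : ℝ} {f : ∀ i, E i → ℝ} {g : ∀ j, F j → ℝ}
    (hfm : ∀ i, Measurable (f i)) (hfb : ∀ i x, |f i x| ≤ b)
    (hf : ∀ i t, 0 ≤ t → SemiSmooth L K (heat (M i) t (f i)))
    (hgm : ∀ j, Measurable (g j)) (hg : ∀ j y, 0 < g j y) (hgb : ∀ j y, |g j y| ≤ b)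
    (hdom : ∀ x : ∀ i, E i, ∑ i, a i * Real.log (f i (x i)) ≤
      ∑ j, d j * Real.log (g j (∑ i, A i j (x i))) + e)
    {T : ℝ} (hT : 0 < T) (x : ∀ i, E i) :
    ∑ i, a i * Real.log (heat (M i) T (f i) (x i)) ≤
      ∑ j, d j * Real.log (heat (N j) T (g j) (∑ i, A i j (x i))) + e := by
  obtain ⟨C, hC⟩ := flow_step ha hd hMN L K
  have ht : Filter.Tendsto (fun n : ℕ => T / (n : ℝ)) Filter.atTop
      (nhdsWithin (0 : ℝ) (Set.Ioi 0)) := by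
    refine tendsto_nhdsWithin_iff.2 ⟨tendsto_const_div_atTop_nhds_zero_nat T, ?_⟩
    filter_upwards [Filter.eventually_gt_atTop 0] with n hn
    exact div_pos hT (by exact_mod_cast hn)
  have hlim : Filter.Tendsto (fun n : ℕ => ∑ j, d j * Real.log (heat (N j) T (g j)
      (∑ i, A i j (x i))) + (e + C * T * (T / (n : ℝ)))) Filter.atTop
      (nhds (∑ j, d j * Real.log (heat (N j) T (g j) (∑ i, A i j (x i))) +
        (e + C * T * 0))) :=
    (((tendsto_const_div_atTop_nhds_zero_nat T).const_mul _).const_add _).const_add _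
  rw [mul_zero, add_zero] at hlim
  refine ge_of_tendsto hlim ?_
  filter_upwards [ht.eventually hC, Filter.eventually_gt_atTop 0] with n hn hn0
  have hn0' : (0 : ℝ) < n := by exact_mod_cast hn0
  set h := T / (n : ℝ) with hh
  have hhpos : 0 < h := div_pos hT hn0'
  have key : ∀ r : ℕ, ∀ x : ∀ i, E i, ∑ i, a i * Real.log (heat (M i) (r * h) (f i) (x i)) ≤
      ∑ j, d j * Real.log (heat (N j) (r * h) (g j) (∑ i, A i j (x i))) +
        (e + r * (C * h ^ 2)) := by
    intro r
    induction r with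
    | zero => intro x; simpa [heat_zero] using hdom x
    | succ r ih =>
      intro x
      have hr : 0 ≤ r * h := by positivity
      have := hn (fun i => heat (M i) (r * h) (f i)) (fun j => heat (N j) (r * h) (g j)) _ b
        (fun i => measurable_heat _ _ (hfm i)) (fun i => hf i _ hr)
        (fun j => measurable_heat _ _ (hgm j)) (fun j => heat_pos _ _ (hgm j) (hgb j) (hg j))
        (fun j => abs_heat_le _ _ (hgb j)) ih x
      simp only [heat_heat (M _) hhpos.le hr (hfm _) (hfb _),
        heat_heat (N _) hhpos.le hr (hgm _) (hgb _)] at this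
      have e1 : h + r * h = (r + 1 : ℕ) * h := by push_cast; ring
      rw [e1] at this
      refine this.trans (le_of_eq ?_)
      push_cast; ring
  have := key n x
  have e2 : (n : ℝ) * h = T := by rw [hh]; field_simp
  rw [e2] at this
  refine this.trans (le_of_eq ?_)
  rw [← e2]; ring

end Flow

end FRBL

namespace FRBL

section Mixture

variable {G X : Type*} [NormedAddCommGroup G] [InnerProductSpace ℝ G]
  [FiniteDimensional ℝ G] [MeasurableSpace G] [BorelSpace G]
  [NormedAddCommGroup X] [InnerProductSpace ℝ X]
  [FiniteDimensional ℝ X] [MeasurableSpace X] [BorelSpace X]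

/-- The mixture of the translates of `κ` with mixing measure `ρ`. -/
def mix (κ : X → ℝ) (ρ : Measure X) (x : X) : ℝ := ∫ y, κ (x + y) ∂ρ

lemma exp_le_self_add_exp_sq (u : ℝ) : Real.exp u ≤ u + Real.exp (u ^ 2) := by
  rcases le_or_gt |u| 1 with h | h
  · have h1 := Real.abs_exp_sub_one_sub_id_le h
    have h2 := Real.add_one_le_exp (u ^ 2)
    linarith [le_abs_self (Real.exp u - 1 - u)]
  · rcases lt_abs.1 h with h | h
    · have : Real.exp u ≤ Real.exp (u ^ 2) := by
        rw [Real.exp_le_exp]; nlinarith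
      linarith
    · have h1 : Real.exp u ≤ 1 := Real.exp_le_one_iff.2 (by linarith)
      have h2 := Real.add_one_le_exp (u ^ 2)
      nlinarith

lemma measurable_mix {κ : X → ℝ} (hκ : Measurable κ) (ρ : Measure X) [IsFiniteMeasure ρ] :
    Measurable (mix κ ρ) := by
  have h : Measurable (Function.uncurry fun (x y : X) => κ (x + y)) :=
    hκ.comp (by fun_prop)
  exact (h.stronglyMeasurable.integral_prod_right (ν := ρ)).measurable

lemma semiSmooth_mix {L K b : ℝ} {κ : X → ℝ} (hκ : Measurable κ) (hκ0 : ∀ x, 0 < κ x)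
    (hκb : ∀ x, κ x ≤ b) {p : X → X} (hp : Measurable p) (hpL : ∀ x, ‖p x‖ ≤ L)
    (hpK : ∀ x w, |Real.log (κ (x + w)) - Real.log (κ x) - ⟪p x, w⟫| ≤ K * ‖w‖ ^ 2)
    (ρ : Measure X) [IsFiniteMeasure ρ] [NeZero ρ] :
    SemiSmooth L (K + 4 * L ^ 2) (mix κ ρ) := by
  have hab : ∀ x, |κ x| ≤ b := fun x => by rw [abs_of_pos (hκ0 x)]; exact hκb x
  have hi : ∀ x, Integrable (fun y => κ (x + y)) ρ := fun x =>
    integrable_of_bounded (hκ.comp (by fun_prop)) fun _ => hab _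
  have hpos : ∀ x, 0 < mix κ ρ x := fun x => integral_pos_of_forall_pos (hi x) fun _ => hκ0 _
  refine ⟨hpos, fun x => ?_⟩
  set Z := mix κ ρ x with hZ
  have hZ0 : 0 < Z := hpos x
  have hL0 : 0 ≤ L := (norm_nonneg _).trans (hpL 0)
  have hb0 : 0 ≤ b := (hκ0 0).le.trans (hκb 0)
  have hpi : Integrable (fun y => κ (x + y) • p (x + y)) ρ := by
    refine Integrable.of_bound (C := b * L) ?_ (Filter.Eventually.of_forall fun y => ?_)
    · exact ((hκ.comp (by fun_prop)).smul (hp.comp (by fun_prop))).aestronglyMeasurable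
    · rw [norm_smul, Real.norm_eq_abs]
      exact mul_le_mul (hab _) (hpL _) (norm_nonneg _) hb0
  set P : X := Z⁻¹ • ∫ y, κ (x + y) • p (x + y) ∂ρ with hP
  have hPL : ‖P‖ ≤ L := by
    rw [hP, norm_smul, norm_inv, Real.norm_of_nonneg hZ0.le, inv_mul_le_iff₀ hZ0]
    refine (norm_integral_le_integral_norm _).trans ?_
    rw [hZ, mix, ← integral_mul_const]
    refine integral_mono hpi.norm ((hi x).mul_const L) fun y => ?_
    simp only
    rw [norm_smul, Real.norm_of_nonneg (hκ0 _).le]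
    exact mul_le_mul_of_nonneg_left (hpL _) (hκ0 _).le
  refine ⟨P, hPL, fun w => ?_⟩
  set t : X → ℝ := fun y => ⟪p (x + y) - P, w⟫ with ht
  have hti : Integrable (fun y => κ (x + y) * t y) ρ := by
    have h1 := (hpi.inner_const w).sub ((hi x).mul_const ⟪P, w⟫)
    refine h1.congr (Filter.Eventually.of_forall fun y => ?_)
    simp only [Pi.sub_apply, ht, inner_sub_left, inner_smul_left, conj_trivial]
    ring
  have htint : ∫ y, κ (x + y) * t y ∂ρ = 0 := by
    have h1 : ∀ y, κ (x + y) * t y = ⟪κ (x + y) • p (x + y), w⟫ - κ (x + y) * ⟪P, w⟫ := by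
      intro y
      simp only [ht, inner_sub_left, inner_smul_left, conj_trivial]
      ring
    have h3 : ∫ y, κ (x + y) • p (x + y) ∂ρ = Z • P := by
      rw [hP, smul_smul, mul_inv_cancel₀ hZ0.ne', one_smul]
    simp_rw [h1]
    rw [integral_sub (hpi.inner_const w) ((hi x).mul_const _), integral_mul_const]
    have h2 : ∫ y, ⟪κ (x + y) • p (x + y), w⟫ ∂ρ = ⟪∫ y, κ (x + y) • p (x + y) ∂ρ, w⟫ := by
      simp_rw [real_inner_comm w]
      exact integral_inner hpi w
    rw [h2, h3, inner_smul_left, conj_trivial]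
    simp [hZ, mix]
  have htb : ∀ y, |t y| ≤ 2 * L * ‖w‖ := by
    intro y
    refine (abs_real_inner_le_norm _ _).trans ?_
    gcongr
    refine (norm_sub_le _ _).trans ?_
    linarith [hpL (x + y)]
  set Λ := ⟪P, w⟫ with hΛ
  have hs : ∀ y, κ (x + w + y) = κ (x + y) *
      Real.exp (Real.log (κ (x + y + w)) - Real.log (κ (x + y))) := by
    intro y
    rw [Real.exp_sub, Real.exp_log (hκ0 _), Real.exp_log (hκ0 _),
      mul_div_cancel₀ _ (hκ0 (x + y)).ne', add_right_comm]
  have hst : ∀ y, |Real.log (κ (x + y + w)) - Real.log (κ (x + y)) - (t y + Λ)|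
      ≤ K * ‖w‖ ^ 2 := by
    intro y
    have := hpK (x + y) w
    have h2 : t y + Λ = ⟪p (x + y), w⟫ := by simp only [ht, hΛ, inner_sub_left]; ring
    rwa [h2]
  have hup : mix κ ρ (x + w) ≤ Z * Real.exp (Λ + (K + 4 * L ^ 2) * ‖w‖ ^ 2) := by
    have hpt : ∀ y, κ (x + w + y) ≤ Real.exp (Λ + K * ‖w‖ ^ 2) *
        (κ (x + y) * t y + κ (x + y) * Real.exp (4 * L ^ 2 * ‖w‖ ^ 2)) := by
      intro y
      rw [hs y]
      have h1 : Real.exp (Real.log (κ (x + y + w)) - Real.log (κ (x + y))) ≤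
          Real.exp (Λ + K * ‖w‖ ^ 2) * Real.exp (t y) := by
        rw [← Real.exp_add, Real.exp_le_exp]
        have := (abs_le.1 (hst y)).2
        linarith
      have h2 : Real.exp (t y) ≤ t y + Real.exp (4 * L ^ 2 * ‖w‖ ^ 2) := by
        refine (exp_le_self_add_exp_sq (t y)).trans ?_
        gcongr
        rw [← sq_abs]
        refine (pow_le_pow_left₀ (abs_nonneg _) (htb y) 2).trans_eq ?_
        ring
      have h3 := h1.trans (mul_le_mul_of_nonneg_left h2 (Real.exp_pos _).le)
      have h4 := mul_le_mul_of_nonneg_left h3 (hκ0 (x + y)).le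
      linarith
    have h5 := integral_mono (hi (x + w))
      ((hti.add ((hi x).mul_const (Real.exp (4 * L ^ 2 * ‖w‖ ^ 2)))).const_mul
        (Real.exp (Λ + K * ‖w‖ ^ 2))) hpt
    simp only [Pi.add_apply] at h5
    rw [integral_const_mul, integral_add hti ((hi x).mul_const _), htint,
      integral_mul_const, zero_add] at h5
    refine h5.trans_eq ?_
    rw [show Λ + (K + 4 * L ^ 2) * ‖w‖ ^ 2 = (Λ + K * ‖w‖ ^ 2) + 4 * L ^ 2 * ‖w‖ ^ 2 by ring,
      Real.exp_add (Λ + K * ‖w‖ ^ 2)]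
    simp only [hZ, mix]
    ring
  have hlow : Z * Real.exp (Λ - K * ‖w‖ ^ 2) ≤ mix κ ρ (x + w) := by
    have hpt : ∀ y, Real.exp (Λ - K * ‖w‖ ^ 2) * (κ (x + y) + κ (x + y) * t y) ≤
        κ (x + w + y) := by
      intro y
      rw [hs y]
      have h1 : Real.exp (Λ - K * ‖w‖ ^ 2) * Real.exp (t y) ≤
          Real.exp (Real.log (κ (x + y + w)) - Real.log (κ (x + y))) := by
        rw [← Real.exp_add, Real.exp_le_exp]
        have := (abs_le.1 (hst y)).1
        linarith
      have h2 := Real.add_one_le_exp (t y)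
      have h3 := (mul_le_mul_of_nonneg_left h2 (Real.exp_pos (Λ - K * ‖w‖ ^ 2)).le).trans h1
      have h4 := mul_le_mul_of_nonneg_left h3 (hκ0 (x + y)).le
      linarith
    have h5 := integral_mono (((hi x).add hti).const_mul (Real.exp (Λ - K * ‖w‖ ^ 2)))
      (hi (x + w)) hpt
    simp only [Pi.add_apply] at h5
    rw [integral_const_mul, integral_add (hi x) hti, htint, add_zero] at h5
    simp only [hZ, mix] at h5 ⊢
    linarith
  have hl1 := Real.log_le_log (hpos _) hup
  have hl2 := Real.log_le_log (by positivity) hlow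
  rw [Real.log_mul hZ0.ne' (Real.exp_pos _).ne', Real.log_exp] at hl1 hl2
  rw [abs_le]
  constructor <;> nlinarith [mul_nonneg (sq_nonneg L) (sq_nonneg ‖w‖)]

lemma heat_mix (M : G →L[ℝ] X) (t : ℝ) {b : ℝ} {κ : X → ℝ} (hκ : Measurable κ)
    (hκb : ∀ x, |κ x| ≤ b) (ρ : Measure X) [IsFiniteMeasure ρ] :
    heat M t (mix κ ρ) = mix κ (((stdGaussian G).map (√t • M)) ∗ ρ) := by
  have h1 := Measure.isProbabilityMeasure_map (μ := stdGaussian G) (f := √t • M) (by fun_prop)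
  ext x
  rw [heat_eq_integral_map M t (measurable_mix hκ ρ), mix, integral_conv]
  · simp only [mix, add_assoc]
  · exact integrable_of_bounded (hκ.comp (by fun_prop)) fun _ => hκb _

lemma semiSmooth_heat_mix {L K b : ℝ} {κ : X → ℝ} (hκ : Measurable κ) (hκ0 : ∀ x, 0 < κ x)
    (hκb : ∀ x, κ x ≤ b) {p : X → X} (hp : Measurable p) (hpL : ∀ x, ‖p x‖ ≤ L)
    (hpK : ∀ x w, |Real.log (κ (x + w)) - Real.log (κ x) - ⟪p x, w⟫| ≤ K * ‖w‖ ^ 2)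
    (ρ : Measure X) [IsFiniteMeasure ρ] [NeZero ρ] (M : G →L[ℝ] X) (t : ℝ) :
    SemiSmooth L (K + 4 * L ^ 2) (heat M t (mix κ ρ)) := by
  have h1 := Measure.isProbabilityMeasure_map (μ := stdGaussian G) (f := √t • M) (by fun_prop)
  rw [heat_mix M t hκ (b := b) (fun x => by rw [abs_of_pos (hκ0 x)]; exact hκb x)]
  have : NeZero (((stdGaussian G).map (√t • M)) ∗ ρ) := by
    refine ⟨fun h => NeZero.ne ρ ?_⟩
    rw [← Measure.measure_univ_eq_zero] at h ⊢
    rw [Measure.conv, Measure.map_apply (by fun_prop) MeasurableSet.univ, Set.preimage_univ,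
      Measure.prod_apply MeasurableSet.univ] at h
    simpa using h
  exact semiSmooth_mix hκ hκ0 hκb hp hpL hpK _

/-- The polynomially decaying kernel at scale `δ`. -/
def ker (q : ℕ) (δ : ℝ) (x : X) : ℝ := ((1 + ‖δ⁻¹ • x‖ ^ 2) ^ q)⁻¹

lemma ker_pos (q : ℕ) (δ : ℝ) (x : X) : 0 < ker q δ x := by unfold ker; positivity

lemma ker_le_one (q : ℕ) (δ : ℝ) (x : X) : ker q δ x ≤ 1 := by
  unfold ker
  refine inv_le_one_of_one_le₀ (one_le_pow₀ ?_)
  nlinarith [sq_nonneg ‖δ⁻¹ • x‖]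

lemma continuous_ker (q : ℕ) (δ : ℝ) : Continuous (ker (X := X) q δ) := by
  unfold ker
  refine Continuous.inv₀ (by fun_prop) fun x => by positivity

lemma abs_log_one_add_norm_sq_sub_le (u w : X) :
    |Real.log (1 + ‖u + w‖ ^ 2) - Real.log (1 + ‖u‖ ^ 2) - 2 * ⟪u, w⟫ / (1 + ‖u‖ ^ 2)|
      ≤ ‖w‖ ^ 2 := by
  have hA : 0 < 1 + ‖u‖ ^ 2 := by positivity
  have hB : 0 < 1 + ‖u + w‖ ^ 2 := by positivity
  have hsq := norm_add_sq_real u w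
  have h1 := Real.log_le_sub_one_of_pos (div_pos hB hA)
  have h2 := Real.one_sub_inv_le_log_of_pos (div_pos hB hA)
  rw [Real.log_div hB.ne' hA.ne'] at h1 h2
  rw [inv_div] at h2
  have hw : ‖w‖ ^ 2 / (1 + ‖u‖ ^ 2) ≤ ‖w‖ ^ 2 :=
    div_le_self (sq_nonneg _) (by nlinarith [sq_nonneg ‖u‖])
  have e1 : (1 + ‖u + w‖ ^ 2) / (1 + ‖u‖ ^ 2) - 1 =
      2 * ⟪u, w⟫ / (1 + ‖u‖ ^ 2) + ‖w‖ ^ 2 / (1 + ‖u‖ ^ 2) := by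
    rw [hsq]; field_simp; ring
  have hd : (‖u + w‖ ^ 2 - ‖u‖ ^ 2) ^ 2 ≤ ‖w‖ ^ 2 * ((1 + ‖u‖ ^ 2) * (1 + ‖u + w‖ ^ 2)) := by
    have h3 : |‖u + w‖ - ‖u‖| ≤ ‖w‖ := by
      simpa using abs_norm_sub_norm_le (u + w) u
    have h4 : (‖u + w‖ - ‖u‖) ^ 2 ≤ ‖w‖ ^ 2 := by
      rw [← sq_abs]; exact pow_le_pow_left₀ (abs_nonneg _) h3 2
    have h5 : (‖u + w‖ + ‖u‖) ^ 2 ≤ (1 + ‖u‖ ^ 2) * (1 + ‖u + w‖ ^ 2) := by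
      nlinarith [sq_nonneg (‖u‖ * ‖u + w‖ - 1)]
    calc _ = (‖u + w‖ - ‖u‖) ^ 2 * (‖u + w‖ + ‖u‖) ^ 2 := by ring
      _ ≤ _ := by gcongr
  have e2 : (1 + ‖u + w‖ ^ 2) / (1 + ‖u‖ ^ 2) - 1 - (1 - (1 + ‖u‖ ^ 2) / (1 + ‖u + w‖ ^ 2)) =
      (‖u + w‖ ^ 2 - ‖u‖ ^ 2) ^ 2 / ((1 + ‖u‖ ^ 2) * (1 + ‖u + w‖ ^ 2)) := by
    field_simp; ring
  have h6 : (‖u + w‖ ^ 2 - ‖u‖ ^ 2) ^ 2 / ((1 + ‖u‖ ^ 2) * (1 + ‖u + w‖ ^ 2)) ≤ ‖w‖ ^ 2 := by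
    rw [div_le_iff₀ (by positivity)]; exact hd
  have h7 : 0 ≤ ‖w‖ ^ 2 / (1 + ‖u‖ ^ 2) := by positivity
  rw [abs_le]
  constructor <;> linarith

lemma log_ker (q : ℕ) (δ : ℝ) (x : X) :
    Real.log (ker q δ x) = -(q * Real.log (1 + ‖δ⁻¹ • x‖ ^ 2)) := by
  rw [ker, Real.log_inv, Real.log_pow]

/-- The mixtures of the polynomial kernel, and their heat evolutions, are uniformly
semi-smooth. -/
lemma exists_semiSmooth_heat_mix_ker (q : ℕ) (δ : ℝ) :
    ∃ L K : ℝ, 0 ≤ L ∧ 0 ≤ K ∧ ∀ (ρ : Measure X) [IsFiniteMeasure ρ] [NeZero ρ] (M : G →L[ℝ] X)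
      (t : ℝ), SemiSmooth L K (heat M t (mix (ker q δ) ρ)) := by
  refine ⟨q * |δ⁻¹|, q * δ⁻¹ ^ 2 + 4 * (q * |δ⁻¹|) ^ 2, by positivity, by positivity,
    fun ρ _ _ M t => ?_⟩
  refine semiSmooth_heat_mix (b := 1) (continuous_ker q δ).measurable (ker_pos q δ)
    (ker_le_one q δ)
    (p := fun x => (-(q * (2 * δ⁻¹ / (1 + ‖δ⁻¹ • x‖ ^ 2)))) • (δ⁻¹ • x)) ?_ ?_ ?_ ρ M t
  · have : Continuous fun x : X => (-(q * (2 * δ⁻¹ / (1 + ‖δ⁻¹ • x‖ ^ 2)))) • (δ⁻¹ • x) := by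
      refine Continuous.smul (Continuous.neg (continuous_const.mul
        (Continuous.div continuous_const (by fun_prop) fun x => by positivity))) (by fun_prop)
    exact this.measurable
  · intro x
    rw [norm_smul, norm_neg, Real.norm_eq_abs, abs_mul, abs_div, abs_mul, abs_two,
      abs_of_nonneg (Nat.cast_nonneg q),
      abs_of_pos (show (0 : ℝ) < 1 + ‖δ⁻¹ • x‖ ^ 2 by positivity), mul_assoc]
    gcongr
    rw [div_mul_eq_mul_div, div_le_iff₀ (by positivity)]
    nlinarith [mul_nonneg (abs_nonneg δ⁻¹) (sq_nonneg (‖δ⁻¹ • x‖ - 1))]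
  · intro x w
    have h := abs_log_one_add_norm_sq_sub_le (δ⁻¹ • x) (δ⁻¹ • w)
    rw [log_ker, log_ker, smul_add]
    have e : -(↑q * Real.log (1 + ‖δ⁻¹ • x + δ⁻¹ • w‖ ^ 2)) -
        -(↑q * Real.log (1 + ‖δ⁻¹ • x‖ ^ 2)) -
        ⟪(-(q * (2 * δ⁻¹ / (1 + ‖δ⁻¹ • x‖ ^ 2)))) • (δ⁻¹ • x), w⟫ =
        -(q * (Real.log (1 + ‖δ⁻¹ • x + δ⁻¹ • w‖ ^ 2) - Real.log (1 + ‖δ⁻¹ • x‖ ^ 2) -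
          2 * ⟪δ⁻¹ • x, δ⁻¹ • w⟫ / (1 + ‖δ⁻¹ • x‖ ^ 2))) := by
      simp only [inner_smul_left, inner_smul_right, conj_trivial]
      ring
    rw [e, abs_neg, abs_mul, abs_of_nonneg (Nat.cast_nonneg q), mul_assoc]
    gcongr
    rw [norm_smul δ⁻¹ w, mul_pow, Real.norm_eq_abs, sq_abs] at h
    exact h

end Mixture

end FRBL

namespace FRBL

variable {X : Type*} [NormedAddCommGroup X] [InnerProductSpace ℝ X] [FiniteDimensional ℝ X]

/-- Symmetric positive semidefinite operators. -/
def Psd (A : X →L[ℝ] X) : Prop :=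
  (∀ x y, ⟪A x, y⟫ = ⟪x, A y⟫) ∧ ∀ x, 0 ≤ ⟪A x, x⟫

/-- Symmetric positive definite operators. -/
def Pos (A : X →L[ℝ] X) : Prop :=
  (∀ x y, ⟪A x, y⟫ = ⟪x, A y⟫) ∧ ∀ x, x ≠ 0 → 0 < ⟪A x, x⟫

/-- The trace of a continuous operator. -/
def tr : (X →L[ℝ] X) →ₗ[ℝ] ℝ := LinearMap.trace ℝ X ∘ₗ ContinuousLinearMap.coeLM ℝ

/-- The rank one operator `p ⊗ p`. -/
def dyad (p : X) : X →L[ℝ] X := InnerProductSpace.rankOne ℝ p p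

lemma dyad_apply (p x : X) : dyad p x = ⟪p, x⟫ • p := by simp [dyad]

lemma tr_dyad (p : X) : tr (dyad p) = ‖p‖ ^ 2 := by
  simp only [tr, dyad, LinearMap.comp_apply, ContinuousLinearMap.coeLM_apply]
  rw [InnerProductSpace.trace_rankOne, real_inner_self_eq_norm_sq]

lemma continuous_tr : Continuous (tr : (X →L[ℝ] X) → ℝ) :=
  LinearMap.continuous_of_finiteDimensional _

lemma Pos.psd {A : X →L[ℝ] X} (hA : Pos A) : Psd A := by
  refine ⟨hA.1, fun x => ?_⟩
  rcases eq_or_ne x 0 with rfl | hx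
  · simp
  · exact (hA.2 x hx).le

lemma Psd.exists_diag {A : X →L[ℝ] X} (hA : Psd A) :
    ∃ (b : OrthonormalBasis (Fin (Module.finrank ℝ X)) ℝ X) (l : Fin (Module.finrank ℝ X) → ℝ),
      (∀ a, 0 ≤ l a) ∧ (∀ a, A (b a) = l a • b a) ∧ A.det = ∏ a, l a ∧ tr A = ∑ a, l a := by
  have hs : (A : X →ₗ[ℝ] X).IsSymmetric := hA.1
  refine ⟨hs.eigenvectorBasis rfl, hs.eigenvalues rfl, fun a => ?_, fun a => ?_, ?_, ?_⟩
  · have h := hA.2 (hs.eigenvectorBasis rfl a)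
    have h2 := hs.apply_eigenvectorBasis rfl a
    rw [ContinuousLinearMap.coe_coe] at h2
    rw [h2, real_inner_smul_left, real_inner_self_eq_norm_sq] at h
    simpa using h
  · exact hs.apply_eigenvectorBasis rfl a
  · simpa using hs.det_eq_prod_eigenvalues rfl
  · simpa [tr] using hs.trace_eq_sum_eigenvalues rfl

lemma Psd.inner_eq_sum {A : X →L[ℝ] X} (hA : Psd A)
    {b : OrthonormalBasis (Fin (Module.finrank ℝ X)) ℝ X} {l : Fin (Module.finrank ℝ X) → ℝ}
    (h : ∀ a, A (b a) = l a • b a) (x : X) : ⟪A x, x⟫ = ∑ a, l a * ⟪b a, x⟫ ^ 2 := by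
  rw [← b.sum_inner_mul_inner]
  refine Finset.sum_congr rfl fun a _ => ?_
  rw [hA.1, h, real_inner_smul_right, real_inner_comm]
  ring

lemma Psd.exists_sqrt {A : X →L[ℝ] X} (hA : Psd A) : ∃ R : X →L[ℝ] X, Psd R ∧ R * R = A := by
  obtain ⟨b, l, hl, hb, -, -⟩ := hA.exists_diag
  have happ : ∀ x, (∑ a, √(l a) • dyad (b a)) x = ∑ a, (√(l a) * ⟪b a, x⟫) • b a := by
    intro x
    simp [dyad_apply, smul_smul]
  have hbb : ∀ a, (∑ a, √(l a) • dyad (b a)) (b a) = √(l a) • b a := by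
    intro a
    rw [happ, Finset.sum_eq_single a]
    · simp
    · intro a' _ h
      simp [b.inner_eq_zero h]
    · simp
  refine ⟨∑ a, √(l a) • dyad (b a), ⟨fun x y => ?_, fun x => ?_⟩, ?_⟩
  · rw [happ, happ, sum_inner, inner_sum]
    refine Finset.sum_congr rfl fun a _ => ?_
    rw [real_inner_smul_left, real_inner_smul_right, real_inner_comm (b a) x]
    ring
  · rw [happ, sum_inner]
    refine Finset.sum_nonneg fun a _ => ?_
    rw [real_inner_smul_left, mul_assoc]
    exact mul_nonneg (Real.sqrt_nonneg _) (mul_self_nonneg _)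
  · refine ContinuousLinearMap.coe_injective (b.toBasis.ext fun a => ?_)
    simp only [OrthonormalBasis.coe_toBasis, ContinuousLinearMap.coe_coe,
      mul_apply_eq_comp]
    rw [hbb, map_smul, hbb, smul_smul, Real.mul_self_sqrt (hl a), hb]

lemma Psd.det_nonneg {A : X →L[ℝ] X} (hA : Psd A) : 0 ≤ A.det := by
  obtain ⟨b, l, hl, hb, h, -⟩ := hA.exists_diag
  rw [h]
  exact Finset.prod_nonneg fun a _ => hl a

lemma Psd.tr_nonneg {A : X →L[ℝ] X} (hA : Psd A) : 0 ≤ tr A := by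
  obtain ⟨b, l, hl, hb, -, h⟩ := hA.exists_diag
  rw [h]
  exact Finset.sum_nonneg fun a _ => hl a

lemma Psd.det_le_pow {A : X →L[ℝ] X} (hA : Psd A) {C : ℝ} (hC : ∀ x, ⟪A x, x⟫ ≤ C * ‖x‖ ^ 2) :
    A.det ≤ C ^ Module.finrank ℝ X := by
  obtain ⟨b, l, hl, hb, h, -⟩ := hA.exists_diag
  rw [h]
  calc ∏ a, l a ≤ ∏ a : Fin (Module.finrank ℝ X), C := by
        refine Finset.prod_le_prod (fun a _ => hl a) fun a _ => ?_
        have := hC (b a)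
        rw [hb, real_inner_smul_left, real_inner_self_eq_norm_sq] at this
        simpa using this
    _ = _ := by simp

lemma Psd.inner_le_tr {A : X →L[ℝ] X} (hA : Psd A) (x : X) : ⟪A x, x⟫ ≤ tr A * ‖x‖ ^ 2 := by
  obtain ⟨b, l, hl, hb, -, h⟩ := hA.exists_diag
  rw [hA.inner_eq_sum hb, h, ← b.sum_sq_inner_right x, Finset.mul_sum]
  refine Finset.sum_le_sum fun a _ => ?_
  exact mul_le_mul_of_nonneg_right (Finset.single_le_sum (f := l) (fun a _ => hl a)
    (Finset.mem_univ a)) (by positivity)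

lemma Psd.det_le_tr_pow {A : X →L[ℝ] X} (hA : Psd A) : A.det ≤ tr A ^ Module.finrank ℝ X :=
  hA.det_le_pow hA.inner_le_tr

lemma Psd.norm_le_tr {A : X →L[ℝ] X} (hA : Psd A) : ‖A‖ ≤ tr A := by
  obtain ⟨R, hR, rfl⟩ := hA.exists_sqrt
  have h1 : ∀ x, ‖R x‖ ^ 2 = ⟪(R * R) x, x⟫ := fun x => by
    rw [mul_apply_eq_comp, hR.1, real_inner_self_eq_norm_sq]
  have h0 := hA.tr_nonneg
  have h2 : ∀ x, ‖R x‖ ≤ √(tr (R * R)) * ‖x‖ := fun x => by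
    refine abs_le_of_sq_le_sq' ?_ (by positivity) |>.2
    rw [h1, mul_pow, Real.sq_sqrt h0]
    exact hA.inner_le_tr x
  refine ContinuousLinearMap.opNorm_le_bound _ h0 fun x => ?_
  calc ‖R (R x)‖ ≤ √(tr (R * R)) * (√(tr (R * R)) * ‖x‖) :=
        (h2 _).trans (mul_le_mul_of_nonneg_left (h2 x) (Real.sqrt_nonneg _))
    _ = tr (R * R) * ‖x‖ := by rw [← mul_assoc, Real.mul_self_sqrt h0]

lemma isUnit_of_injective {A : X →L[ℝ] X} (h : Function.Injective A) : IsUnit A := by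
  let e := (LinearEquiv.ofInjectiveEndo (A : X →ₗ[ℝ] X) h).toContinuousLinearEquiv
  refine ⟨⟨A, (e.symm : X →L[ℝ] X), ?_, ?_⟩, rfl⟩
  · ext x
    exact e.apply_symm_apply x
  · ext x
    exact e.symm_apply_apply x

lemma Pos.isUnit {A : X →L[ℝ] X} (hA : Pos A) : IsUnit A := by
  refine isUnit_of_injective ((injective_iff_map_eq_zero A).2 fun x hx => ?_)
  by_contra h
  have := hA.2 x h
  simp [hx] at this

lemma Pos.det_pos {A : X →L[ℝ] X} (hA : Pos A) : 0 < A.det := by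
  refine lt_of_le_of_ne hA.psd.det_nonneg fun h => ?_
  obtain ⟨B, hB⟩ := hA.isUnit.exists_right_inv
  have h1 : (A * B).det = A.det * B.det := LinearMap.det_comp _ _
  rw [hB, ← h, zero_mul] at h1
  have h2 : (1 : X →L[ℝ] X).det = 1 := LinearMap.det_id
  linarith

lemma Psd.pos {A : X →L[ℝ] X} (hA : Psd A) (h : A.det ≠ 0) : Pos A := by
  refine ⟨hA.1, fun x hx => lt_of_le_of_ne (hA.2 x) fun h0 => h ?_⟩
  obtain ⟨R, hR, rfl⟩ := hA.exists_sqrt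
  rw [mul_apply_eq_comp, hR.1, eq_comm, inner_self_eq_zero] at h0
  by_contra h
  have hu : IsUnit ((R * R : X →L[ℝ] X) : X →ₗ[ℝ] X) :=
    (LinearMap.isUnit_iff_isUnit_det _).2 (isUnit_iff_ne_zero.2 h)
  have := ((Module.End.isUnit_iff _).1 hu).1 (a₁ := x) (a₂ := 0) (by simp [h0])
  exact hx this

/-- The inverse operator. -/
def opInv (A : X →L[ℝ] X) : X →L[ℝ] X := Ring.inverse A

lemma Pos.apply_opInv {A : X →L[ℝ] X} (hA : Pos A) (x : X) : A (opInv A x) = x :=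
  congrArg (fun B : X →L[ℝ] X => B x) (Ring.mul_inverse_cancel A hA.isUnit)

lemma Pos.opInv_apply {A : X →L[ℝ] X} (hA : Pos A) (x : X) : opInv A (A x) = x :=
  congrArg (fun B : X →L[ℝ] X => B x) (Ring.inverse_mul_cancel A hA.isUnit)

lemma Pos.opInv_pos {A : X →L[ℝ] X} (hA : Pos A) : Pos (opInv A) := by
  refine ⟨fun x y => ?_, fun x hx => ?_⟩
  · conv_lhs => rw [← hA.apply_opInv y]
    conv_rhs => rw [← hA.apply_opInv x]
    rw [hA.1]
  · have h : opInv A x ≠ 0 := fun h => hx (by rw [← hA.apply_opInv x, h, map_zero])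
    have := hA.2 _ h
    rwa [hA.apply_opInv, real_inner_comm] at this

lemma Pos.det_opInv {A : X →L[ℝ] X} (hA : Pos A) : (opInv A).det = A.det⁻¹ := by
  have h1 : (A * opInv A).det = A.det * (opInv A).det := LinearMap.det_comp _ _
  have h3 : A * opInv A = 1 := Ring.mul_inverse_cancel A hA.isUnit
  have h2 : (1 : X →L[ℝ] X).det = 1 := LinearMap.det_id
  rw [h3, h2] at h1
  exact eq_inv_of_mul_eq_one_right h1.symm

lemma Pos.sq_inner_le {A : X →L[ℝ] X} (hA : Pos A) (p x : X) :
    ⟪p, x⟫ ^ 2 ≤ ⟪opInv A p, p⟫ * ⟪A x, x⟫ := by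
  obtain ⟨R, hR, hRA⟩ := hA.psd.exists_sqrt
  have hA' : ∀ y, A y = R (R y) := fun y => by rw [← hRA]; rfl
  have h := real_inner_mul_inner_self_le (R (opInv A p)) (R x)
  rw [hR.1 _ (R x), hR.1 _ (R (opInv A p)), hR.1 _ (R x), ← hA', ← hA', ← hA.1,
    hA.apply_opInv, real_inner_comm (A x) x] at h
  rw [pow_two]
  exact h

lemma Pos.norm_sq_le {A : X →L[ℝ] X} (hA : Pos A) (p : X) :
    ‖p‖ ^ 2 ≤ tr A * ⟪opInv A p, p⟫ := by
  rcases eq_or_ne p 0 with rfl | hp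
  · simp
  have h1 := hA.sq_inner_le p p
  have h2 := hA.psd.inner_le_tr p
  rw [real_inner_self_eq_norm_sq] at h1
  have h3 := hA.opInv_pos.2 p hp
  have hp' : 0 < ‖p‖ ^ 2 := by positivity
  refine le_of_mul_le_mul_right ?_ hp'
  nlinarith [mul_le_mul_of_nonneg_left h2 h3.le]

lemma Pos.det_add_dyad {A : X →L[ℝ] X} (hA : Pos A) (s : ℝ) (p : X) :
    (A + s • dyad p).det = A.det * (1 + s * ⟪opInv A p, p⟫) := by
  have h : A + s • dyad p =
      A * (1 + s • InnerProductSpace.rankOne ℝ (opInv A p) p) := by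
    ext x
    simp [dyad_apply, hA.apply_opInv]
  rw [h]
  have h1 : ∀ B C : X →L[ℝ] X, (B * C).det = B.det * C.det := fun B C => LinearMap.det_comp _ _
  rw [h1]
  congr 1
  have h2 : ((1 + s • InnerProductSpace.rankOne ℝ (opInv A p) p : X →L[ℝ] X) : X →ₗ[ℝ] X) =
      LinearMap.transvection (innerₗ X p) (s • opInv A p) := by
    ext x
    simp [LinearMap.transvection, smul_comm s]
  rw [ContinuousLinearMap.det, h2, LinearMap.transvection.det]
  simp [real_inner_comm]

lemma Pos.add_dyad {A : X →L[ℝ] X} (hA : Pos A) {s : ℝ} {p : X}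
    (hs : |s| * ⟪opInv A p, p⟫ < 1) : Pos (A + s • dyad p) := by
  refine ⟨fun x y => ?_, fun x hx => ?_⟩
  · simp only [_root_.add_apply, _root_.smul_apply, dyad_apply,
      inner_add_left, inner_add_right, real_inner_smul_left, real_inner_smul_right, hA.1 x y]
    rw [real_inner_comm p x]
    ring
  · simp only [_root_.add_apply, _root_.smul_apply, dyad_apply,
      inner_add_left, real_inner_smul_left]
    have h1 := hA.sq_inner_le p x
    have h2 := hA.2 x hx
    have h3 : |s| * ⟪p, x⟫ ^ 2 ≤ |s| * (⟪opInv A p, p⟫ * ⟪A x, x⟫) :=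
      mul_le_mul_of_nonneg_left h1 (abs_nonneg s)
    have h4 := neg_abs_le s
    nlinarith [mul_lt_mul_of_pos_right hs h2, sq_nonneg ⟪p, x⟫]

end FRBL

namespace FRBL

section squareRoots

variable {X : Type*} [NormedAddCommGroup X] [InnerProductSpace ℝ X] [FiniteDimensional ℝ X]

lemma Pos.opInv_eq_of_sqrt {P R : X →L[ℝ] X} (hR : Pos R) (hP : R * R = P) (x : X) :
    ‖opInv R x‖ ^ 2 = ⟪opInv P x, x⟫ := by
  have h1 : Function.LeftInverse (opInv R * opInv R) P := fun y => by
    rw [← hP]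
    simp [hR.opInv_apply]
  have h2 : P ((opInv R * opInv R) x) = x := by
    rw [← hP]
    simp [hR.apply_opInv]
  have hPu : IsUnit P := by
    rw [← hP]
    exact hR.isUnit.mul hR.isUnit
  have h3 : opInv P x = (opInv R * opInv R) x := by
    conv_lhs => rw [← h2]
    exact congrArg (fun B : X →L[ℝ] X => B _) (Ring.inverse_mul_cancel P hPu)
  rw [h3, mul_apply_eq_comp, hR.opInv_pos.1, real_inner_self_eq_norm_sq]

lemma Pos.exists_sqrt {P : X →L[ℝ] X} (hP : Pos P) :
    ∃ R : X →L[ℝ] X, Pos R ∧ R * R = P ∧ R.det = √P.det := by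
  obtain ⟨R, hR, h⟩ := hP.psd.exists_sqrt
  have h1 : (R * R).det = R.det * R.det := LinearMap.det_comp _ _
  have h2 : R.det ≠ 0 := fun h0 => hP.det_pos.ne' (by rw [← h, h1, h0, zero_mul])
  refine ⟨R, hR.pos h2, h, ?_⟩
  rw [← h, h1, Real.sqrt_mul_self hR.det_nonneg]

end squareRoots

section gaussianIntegrals

variable {X : Type*} [NormedAddCommGroup X] [InnerProductSpace ℝ X] [FiniteDimensional ℝ X]
  [MeasurableSpace X] [BorelSpace X]

lemma integral_stdGaussian_comp_of_sqrt {P R : X →L[ℝ] X} (hR : Pos R) (hP : R * R = P)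
    {T : ℝ} (hT : 0 < T) (f : X → ℝ) :
    ∫ z, f (√T • R z) ∂(stdGaussian X) =
      (gaussNorm X * (√T ^ Module.finrank ℝ X)⁻¹ * R.det⁻¹) *
        ∫ x, Real.exp (-⟪opInv P x, x⟫ / (2 * T)) * f x := by
  have hT' : 0 < √T := Real.sqrt_pos.2 hT
  let S : X →ₗ[ℝ] X := √T • (R : X →ₗ[ℝ] X)
  have hdet : LinearMap.det S = √T ^ Module.finrank ℝ X * R.det := LinearMap.det_smul _ _
  have hdet0 : 0 < LinearMap.det S := by
    rw [hdet]
    exact mul_pos (pow_pos hT' _) hR.det_pos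
  have hS : Function.LeftInverse (fun x => (√T)⁻¹ • opInv R x) S := fun z => by
    simp [S, hR.opInv_apply, smul_smul, hT'.ne']
  have hS' : Function.RightInverse (fun x => (√T)⁻¹ • opInv R x) S := fun z => by
    simp [S, hR.apply_opInv, smul_smul, hT'.ne']
  have hemb : MeasurableEmbedding S := by
    have hc : Continuous S := LinearMap.continuous_of_finiteDimensional S
    exact hc.measurableEmbedding hS.injective
  have key := hemb.integral_map (μ := (volume : Measure X))
    (fun x => gaussNorm X * (Real.exp (-⟪opInv P x, x⟫ / (2 * T)) * f x))
  rw [Measure.map_linearMap_addHaar_eq_smul_addHaar _ hdet0.ne', integral_smul_measure,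
    ENNReal.toReal_ofReal (abs_nonneg _), abs_of_pos (inv_pos.2 hdet0), hdet, smul_eq_mul,
    integral_const_mul] at key
  rw [integral_stdGaussian, mul_assoc, mul_assoc]
  have : ∫ z, (gaussNorm X * Real.exp (-‖z‖ ^ 2 / 2)) • f (√T • R z) =
      ∫ z, gaussNorm X * (Real.exp (-⟪opInv P (S z), S z⟫ / (2 * T)) * f (S z)) := by
    congr 1 with z
    have h1 : ⟪opInv P (S z), S z⟫ = T * ‖z‖ ^ 2 := by
      rw [← hR.opInv_eq_of_sqrt hP]
      simp only [S, LinearMap.smul_apply, ContinuousLinearMap.coe_coe, map_smul, hR.opInv_apply]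
      rw [norm_smul, mul_pow, Real.norm_eq_abs, sq_abs, Real.sq_sqrt hT.le]
    rw [h1, smul_eq_mul, mul_assoc]
    congr 3
    field_simp
  rw [this, ← key, mul_inv]
  ring

/-- The logarithm of the integral of the centered gaussian `exp (-⟪A x, x⟫ / 2)`. -/
def logGauss (A : X →L[ℝ] X) : ℝ :=
  (Module.finrank ℝ X : ℝ) / 2 * Real.log (2 * Real.pi) - Real.log A.det / 2

lemma integral_exp_neg_inner {A : X →L[ℝ] X} (hA : Pos A) :
    ∫ x, Real.exp (-⟪A x, x⟫ / 2) = Real.exp (logGauss A) := by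
  have hA2 : opInv (opInv A) = A := by
    ext x
    conv_lhs => rw [← hA.opInv_apply x]
    exact hA.opInv_pos.opInv_apply _
  obtain ⟨R, hR, hRA, hdet⟩ := hA.opInv_pos.exists_sqrt
  have h := integral_stdGaussian_comp_of_sqrt hR hRA one_pos (fun _ => 1)
  have hn := gaussNorm_mul (G := X)
  rw [hA2, hdet, hA.det_opInv] at h
  simp only [integral_const, probReal_univ, smul_eq_mul, mul_one, Real.sqrt_one, one_pow,
    inv_one, Real.sqrt_inv, inv_inv] at h
  have hd := hA.det_pos
  have h2 : Real.exp (logGauss A) = (2 * Real.pi) ^ ((Module.finrank ℝ X : ℝ) / 2) *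
      (√A.det)⁻¹ := by
    rw [logGauss, Real.exp_sub, Real.rpow_def_of_pos (by positivity), mul_comm (Real.log _),
      Real.sqrt_eq_rpow, Real.rpow_def_of_pos hd, div_eq_mul_inv (Real.log _),
      div_eq_mul_inv (Real.exp _)]
    norm_num
  rw [h2]
  have hd' : 0 < √A.det := Real.sqrt_pos.2 hd
  have hg := gaussNorm_pos (G := X)
  have hmul : gaussNorm X * √A.det * ∫ x, Real.exp (-⟪A x, x⟫ / 2) =
      gaussNorm X * √A.det * ((2 * Real.pi) ^ ((Module.finrank ℝ X : ℝ) / 2) * (√A.det)⁻¹) := by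
    rw [← h]
    calc (1 : ℝ) = gaussNorm X * (2 * Real.pi) ^ ((Module.finrank ℝ X : ℝ) / 2) := hn.symm
      _ = _ := by field_simp
  exact mul_left_cancel₀ (by positivity) hmul

lemma lintegral_exp_neg_inner {A : X →L[ℝ] X} (hA : Pos A) :
    ∫⁻ x, (Real.toNNReal (Real.exp (-⟪A x, x⟫ / 2)) : ℝ≥0∞) =
      ENNReal.ofReal (Real.exp (logGauss A)) := by
  have h := integral_exp_neg_inner hA
  have hi : Integrable fun x : X => Real.exp (-⟪A x, x⟫ / 2) := by
    by_contra hi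
    rw [integral_undef hi] at h
    exact (Real.exp_pos _).ne h
  rw [← h, ofReal_integral_eq_lintegral_ofReal hi (by filter_upwards with x; positivity)]
  rfl

end gaussianIntegrals

lemma prod_ofReal_exp_rpow {ι : Type*} [Fintype ι] (a c : ι → ℝ) :
    ∏ i, ENNReal.ofReal (Real.exp (a i)) ^ c i = ENNReal.ofReal (Real.exp (∑ i, c i * a i)) := by
  rw [Real.exp_sum, ENNReal.ofReal_prod_of_nonneg fun i _ => (Real.exp_pos _).le]
  refine Finset.prod_congr rfl fun i _ => ?_
  rw [ENNReal.ofReal_rpow_of_pos (Real.exp_pos _), ← Real.exp_mul, mul_comm]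

variable {k m : ℕ} {E : Fin k → Type*} {F : Fin m → Type*}
  [∀ i, NormedAddCommGroup (E i)] [∀ i, InnerProductSpace ℝ (E i)]
  [∀ i, FiniteDimensional ℝ (E i)]
  [∀ i, MeasurableSpace (E i)] [∀ i, BorelSpace (E i)]
  [∀ j, NormedAddCommGroup (F j)] [∀ j, InnerProductSpace ℝ (F j)]
  [∀ j, FiniteDimensional ℝ (F j)]
  [∀ j, MeasurableSpace (F j)] [∀ j, BorelSpace (F j)]
  {c : Fin k → ℝ} {d : Fin m → ℝ} {B : ∀ i j, E i →ₗ[ℝ] F j} {D₀ : ℝ}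

lemma IsBound.gaussian_test (hB : IsBound E F c d B D₀)
    {P : ∀ i, E i →L[ℝ] E i} {P' : ∀ j, F j →L[ℝ] F j} (hP : ∀ i, Pos (P i))
    (hP' : ∀ j, Pos (P' j))
    (h : ∀ x : ∀ i, E i, ∑ j, d j * ⟪P' j (∑ i, c i • B i j (x i)), ∑ i, c i • B i j (x i)⟫ ≤
      ∑ i, c i * ⟪P i (x i), x i⟫) :
    ∑ i, c i * logGauss (P i) ≤ D₀ + ∑ j, d j * logGauss (P' j) := by
  have key := hB (fun i x => Real.toNNReal (Real.exp (-⟪P i x, x⟫ / 2)))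
    (fun j y => Real.toNNReal (Real.exp (-⟪P' j y, y⟫ / 2))) (fun i => by fun_prop)
    (fun j => by fun_prop) fun x => ?_
  · simp only [lintegral_exp_neg_inner (hP _), lintegral_exp_neg_inner (hP' _),
      prod_ofReal_exp_rpow] at key
    rw [← ENNReal.ofReal_mul (Real.exp_pos _).le, ← Real.exp_add,
      ENNReal.ofReal_le_ofReal_iff (Real.exp_pos _).le, Real.exp_le_exp] at key
    exact key
  · rw [← NNReal.coe_le_coe]
    push_cast
    simp only [Real.coe_toNNReal _ (Real.exp_pos _).le, ← Real.exp_mul, ← Real.exp_sum]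
    rw [Real.exp_le_exp]
    have h := h x
    have e1 : ∑ i, -⟪P i (x i), x i⟫ / 2 * c i = -(∑ i, c i * ⟪P i (x i), x i⟫) / 2 := by
      rw [← Finset.sum_neg_distrib, Finset.sum_div]
      exact Finset.sum_congr rfl fun i _ => by ring
    have e2 : ∀ y : ∀ j, F j, ∑ j, -⟪P' j (y j), y j⟫ / 2 * d j =
        -(∑ j, d j * ⟪P' j (y j), y j⟫) / 2 := fun y => by
      rw [← Finset.sum_neg_distrib, Finset.sum_div]
      exact Finset.sum_congr rfl fun i _ => by ring
    rw [e1, e2 fun j => ∑ i, c i • B i j (x i)]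
    linarith

end FRBL

namespace FRBL

lemma sum_update {ι M : Type*} [Fintype ι] [DecidableEq ι] [AddCommGroup M] {Z : ι → Type*}
    (g : ∀ i, Z i → M) (V : ∀ i, Z i) (i : ι) (w : Z i) :
    ∑ a, g a (Function.update V i w a) = ∑ a, g a (V a) + (g i w - g i (V i)) := by
  rw [← sub_eq_iff_eq_add', ← Finset.sum_sub_distrib, Finset.sum_eq_single i]
  · simp
  · intro a _ ha
    simp [ha]
  · simp

lemma eq_zero_of_eventually_log_le {α β γ u v w : ℝ}
    (h : ∀ᶠ s in nhds (0 : ℝ), α * Real.log (1 + s * u) + β * Real.log (1 + s * v) +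
      γ * Real.log (1 + s * w) ≤ 0) : α * u + β * v + γ * w = 0 := by
  have hd : ∀ u : ℝ, HasDerivAt (fun s : ℝ => Real.log (1 + s * u)) u 0 := fun u => by
    have := (((hasDerivAt_id (0 : ℝ)).mul_const u).const_add 1).log (by simp)
    simpa using this
  refine IsLocalMax.hasDerivAt_eq_zero (a := 0) ?_
    ((((hd u).const_mul α).add ((hd v).const_mul β)).add ((hd w).const_mul γ))
  filter_upwards [h] with s hs
  simpa using hs

lemma isClosed_psd {X : Type*} [NormedAddCommGroup X] [InnerProductSpace ℝ X]
    [FiniteDimensional ℝ X] : IsClosed {A : X →L[ℝ] X | Psd A} := by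
  simp only [Psd, Set.ofPred_and, Set.ofPred_forall]
  refine IsClosed.inter (isClosed_iInter fun x => isClosed_iInter fun y => ?_)
    (isClosed_iInter fun x => ?_)
  · exact isClosed_eq (by fun_prop) (by fun_prop)
  · exact isClosed_le (by fun_prop) (by fun_prop)

variable {k m : ℕ} {E : Fin k → Type*} {F : Fin m → Type*}
  [∀ i, NormedAddCommGroup (E i)] [∀ i, InnerProductSpace ℝ (E i)]
  [∀ i, FiniteDimensional ℝ (E i)]
  [∀ j, NormedAddCommGroup (F j)] [∀ j, InnerProductSpace ℝ (F j)]
  [∀ j, FiniteDimensional ℝ (F j)]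
  {H : Type*} [NormedAddCommGroup H] [InnerProductSpace ℝ H] [FiniteDimensional ℝ H]
  (c : Fin k → ℝ) (d : Fin m → ℝ) (π : ∀ i, H →L[ℝ] E i) (Q : ∀ j, H →L[ℝ] F j)

/-- The slack operator `∑ᵢ cᵢ πᵢ* Vᵢ πᵢ - ∑ⱼ dⱼ Qⱼ* Uⱼ Qⱼ` of the gaussian constraint. -/
def slack (V : ∀ i, E i →L[ℝ] E i) (U : ∀ j, F j →L[ℝ] F j) : H →L[ℝ] H :=
  ∑ i, c i • (ContinuousLinearMap.adjoint (π i) ∘L V i ∘L π i) -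
    ∑ j, d j • (ContinuousLinearMap.adjoint (Q j) ∘L U j ∘L Q j)

/-- Strict feasibility for the gaussian optimization problem. -/
def Feas (V : ∀ i, E i →L[ℝ] E i) (U : ∀ j, F j →L[ℝ] F j) : Prop :=
  (∀ i, Pos (V i)) ∧ (∀ j, Pos (U j)) ∧ Pos (slack c d π Q V U)

/-- The objective of the gaussian optimization problem. -/
def obj (V : ∀ i, E i →L[ℝ] E i) (U : ∀ j, F j →L[ℝ] F j) : ℝ :=
  ∑ j, d j * Real.log (U j).det - ∑ i, c i * Real.log (V i).det

/-- The sum of the logarithms of the traces. -/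
def logTr (V : ∀ i, E i →L[ℝ] E i) (U : ∀ j, F j →L[ℝ] F j) : ℝ :=
  ∑ i, Real.log (1 + tr (V i)) + ∑ j, Real.log (1 + tr (U j))

/-- The sum of the logarithms of the determinants. -/
def logDet (V : ∀ i, E i →L[ℝ] E i) (U : ∀ j, F j →L[ℝ] F j) : ℝ :=
  ∑ i, Real.log (V i).det + ∑ j, Real.log (U j).det + Real.log (slack c d π Q V U).det

variable (E F H) in
/-- The weight of the trace penalty. -/
def trWeight : ℝ :=
  ∑ i, (Module.finrank ℝ (E i) : ℝ) + ∑ j, (Module.finrank ℝ (F j) : ℝ) + Module.finrank ℝ H + 1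

/-- The penalty, a barrier for the strictly feasible region. -/
def penalty (V : ∀ i, E i →L[ℝ] E i) (U : ∀ j, F j →L[ℝ] F j) : ℝ :=
  trWeight E F H * logTr V U - logDet c d π Q V U

variable {c d π Q} {V : ∀ i, E i →L[ℝ] E i} {U : ∀ j, F j →L[ℝ] F j}

lemma inner_slack (x : H) : ⟪slack c d π Q V U x, x⟫ =
    ∑ i, c i * ⟪V i (π i x), π i x⟫ - ∑ j, d j * ⟪U j (Q j x), Q j x⟫ := by
  simp only [slack, _root_.sub_apply, _root_.sum_apply, _root_.smul_apply,
    ContinuousLinearMap.comp_apply, inner_sub_left, sum_inner, real_inner_smul_left,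
    ContinuousLinearMap.adjoint_inner_left]

lemma slack_symm (hV : ∀ i x y, ⟪V i x, y⟫ = ⟪x, V i y⟫) (hU : ∀ j x y, ⟪U j x, y⟫ = ⟪x, U j y⟫)
    (x y : H) : ⟪slack c d π Q V U x, y⟫ = ⟪x, slack c d π Q V U y⟫ := by
  simp only [slack, _root_.sub_apply, _root_.sum_apply, _root_.smul_apply,
    ContinuousLinearMap.comp_apply, inner_sub_left, inner_sub_right, sum_inner, inner_sum,
    real_inner_smul_left, real_inner_smul_right, ContinuousLinearMap.adjoint_inner_left,
    ContinuousLinearMap.adjoint_inner_right, hV, hU]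

lemma continuous_slack : Continuous fun z : (∀ i, E i →L[ℝ] E i) × (∀ j, F j →L[ℝ] F j) =>
    slack c d π Q z.1 z.2 := by
  unfold slack
  fun_prop

lemma adjoint_comp_dyad_comp {X : Type*} [NormedAddCommGroup X] [InnerProductSpace ℝ X]
    [FiniteDimensional ℝ X] (P : H →L[ℝ] X) (p : X) :
    ContinuousLinearMap.adjoint P ∘L dyad p ∘L P = dyad (ContinuousLinearMap.adjoint P p) := by
  ext x
  simp [dyad_apply, ContinuousLinearMap.adjoint_inner_left]

lemma slack_update_left (i : Fin k) (s : ℝ) (p : E i) :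
    slack c d π Q (Function.update V i (V i + s • dyad p)) U =
      slack c d π Q V U + (s * c i) • dyad (ContinuousLinearMap.adjoint (π i) p) := by
  unfold slack
  rw [sum_update (fun a W => c a • (ContinuousLinearMap.adjoint (π a) ∘L W ∘L π a)),
    ← adjoint_comp_dyad_comp]
  ext x
  simp
  module

lemma slack_update_right (j : Fin m) (s : ℝ) (p : F j) :
    slack c d π Q V (Function.update U j (U j + s • dyad p)) =
      slack c d π Q V U + (s * -d j) • dyad (ContinuousLinearMap.adjoint (Q j) p) := by
  unfold slack
  rw [sum_update (fun a W => d a • (ContinuousLinearMap.adjoint (Q a) ∘L W ∘L Q a)),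
    ← adjoint_comp_dyad_comp]
  ext x
  simp
  module

lemma exists_penalty_bound (hc : ∀ i, 0 < c i) (hd : ∀ j, 0 < d j) :
    ∃ C₁, 0 ≤ C₁ ∧ ∀ (V : ∀ i, E i →L[ℝ] E i) (U : ∀ j, F j →L[ℝ] F j), Feas c d π Q V U →
      0 ≤ logTr V U ∧ logTr V U ≤ penalty c d π Q V U + C₁ ∧
      (∀ i, -Real.log (V i).det ≤ penalty c d π Q V U + C₁) ∧
      (∀ j, -Real.log (U j).det ≤ penalty c d π Q V U + C₁) ∧
      -Real.log (slack c d π Q V U).det ≤ penalty c d π Q V U + C₁ := by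
  set C₂ : ℝ := ∑ i, c i * ‖π i‖ ^ 2 with hC₂
  have hC₂0 : 0 ≤ C₂ := Finset.sum_nonneg fun i _ => by have := hc i; positivity
  have hlC : 0 ≤ Real.log (1 + C₂) := Real.log_nonneg (by linarith)
  refine ⟨Module.finrank ℝ H * Real.log (1 + C₂), by positivity, fun V U hz => ?_⟩
  obtain ⟨hV, hU, hS⟩ := hz
  have h1 : ∀ i, 0 ≤ Real.log (1 + tr (V i)) := fun i =>
    Real.log_nonneg (by linarith [(hV i).psd.tr_nonneg])
  have h2 : ∀ j, 0 ≤ Real.log (1 + tr (U j)) := fun i =>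
    Real.log_nonneg (by linarith [(hU i).psd.tr_nonneg])
  have h1s := Finset.sum_nonneg fun i (_ : i ∈ Finset.univ) => h1 i
  have h2s := Finset.sum_nonneg fun i (_ : i ∈ Finset.univ) => h2 i
  have hP : 0 ≤ logTr V U := add_nonneg h1s h2s
  have h1P : ∀ i, Real.log (1 + tr (V i)) ≤ logTr V U := fun i =>
    (Finset.single_le_sum (fun i _ => h1 i) (Finset.mem_univ i)).trans
      (le_add_of_nonneg_right h2s)
  have h2P : ∀ i, Real.log (1 + tr (U i)) ≤ logTr V U := fun i =>
    (Finset.single_le_sum (fun i _ => h2 i) (Finset.mem_univ i)).trans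
      (le_add_of_nonneg_left h1s)
  have key : ∀ {n : ℕ} {D S : ℝ}, 0 < D → D ≤ S ^ n → 0 ≤ S →
      Real.log D ≤ n * Real.log (1 + S) := fun {n D S} hD h hS => by
    rw [← Real.log_pow]
    exact Real.log_le_log hD (h.trans (pow_le_pow_left₀ hS (by linarith) n))
  have hdV : ∀ i, 0 ≤ Module.finrank ℝ (E i) * logTr V U - Real.log (V i).det := fun i => by
    have := key (hV i).det_pos (hV i).psd.det_le_tr_pow (hV i).psd.tr_nonneg
    have := mul_le_mul_of_nonneg_left (h1P i) (Nat.cast_nonneg (α := ℝ) (Module.finrank ℝ (E i)))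
    linarith
  have hdU : ∀ j, 0 ≤ Module.finrank ℝ (F j) * logTr V U - Real.log (U j).det := fun i => by
    have := key (hU i).det_pos (hU i).psd.det_le_tr_pow (hU i).psd.tr_nonneg
    have := mul_le_mul_of_nonneg_left (h2P i) (Nat.cast_nonneg (α := ℝ) (Module.finrank ℝ (F i)))
    linarith
  have hdS : 0 ≤ Module.finrank ℝ H * logTr V U + Module.finrank ℝ H * Real.log (1 + C₂) -
      Real.log (slack c d π Q V U).det := by
    have hpe : 1 ≤ Real.exp (logTr V U) := Real.one_le_exp hP
    have htr : ∀ i, 1 + tr (V i) ≤ Real.exp (logTr V U) := fun i => by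
      rw [← Real.exp_log (by linarith [(hV i).psd.tr_nonneg] : 0 < 1 + tr (V i))]
      exact Real.exp_le_exp.2 (h1P i)
    have hS1 : (slack c d π Q V U).det ≤ (C₂ * Real.exp (logTr V U)) ^ Module.finrank ℝ H := by
      refine hS.psd.det_le_pow fun x => ?_
      rw [inner_slack]
      have hn : 0 ≤ ∑ j, d j * ⟪U j (Q j x), Q j x⟫ :=
        Finset.sum_nonneg fun j _ => mul_nonneg (hd j).le ((hU j).psd.2 _)
      have hle : ∑ i, c i * ⟪V i (π i x), π i x⟫ ≤ C₂ * Real.exp (logTr V U) * ‖x‖ ^ 2 := by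
        rw [hC₂, Finset.sum_mul, Finset.sum_mul]
        refine Finset.sum_le_sum fun i _ => ?_
        have e1 := (hV i).psd.inner_le_tr (π i x)
        have e2 : ‖π i x‖ ^ 2 ≤ (‖π i‖ * ‖x‖) ^ 2 := by
          gcongr
          exact (π i).le_opNorm x
        have e3 : tr (V i) * ‖π i x‖ ^ 2 ≤ Real.exp (logTr V U) * (‖π i‖ * ‖x‖) ^ 2 :=
          mul_le_mul (by linarith [htr i]) e2 (by positivity) (by positivity)
        have := mul_le_mul_of_nonneg_left (e1.trans e3) (hc i).le
        linarith
      linarith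
    have h3 : (slack c d π Q V U).det ≤
        ((1 + C₂) * Real.exp (logTr V U)) ^ Module.finrank ℝ H := by
      refine hS1.trans (pow_le_pow_left₀ (by positivity) ?_ _)
      gcongr
      linarith
    have h4 := Real.log_le_log hS.det_pos h3
    rw [Real.log_pow, Real.log_mul (by positivity) (by positivity), Real.log_exp] at h4
    linarith
  have hpen : penalty c d π Q V U = ∑ i, (Module.finrank ℝ (E i) * logTr V U - Real.log (V i).det)
      + ∑ j, (Module.finrank ℝ (F j) * logTr V U - Real.log (U j).det) +
      (Module.finrank ℝ H * logTr V U + Module.finrank ℝ H * Real.log (1 + C₂) -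
      Real.log (slack c d π Q V U).det) + logTr V U - Module.finrank ℝ H * Real.log (1 + C₂) := by
    simp only [penalty, trWeight, logDet, Finset.sum_sub_distrib, ← Finset.sum_mul]
    ring
  have hsV := Finset.sum_nonneg fun i (_ : i ∈ Finset.univ) => hdV i
  have hsU := Finset.sum_nonneg fun i (_ : i ∈ Finset.univ) => hdU i
  refine ⟨hP, by linarith, fun i => ?_, fun j => ?_, ?_⟩
  · have := Finset.single_le_sum (fun i _ => hdV i) (Finset.mem_univ i)
    have : 0 ≤ Module.finrank ℝ (E i) * logTr V U := by positivity
    linarith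
  · have := Finset.single_le_sum (fun i _ => hdU i) (Finset.mem_univ j)
    have : 0 ≤ Module.finrank ℝ (F j) * logTr V U := by positivity
    linarith
  · have : 0 ≤ Module.finrank ℝ H * logTr V U := by positivity
    have : 0 ≤ Module.finrank ℝ H * Real.log (1 + C₂) := by positivity
    linarith

end FRBL

namespace FRBL

variable {k m : ℕ} {E : Fin k → Type*} {F : Fin m → Type*}
  [∀ i, NormedAddCommGroup (E i)] [∀ i, InnerProductSpace ℝ (E i)]
  [∀ i, FiniteDimensional ℝ (E i)]
  [∀ j, NormedAddCommGroup (F j)] [∀ j, InnerProductSpace ℝ (F j)]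
  [∀ j, FiniteDimensional ℝ (F j)]
  {H : Type*} [NormedAddCommGroup H] [InnerProductSpace ℝ H] [FiniteDimensional ℝ H]
  {c : Fin k → ℝ} {d : Fin m → ℝ} {π : ∀ i, H →L[ℝ] E i} {Q : ∀ j, H →L[ℝ] F j}

lemma isCompact_feas (R r : ℝ) :
    IsCompact {z : (∀ i, E i →L[ℝ] E i) × (∀ j, F j →L[ℝ] F j) |
      ((∀ i, Psd (z.1 i) ∧ tr (z.1 i) ≤ R ∧ r ≤ (z.1 i).det) ∧
       (∀ j, Psd (z.2 j) ∧ tr (z.2 j) ≤ R ∧ r ≤ (z.2 j).det)) ∧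
       Psd (slack c d π Q z.1 z.2) ∧ r ≤ (slack c d π Q z.1 z.2).det} := by
  have hcl : ∀ {X : Type _} [NormedAddCommGroup X] [InnerProductSpace ℝ X]
      [FiniteDimensional ℝ X],
      IsClosed {A : X →L[ℝ] X | Psd A ∧ tr A ≤ R ∧ r ≤ A.det} := fun {X} _ _ _ =>
    isClosed_psd.inter ((isClosed_le continuous_tr continuous_const).inter
      (isClosed_le continuous_const ContinuousLinearMap.continuous_det))
  have hcl' : ∀ {X : Type _} [NormedAddCommGroup X] [InnerProductSpace ℝ X]
      [FiniteDimensional ℝ X],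
      IsClosed {A : X →L[ℝ] X | Psd A ∧ tr A ≤ R ∧ r ≤ A.det} := fun {X} _ _ _ =>
    isClosed_psd.inter ((isClosed_le continuous_tr continuous_const).inter
      (isClosed_le continuous_const ContinuousLinearMap.continuous_det))
  have := FiniteDimensional.proper ℝ ((∀ i, E i →L[ℝ] E i) × (∀ j, F j →L[ℝ] F j))
  refine Metric.isCompact_of_isClosed_isBounded ?_ ?_
  · refine IsClosed.inter (IsClosed.inter ?_ ?_) (IsClosed.inter ?_ ?_)
    · have : IsClosed (⋂ i, {z : (∀ i, E i →L[ℝ] E i) × (∀ j, F j →L[ℝ] F j) |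
          Psd (z.1 i) ∧ tr (z.1 i) ≤ R ∧ r ≤ (z.1 i).det}) :=
        isClosed_iInter fun i => hcl.preimage (f := fun z :
        (∀ i, E i →L[ℝ] E i) × (∀ j, F j →L[ℝ] F j) => z.1 i) (by fun_prop)
      rwa [← Set.ofPred_forall] at this
    · have : IsClosed (⋂ i, {z : (∀ i, E i →L[ℝ] E i) × (∀ j, F j →L[ℝ] F j) |
          Psd (z.2 i) ∧ tr (z.2 i) ≤ R ∧ r ≤ (z.2 i).det}) :=
        isClosed_iInter fun i => hcl'.preimage (f := fun z :
        (∀ i, E i →L[ℝ] E i) × (∀ j, F j →L[ℝ] F j) => z.2 i) (by fun_prop)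
      rwa [← Set.ofPred_forall] at this
    · exact isClosed_psd.preimage continuous_slack
    · exact isClosed_le continuous_const (ContinuousLinearMap.continuous_det.comp continuous_slack)
  · refine (Metric.isBounded_closedBall (x := 0) (r := |R|)).subset fun z hz => ?_
    rw [mem_closedBall_zero_iff, Prod.norm_def, max_le_iff]
    refine ⟨(pi_norm_le_iff_of_nonneg (abs_nonneg R)).2 fun i => ?_,
      (pi_norm_le_iff_of_nonneg (abs_nonneg R)).2 fun j => ?_⟩
    · exact ((hz.1.1 i).1.norm_le_tr.trans (hz.1.1 i).2.1).trans (le_abs_self R)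
    · exact ((hz.1.2 j).1.norm_le_tr.trans (hz.1.2 j).2.1).trans (le_abs_self R)

lemma exists_max_penalized (hc : ∀ i, 0 < c i) (hd : ∀ j, 0 < d j)
    (hne : ∃ (V : ∀ i, E i →L[ℝ] E i) (U : ∀ j, F j →L[ℝ] F j), Feas c d π Q V U)
    {C : ℝ} (hC : ∀ (V : ∀ i, E i →L[ℝ] E i) (U : ∀ j, F j →L[ℝ] F j), Feas c d π Q V U →
      obj c d V U ≤ C) {ε : ℝ} (hε : 0 < ε) :
    ∃ (V : ∀ i, E i →L[ℝ] E i) (U : ∀ j, F j →L[ℝ] F j), Feas c d π Q V U ∧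
      ∀ V' U', Feas c d π Q V' U' → obj c d V' U' - ε * penalty c d π Q V' U' ≤
        obj c d V U - ε * penalty c d π Q V U := by
  obtain ⟨V₁, U₁, h₁⟩ := hne
  obtain ⟨C₁, hC₁, hpen⟩ := exists_penalty_bound (π := π) (Q := Q) hc hd
  set W := (C - (obj c d V₁ U₁ - ε * penalty c d π Q V₁ U₁)) / ε + C₁ with hW
  let S := {z : (∀ i, E i →L[ℝ] E i) × (∀ j, F j →L[ℝ] F j) |
      ((∀ i, Psd (z.1 i) ∧ tr (z.1 i) ≤ Real.exp W ∧ Real.exp (-W) ≤ (z.1 i).det) ∧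
       (∀ j, Psd (z.2 j) ∧ tr (z.2 j) ≤ Real.exp W ∧ Real.exp (-W) ≤ (z.2 j).det)) ∧
       Psd (slack c d π Q z.1 z.2) ∧ Real.exp (-W) ≤ (slack c d π Q z.1 z.2).det}
  have hSc : IsCompact S := isCompact_feas _ _
  have hSF : ∀ z ∈ S, Feas c d π Q z.1 z.2 := fun z hz =>
    ⟨fun i => (hz.1.1 i).1.pos ((Real.exp_pos _).trans_le (hz.1.1 i).2.2).ne',
      fun i => (hz.1.2 i).1.pos ((Real.exp_pos _).trans_le (hz.1.2 i).2.2).ne',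
      hz.2.1.pos ((Real.exp_pos _).trans_le hz.2.2).ne'⟩
  have hmem : ∀ V' U', Feas c d π Q V' U' → obj c d V₁ U₁ - ε * penalty c d π Q V₁ U₁ ≤
      obj c d V' U' - ε * penalty c d π Q V' U' → (V', U') ∈ S := fun V' U' hz hle => by
    obtain ⟨p0, p1, p2, p3, p4⟩ := hpen V' U' hz
    have hpW : penalty c d π Q V' U' + C₁ ≤ W := by
      rw [hW]
      gcongr
      rw [le_div_iff₀ hε]
      linarith [hC V' U' hz]
    have hdet : ∀ {D : ℝ}, 0 < D → -Real.log D ≤ penalty c d π Q V' U' + C₁ →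
        Real.exp (-W) ≤ D := fun {D} hD h => by
      rw [← Real.exp_log hD]
      exact Real.exp_le_exp.2 (by linarith)
    have htr : ∀ {t : ℝ}, 0 ≤ t → Real.log (1 + t) ≤ logTr V' U' → t ≤ Real.exp W :=
      fun {t} ht h => by
      have : 1 + t ≤ Real.exp W := by
        rw [← Real.exp_log (by linarith : 0 < 1 + t)]
        exact Real.exp_le_exp.2 (by linarith)
      linarith
    have h1 : ∀ i, 0 ≤ Real.log (1 + tr (V' i)) := fun i =>
      Real.log_nonneg (by linarith [(hz.1 i).psd.tr_nonneg])
    have h2 : ∀ j, 0 ≤ Real.log (1 + tr (U' j)) := fun i =>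
      Real.log_nonneg (by linarith [(hz.2.1 i).psd.tr_nonneg])
    have h1s := Finset.sum_nonneg fun i (_ : i ∈ Finset.univ) => h1 i
    have h2s := Finset.sum_nonneg fun i (_ : i ∈ Finset.univ) => h2 i
    refine ⟨⟨fun i => ⟨(hz.1 i).psd, htr (hz.1 i).psd.tr_nonneg ?_, hdet (hz.1 i).det_pos (p2 i)⟩,
      fun j => ⟨(hz.2.1 j).psd, htr (hz.2.1 j).psd.tr_nonneg ?_, hdet (hz.2.1 j).det_pos (p3 j)⟩⟩,
      hz.2.2.psd, hdet hz.2.2.det_pos p4⟩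
    · exact (Finset.single_le_sum (fun i _ => h1 i) (Finset.mem_univ i)).trans
        (le_add_of_nonneg_right h2s)
    · exact (Finset.single_le_sum (fun i _ => h2 i) (Finset.mem_univ j)).trans
        (le_add_of_nonneg_left h1s)
  have hcont : ContinuousOn (fun z : (∀ i, E i →L[ℝ] E i) × (∀ j, F j →L[ℝ] F j) =>
      obj c d z.1 z.2 - ε * penalty c d π Q z.1 z.2) S := by
    have hV : ∀ i, ContinuousOn (fun z : (∀ i, E i →L[ℝ] E i) × (∀ j, F j →L[ℝ] F j) =>
        Real.log (z.1 i).det) S := fun i =>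
      ContinuousOn.log (ContinuousLinearMap.continuous_det.comp
        (by fun_prop : Continuous fun z : (∀ i, E i →L[ℝ] E i) × (∀ j, F j →L[ℝ] F j) =>
          z.1 i)).continuousOn fun z hz => ((hSF z hz).1 i).det_pos.ne'
    have hU : ∀ i, ContinuousOn (fun z : (∀ i, E i →L[ℝ] E i) × (∀ j, F j →L[ℝ] F j) =>
        Real.log (z.2 i).det) S := fun i =>
      ContinuousOn.log (ContinuousLinearMap.continuous_det.comp
        (by fun_prop : Continuous fun z : (∀ i, E i →L[ℝ] E i) × (∀ j, F j →L[ℝ] F j) =>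
          z.2 i)).continuousOn fun z hz => ((hSF z hz).2.1 i).det_pos.ne'
    have hS : ContinuousOn (fun z : (∀ i, E i →L[ℝ] E i) × (∀ j, F j →L[ℝ] F j) =>
        Real.log (slack c d π Q z.1 z.2).det) S :=
      ContinuousOn.log (ContinuousLinearMap.continuous_det.comp continuous_slack).continuousOn
        fun z hz => (hSF z hz).2.2.det_pos.ne'
    have hVt : ∀ i, ContinuousOn (fun z : (∀ i, E i →L[ℝ] E i) × (∀ j, F j →L[ℝ] F j) =>
        Real.log (1 + tr (z.1 i))) S := fun i =>
      ContinuousOn.log (continuous_const.add (continuous_tr.comp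
        (by fun_prop : Continuous fun z : (∀ i, E i →L[ℝ] E i) × (∀ j, F j →L[ℝ] F j) =>
          z.1 i))).continuousOn fun z hz => by linarith [((hSF z hz).1 i).psd.tr_nonneg]
    have hUt : ∀ i, ContinuousOn (fun z : (∀ i, E i →L[ℝ] E i) × (∀ j, F j →L[ℝ] F j) =>
        Real.log (1 + tr (z.2 i))) S := fun i =>
      ContinuousOn.log (continuous_const.add (continuous_tr.comp
        (by fun_prop : Continuous fun z : (∀ i, E i →L[ℝ] E i) × (∀ j, F j →L[ℝ] F j) =>
          z.2 i))).continuousOn fun z hz => by linarith [((hSF z hz).2.1 i).psd.tr_nonneg]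
    refine ContinuousOn.sub (ContinuousOn.sub ?_ ?_) (continuousOn_const.mul
      (ContinuousOn.sub (continuousOn_const.mul (ContinuousOn.add ?_ ?_))
        (ContinuousOn.add (ContinuousOn.add ?_ ?_) hS)))
    · exact continuousOn_finsetSum _ fun i _ => continuousOn_const.mul (hU i)
    · exact continuousOn_finsetSum _ fun i _ => continuousOn_const.mul (hV i)
    · exact continuousOn_finsetSum _ fun i _ => hVt i
    · exact continuousOn_finsetSum _ fun i _ => hUt i
    · exact continuousOn_finsetSum _ fun i _ => hV i
    · exact continuousOn_finsetSum _ fun i _ => hU i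
  obtain ⟨z, hzS, hz⟩ := hSc.exists_isMaxOn ⟨(V₁, U₁), hmem V₁ U₁ h₁ le_rfl⟩ hcont
  refine ⟨z.1, z.2, hSF z hzS, fun V' U' h' => ?_⟩
  by_cases hle : obj c d V₁ U₁ - ε * penalty c d π Q V₁ U₁ ≤
      obj c d V' U' - ε * penalty c d π Q V' U'
  · exact hz (hmem V' U' h' hle)
  · exact (not_le.1 hle).le.trans (hz (hmem V₁ U₁ h₁ le_rfl))

lemma eventually_abs_mul_lt_one (v : ℝ) : ∀ᶠ s in nhds (0 : ℝ), |s| * v < 1 := by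
  have : Continuous fun s : ℝ => |s| * v := by fun_prop
  exact this.continuousAt.eventually_lt continuousAt_const (by simp)

lemma log_one_add_mul_of {s v x D : ℝ} (hD : 0 < D) (hs : |s| * v < 1) (hv : 0 ≤ v)
    (h : x = D * (1 + s * v)) : Real.log x = Real.log D + Real.log (1 + s * v) := by
  rw [h, Real.log_mul hD.ne']
  nlinarith [neg_abs_le s]

lemma critical_left {ε : ℝ} {V : ∀ i, E i →L[ℝ] E i} {U : ∀ j, F j →L[ℝ] F j}
    (hz : Feas c d π Q V U) (hc : ∀ i, 0 < c i)
    (hmax : ∀ V' U', Feas c d π Q V' U' → obj c d V' U' - ε * penalty c d π Q V' U' ≤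
        obj c d V U - ε * penalty c d π Q V U) (i : Fin k) (p : E i) :
    ε * c i * ⟪opInv (slack c d π Q V U) (ContinuousLinearMap.adjoint (π i) p),
      ContinuousLinearMap.adjoint (π i) p⟫ = (c i - ε) * ⟪opInv (V i) p, p⟫ +
      ε * trWeight E F H * ‖p‖ ^ 2 / (1 + tr (V i)) := by
  obtain ⟨hV, hU, hS⟩ := hz
  set v := ⟪opInv (V i) p, p⟫
  set q := ContinuousLinearMap.adjoint (π i) p
  set w := ⟪opInv (slack c d π Q V U) q, q⟫
  set t := ‖p‖ ^ 2 / (1 + tr (V i)) with ht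
  have htr : 0 < 1 + tr (V i) := by linarith [(hV i).psd.tr_nonneg]
  have ht0 : 0 ≤ t := by positivity
  have hw0 : 0 ≤ w := hS.opInv_pos.psd.2 q
  have key := eq_zero_of_eventually_log_le (α := ε - c i) (β := -(ε * trWeight E F H)) (γ := ε)
    (u := v) (v := t) (w := c i * w) ?_
  · rw [ht] at key
    linear_combination key
  · filter_upwards [eventually_abs_mul_lt_one v, eventually_abs_mul_lt_one t,
      eventually_abs_mul_lt_one (c i * w)] with s h1 h2 h3
    have hfeas : Feas c d π Q (Function.update V i (V i + s • dyad p)) U := by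
      refine ⟨fun a => ?_, hU, ?_⟩
      · rcases eq_or_ne a i with rfl | ha
        · simpa using (hV a).add_dyad h1
        · simpa [ha] using hV a
      · rw [slack_update_left]
        exact hS.add_dyad (by rw [abs_mul, abs_of_pos (hc i), mul_assoc]; exact h3)
    have h := hmax _ _ hfeas
    simp only [obj, penalty, logTr, logDet, slack_update_left] at h
    rw [sum_update (fun a (W : E a →L[ℝ] E a) => c a * Real.log W.det),
      sum_update (fun a (W : E a →L[ℝ] E a) => Real.log W.det),
      sum_update (fun a (W : E a →L[ℝ] E a) => Real.log (1 + tr W))] at h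
    rw [log_one_add_mul_of (hV i).det_pos h1 ((hV i).opInv_pos.psd.2 p) ((hV i).det_add_dyad s p),
      log_one_add_mul_of htr h2 ht0 (x := 1 + tr (V i + s • dyad p)) (by
        rw [map_add, map_smul, tr_dyad, ht, smul_eq_mul]; field_simp; ring),
      log_one_add_mul_of hS.det_pos h3 (mul_nonneg (hc i).le hw0)
        ((hS.det_add_dyad (s * c i) q).trans (by rw [mul_assoc s]))] at h
    linarith

lemma critical_right {ε : ℝ} {V : ∀ i, E i →L[ℝ] E i} {U : ∀ j, F j →L[ℝ] F j}
    (hz : Feas c d π Q V U) (hd : ∀ i, 0 < d i)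
    (hmax : ∀ V' U', Feas c d π Q V' U' → obj c d V' U' - ε * penalty c d π Q V' U' ≤
        obj c d V U - ε * penalty c d π Q V U) (j : Fin m) (p : F j) :
    ε * d j * ⟪opInv (slack c d π Q V U) (ContinuousLinearMap.adjoint (Q j) p),
      ContinuousLinearMap.adjoint (Q j) p⟫ = (d j + ε) * ⟪opInv (U j) p, p⟫ -
      ε * trWeight E F H * ‖p‖ ^ 2 / (1 + tr (U j)) := by
  obtain ⟨hV, hU, hS⟩ := hz
  set v := ⟪opInv (U j) p, p⟫
  set q := ContinuousLinearMap.adjoint (Q j) p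
  set w := ⟪opInv (slack c d π Q V U) q, q⟫
  set t := ‖p‖ ^ 2 / (1 + tr (U j)) with ht
  have htr : 0 < 1 + tr (U j) := by linarith [(hU j).psd.tr_nonneg]
  have ht0 : 0 ≤ t := by positivity
  have hw0 : 0 ≤ w := hS.opInv_pos.psd.2 q
  have key := eq_zero_of_eventually_log_le (α := ε + d j) (β := -(ε * trWeight E F H)) (γ := ε)
    (u := v) (v := t) (w := -(d j * w)) ?_
  · rw [ht] at key
    linear_combination -key
  · filter_upwards [eventually_abs_mul_lt_one v, eventually_abs_mul_lt_one t,
      eventually_abs_mul_lt_one (d j * w)] with s h1 h2 h3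
    have hfeas : Feas c d π Q V (Function.update U j (U j + s • dyad p)) := by
      refine ⟨hV, fun a => ?_, ?_⟩
      · rcases eq_or_ne a j with rfl | ha
        · simpa using (hU a).add_dyad h1
        · simpa [ha] using hU a
      · rw [slack_update_right]
        exact hS.add_dyad (by rw [abs_mul, abs_neg, abs_of_pos (hd j), mul_assoc]; exact h3)
    have h := hmax _ _ hfeas
    simp only [obj, penalty, logTr, logDet, slack_update_right] at h
    rw [sum_update (fun a (W : F a →L[ℝ] F a) => d a * Real.log W.det),
      sum_update (fun a (W : F a →L[ℝ] F a) => Real.log W.det),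
      sum_update (fun a (W : F a →L[ℝ] F a) => Real.log (1 + tr W))] at h
    rw [log_one_add_mul_of (hU j).det_pos h1 ((hU j).opInv_pos.psd.2 p) ((hU j).det_add_dyad s p),
      log_one_add_mul_of htr h2 ht0 (x := 1 + tr (U j + s • dyad p)) (by
        rw [map_add, map_smul, tr_dyad, ht, smul_eq_mul]; field_simp; ring),
      log_one_add_mul_of (s := -s) hS.det_pos (by rw [abs_neg]; exact h3)
        (mul_nonneg (hd j).le hw0)
        ((hS.det_add_dyad (s * -d j) q).trans (by ring))] at h
    have e : 1 + s * -(d j * w) = 1 + -s * (d j * w) := by ring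
    rw [e]
    linarith

end FRBL

namespace FRBL

section operators

variable {X H : Type*} [NormedAddCommGroup X] [InnerProductSpace ℝ X] [FiniteDimensional ℝ X]
  [NormedAddCommGroup H] [InnerProductSpace ℝ H] [FiniteDimensional ℝ H]

lemma Pos.mul_inner_opInv_le {U P : X →L[ℝ] X} (hU : Pos U) (hP : Pos P) {a : ℝ} (ha : 0 < a)
    (h : ∀ p, a * ⟪opInv U p, p⟫ ≤ ⟪P p, p⟫) (y : X) : a * ⟪opInv P y, y⟫ ≤ ⟪U y, y⟫ := by
  have h1 := hU.sq_inner_le (opInv P y) y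
  have h2 : a * ⟪opInv U (opInv P y), opInv P y⟫ ≤ ⟪opInv P y, y⟫ := by
    have := h (opInv P y)
    rwa [hP.apply_opInv, real_inner_comm (opInv P y) y] at this
  rcases eq_or_ne y 0 with rfl | hy
  · simp
  have h3 := hP.opInv_pos.2 y hy
  have h4 := hU.2 y hy
  refine le_of_mul_le_mul_right ?_ h3
  nlinarith [mul_le_mul_of_nonneg_right h2 h4.le, mul_le_mul_of_nonneg_left h1 ha.le]

lemma Pos.det_mul_det_le {A P : X →L[ℝ] X} (hA : Pos A) (hP : Psd P) {C : ℝ}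
    (h : ∀ p, ⟪P p, p⟫ ≤ C * ⟪opInv A p, p⟫) :
    P.det * A.det ≤ C ^ Module.finrank ℝ X := by
  obtain ⟨R, hR, hRA, -⟩ := hA.exists_sqrt
  have hdet : ∀ B C : X →L[ℝ] X, (B * C).det = B.det * C.det := fun B C => LinearMap.det_comp _ _
  have hpsd : Psd (R * P * R) := by
    refine ⟨fun x y => ?_, fun x => ?_⟩
    · simp only [mul_apply_eq_comp, hR.1, hP.1]
    · simp only [mul_apply_eq_comp]
      rw [hR.1]
      exact hP.2 _
  have := hpsd.det_le_pow (C := C) fun x => by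
    simp only [mul_apply_eq_comp]
    rw [hR.1]
    refine (h _).trans_eq ?_
    rw [← hR.opInv_eq_of_sqrt hRA, hR.opInv_apply]
  rw [hdet, hdet] at this
  rw [← hRA, hdet]
  linarith

lemma inner_mul_adjoint (M : H →L[ℝ] X) (p : X) :
    ⟪(M ∘L ContinuousLinearMap.adjoint M) p, p⟫ = ‖ContinuousLinearMap.adjoint M p‖ ^ 2 := by
  rw [ContinuousLinearMap.comp_apply, ← ContinuousLinearMap.adjoint_inner_right,
    real_inner_self_eq_norm_sq]

lemma pos_mul_adjoint {M : H →L[ℝ] X} (h : ∀ p, p ≠ 0 → 0 < ‖ContinuousLinearMap.adjoint M p‖ ^ 2) :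
    Pos (M ∘L ContinuousLinearMap.adjoint M) := by
  refine ⟨fun x y => ?_, fun x hx => ?_⟩
  · simp only [ContinuousLinearMap.comp_apply]
    rw [← ContinuousLinearMap.adjoint_inner_right, ContinuousLinearMap.adjoint_inner_left]
  · rw [inner_mul_adjoint]
    exact h x hx

lemma Pos.inner_apply_le {V : X →L[ℝ] X} (hV : Pos V) {M : H →L[ℝ] X} {C : ℝ} (hC : 0 ≤ C)
    (h : ∀ p, ‖ContinuousLinearMap.adjoint M p‖ ^ 2 ≤ C * ⟪opInv V p, p⟫) (q : H) :
    ⟪V (M q), M q⟫ ≤ C * ‖q‖ ^ 2 := by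
  set s := ⟪V (M q), M q⟫ with hs
  have h0 : 0 ≤ s := hV.psd.2 _
  have h1 : s = ⟪ContinuousLinearMap.adjoint M (V (M q)), q⟫ := by
    rw [ContinuousLinearMap.adjoint_inner_left]
  have h2 := h (V (M q))
  rw [hV.opInv_apply, real_inner_comm, ← hs] at h2
  have h3 := real_inner_mul_inner_self_le (ContinuousLinearMap.adjoint M (V (M q))) q
  rw [← h1, real_inner_self_eq_norm_sq, real_inner_self_eq_norm_sq] at h3
  rcases h0.eq_or_lt with h | h
  · rw [← h]
    positivity
  · refine le_of_mul_le_mul_right ?_ h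
    nlinarith [mul_le_mul_of_nonneg_right h2 (sq_nonneg ‖q‖)]

lemma logGauss_smul {A : X →L[ℝ] X} (hA : Pos A) {r : ℝ} (hr : 0 < r) :
    logGauss (r • A) = logGauss A - (Module.finrank ℝ X : ℝ) / 2 * Real.log r := by
  have : (r • A).det = r ^ Module.finrank ℝ X * A.det := LinearMap.det_smul _ _
  rw [logGauss, logGauss, this, Real.log_mul (by positivity) hA.det_pos.ne', Real.log_pow]
  ring

lemma Pos.smul {A : X →L[ℝ] X} (hA : Pos A) {r : ℝ} (hr : 0 < r) : Pos (r • A) := by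
  refine ⟨fun x y => ?_, fun x hx => ?_⟩
  · simp [real_inner_smul_left, real_inner_smul_right, hA.1 x y]
  · simp only [_root_.smul_apply, real_inner_smul_left]
    exact mul_pos hr (hA.2 x hx)

lemma pos_one : Pos (1 : X →L[ℝ] X) := by
  refine ⟨fun x y => by simp, fun x hx => ?_⟩
  simp only [one_apply_eq_self, real_inner_self_eq_norm_sq]
  positivity

end operators

variable {k m : ℕ} {E : Fin k → Type*} {F : Fin m → Type*}
  [∀ i, NormedAddCommGroup (E i)] [∀ i, InnerProductSpace ℝ (E i)]
  [∀ i, FiniteDimensional ℝ (E i)]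
  [∀ j, NormedAddCommGroup (F j)] [∀ j, InnerProductSpace ℝ (F j)]
  [∀ j, FiniteDimensional ℝ (F j)]
  {H : Type*} [NormedAddCommGroup H] [InnerProductSpace ℝ H] [FiniteDimensional ℝ H]
  {c : Fin k → ℝ} {d : Fin m → ℝ} {π : ∀ i, H →L[ℝ] E i} {Q : ∀ j, H →L[ℝ] F j}

lemma exists_near_critical (hc : ∀ i, 0 < c i) (hd : ∀ j, 0 < d j)
    (hne : ∃ (V : ∀ i, E i →L[ℝ] E i) (U : ∀ j, F j →L[ℝ] F j), Feas c d π Q V U)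
    {C : ℝ} (hC : ∀ (V : ∀ i, E i →L[ℝ] E i) (U : ∀ j, F j →L[ℝ] F j), Feas c d π Q V U →
      obj c d V U ≤ C) {η : ℝ} (hη : 0 < η) :
    ∃ ε₀, 0 < ε₀ ∧ ∀ ε, 0 < ε → ε < ε₀ →
      ∃ (V : ∀ i, E i →L[ℝ] E i) (U : ∀ j, F j →L[ℝ] F j), Feas c d π Q V U ∧
      (∀ i p, ε * c i * ⟪opInv (slack c d π Q V U) (ContinuousLinearMap.adjoint (π i) p),
        ContinuousLinearMap.adjoint (π i) p⟫ = (c i - ε) * ⟪opInv (V i) p, p⟫ +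
        ε * trWeight E F H * ‖p‖ ^ 2 / (1 + tr (V i))) ∧
      (∀ j p, ε * d j * ⟪opInv (slack c d π Q V U) (ContinuousLinearMap.adjoint (Q j) p),
        ContinuousLinearMap.adjoint (Q j) p⟫ = (d j + ε) * ⟪opInv (U j) p, p⟫ -
        ε * trWeight E F H * ‖p‖ ^ 2 / (1 + tr (U j))) ∧
      0 ≤ logTr V U ∧ ε * logTr V U ≤ η ∧ ∀ i, -(ε * Real.log (V i).det) ≤ η := by
  obtain ⟨C₁, hC₁, hpen⟩ := exists_penalty_bound (π := π) (Q := Q) hc hd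
  let S : Set ℝ := {r | ∃ (V : ∀ i, E i →L[ℝ] E i) (U : ∀ j, F j →L[ℝ] F j), Feas c d π Q V U ∧
    r = obj c d V U}
  have hSne : S.Nonempty := by
    obtain ⟨V, U, h⟩ := hne
    exact ⟨_, V, U, h, rfl⟩
  have hSb : BddAbove S := ⟨C, by rintro r ⟨V, U, h, rfl⟩; exact hC V U h⟩
  obtain ⟨_, ⟨V₀, U₀, h₀, rfl⟩, hsup⟩ := exists_lt_of_lt_csSup hSne
    (by linarith : sSup S - η / 3 < sSup S)
  set A := |penalty c d π Q V₀ U₀| + C₁ + 1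
  have hA : 0 < A := by positivity
  refine ⟨η / (3 * A), by positivity, fun ε hε hεlt => ?_⟩
  obtain ⟨V, U, hz, hmax⟩ := exists_max_penalized hc hd hne hC hε
  refine ⟨V, U, hz, critical_left hz hc hmax, critical_right hz hd hmax, ?_⟩
  rw [lt_div_iff₀ (by positivity)] at hεlt
  have h1 := hmax V₀ U₀ h₀
  have h2 : obj c d V U ≤ sSup S := le_csSup hSb ⟨V, U, hz, rfl⟩
  have h3 : ε * penalty c d π Q V₀ U₀ ≤ ε * (A - C₁ - 1) :=
    mul_le_mul_of_nonneg_left (by simp only [A]; linarith [le_abs_self (penalty c d π Q V₀ U₀)])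
      hε.le
  have h4 : ε * C₁ ≤ ε * A := mul_le_mul_of_nonneg_left (by
    simp only [A]; linarith [abs_nonneg (penalty c d π Q V₀ U₀)]) hε.le
  have h5 : ε * (penalty c d π Q V U + C₁) ≤ η := by nlinarith
  obtain ⟨p0, p1, p2, -, -⟩ := hpen V U hz
  refine ⟨p0, (mul_le_mul_of_nonneg_left p1 hε.le).trans h5, fun i => ?_⟩
  have := mul_le_mul_of_nonneg_left (p2 i) hε.le
  linarith

end FRBL

namespace FRBL

lemma exists_pos_le {ι : Type*} [Fintype ι] {c : ι → ℝ} (hc : ∀ i, 0 < c i) :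
    ∃ μ, 0 < μ ∧ ∀ i, μ ≤ c i := by
  have h0 : 0 ≤ ∑ i, (c i)⁻¹ := Finset.sum_nonneg fun i _ => (inv_pos.2 (hc i)).le
  refine ⟨(1 + ∑ i, (c i)⁻¹)⁻¹, by positivity, fun i => inv_le_of_inv_le₀ (hc i) ?_⟩
  have := Finset.single_le_sum (f := fun i => (c i)⁻¹)
    (fun i _ => (inv_pos.2 (hc i)).le) (Finset.mem_univ i)
  linarith

lemma logGauss_opInv {X : Type*} [NormedAddCommGroup X] [InnerProductSpace ℝ X]
    [FiniteDimensional ℝ X] {A : X →L[ℝ] X} (hA : Pos A) :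
    logGauss (opInv A) =
      (Module.finrank ℝ X : ℝ) / 2 * Real.log (2 * Real.pi) + Real.log A.det / 2 := by
  rw [logGauss, hA.det_opInv, Real.log_inv]
  ring

lemma mul_le_of_forall_log {x C : ℝ} (h : ∀ l : ℝ, x * l ≤ C) : x = 0 := by
  by_contra hx
  have := h ((C + 1) / x)
  rw [mul_div_cancel₀ _ hx] at this
  linarith

variable {k m : ℕ} {E : Fin k → Type*} {F : Fin m → Type*}
  [∀ i, NormedAddCommGroup (E i)] [∀ i, InnerProductSpace ℝ (E i)]
  [∀ i, FiniteDimensional ℝ (E i)]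
  [∀ i, MeasurableSpace (E i)] [∀ i, BorelSpace (E i)]
  [∀ j, NormedAddCommGroup (F j)] [∀ j, InnerProductSpace ℝ (F j)]
  [∀ j, FiniteDimensional ℝ (F j)]
  [∀ j, MeasurableSpace (F j)] [∀ j, BorelSpace (F j)]
  {H : Type*} [NormedAddCommGroup H] [InnerProductSpace ℝ H] [FiniteDimensional ℝ H]
  {c : Fin k → ℝ} {d : Fin m → ℝ} {B : ∀ i j, E i →ₗ[ℝ] F j}
  {π : ∀ i, H →L[ℝ] E i} {Q : ∀ j, H →L[ℝ] F j} {D₀ : ℝ}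

lemma sum_inner_dual (x : ∀ i, E i) (y : ∀ j, F j) :
    ∑ i, c i * ⟪x i, ∑ j, d j • LinearMap.adjoint (B i j) (y j)⟫ =
      ∑ j, d j * ⟪∑ i, c i • B i j (x i), y j⟫ := by
  simp only [inner_sum, sum_inner, real_inner_smul_left, real_inner_smul_right,
    LinearMap.adjoint_inner_right, Finset.mul_sum]
  rw [Finset.sum_comm]
  exact Finset.sum_congr rfl fun j _ => Finset.sum_congr rfl fun i _ => by ring

/-- A strictly feasible point provides a gaussian test pair for the dual datum. -/
lemma Feas.dual_le (hd : ∀ j, 0 < d j) (hπ : ∀ x : ∀ i, E i, ∃ h : H, ∀ i, π i h = x i)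
    (hQ : ∀ j h, Q j h = ∑ i, c i • B i j (π i h))
    {V : ∀ i, E i →L[ℝ] E i} {U : ∀ j, F j →L[ℝ] F j} (hz : Feas c d π Q V U) (y : ∀ j, F j) :
    ∑ i, c i * ⟪opInv (V i) (∑ j, d j • LinearMap.adjoint (B i j) (y j)),
      ∑ j, d j • LinearMap.adjoint (B i j) (y j)⟫ ≤ ∑ j, d j * ⟪opInv (U j) (y j), y j⟫ := by
  set ξ : ∀ i, E i := fun i => ∑ j, d j • LinearMap.adjoint (B i j) (y j) with hξ
  obtain ⟨h, hh⟩ := hπ fun i => opInv (V i) (ξ i)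
  have e1 : ∑ i, c i * ⟪opInv (V i) (ξ i), ξ i⟫ = ∑ j, d j * ⟪Q j h, y j⟫ := by
    rw [sum_inner_dual (B := B) (fun i => opInv (V i) (ξ i))]
    simp only [hQ, hh]
  have e2 : ∑ i, c i * ⟪V i (π i h), π i h⟫ = ∑ i, c i * ⟪opInv (V i) (ξ i), ξ i⟫ := by
    simp only [hh, (hz.1 _).apply_opInv]
    exact Finset.sum_congr rfl fun i _ => by rw [real_inner_comm]
  have e3 := hz.2.2.psd.2 h
  rw [inner_slack, e2] at e3
  have e4 : ∑ j, d j * ⟪Q j h, y j⟫ ≤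
      ∑ j, d j * ((⟪U j (Q j h), Q j h⟫ + ⟪opInv (U j) (y j), y j⟫) / 2) := by
    refine Finset.sum_le_sum fun j _ => mul_le_mul_of_nonneg_left ?_ (hd j).le
    have h1 := (hz.2.1 j).sq_inner_le (y j) (Q j h)
    have h2 := (hz.2.1 j).psd.2 (Q j h)
    have h3 := (hz.2.1 j).opInv_pos.psd.2 (y j)
    rw [real_inner_comm]
    refine abs_le_of_sq_le_sq' (b := (⟪U j (Q j h), Q j h⟫ + ⟪opInv (U j) (y j), y j⟫) / 2)
      ?_ (by positivity) |>.2
    nlinarith [sq_nonneg (⟪U j (Q j h), Q j h⟫ - ⟪opInv (U j) (y j), y j⟫)]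
  simp only [mul_div_assoc', mul_add, ← Finset.sum_div, Finset.sum_add_distrib] at e4
  rw [e1] at e3 ⊢
  linarith

variable (hB : IsBound F E d c (fun j i => LinearMap.adjoint (B i j)) D₀)
include hB

lemma IsBound.obj_le (hd : ∀ j, 0 < d j) (hπ : ∀ x : ∀ i, E i, ∃ h : H, ∀ i, π i h = x i)
    (hQ : ∀ j h, Q j h = ∑ i, c i • B i j (π i h))
    {V : ∀ i, E i →L[ℝ] E i} {U : ∀ j, F j →L[ℝ] F j} (hz : Feas c d π Q V U) :
    obj c d V U ≤ 2 * (D₀ + ∑ i, c i * ((Module.finrank ℝ (E i) : ℝ) / 2 * Real.log (2 * Real.pi))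
      - ∑ j, d j * ((Module.finrank ℝ (F j) : ℝ) / 2 * Real.log (2 * Real.pi))) := by
  have key := hB.gaussian_test (fun j => (hz.2.1 j).opInv_pos) (fun i => (hz.1 i).opInv_pos)
    (hz.dual_le hd hπ hQ)
  simp only [logGauss_opInv (hz.1 _), logGauss_opInv (hz.2.1 _), mul_add, Finset.sum_add_distrib,
    mul_div_assoc', ← Finset.sum_div] at key ⊢
  rw [obj]
  linarith

lemma IsBound.sum_finrank_eq (hd : ∀ j, 0 < d j)
    (hπ : ∀ x : ∀ i, E i, ∃ h : H, ∀ i, π i h = x i)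
    (hQ : ∀ j h, Q j h = ∑ i, c i • B i j (π i h))
    {V : ∀ i, E i →L[ℝ] E i} {U : ∀ j, F j →L[ℝ] F j} (hz : Feas c d π Q V U) :
    ∑ i, c i * (Module.finrank ℝ (E i) : ℝ) = ∑ j, d j * (Module.finrank ℝ (F j) : ℝ) := by
  have hU := fun j => (hz.2.1 j).opInv_pos
  have hV := fun i => (hz.1 i).opInv_pos
  have key : ∀ l : ℝ, (∑ i, c i * (Module.finrank ℝ (E i) : ℝ) -
      ∑ j, d j * (Module.finrank ℝ (F j) : ℝ)) * l ≤ 2 * (D₀ +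
      ∑ i, c i * logGauss (opInv (V i)) - ∑ j, d j * logGauss (opInv (U j))) := fun l => by
    have := hB.gaussian_test (fun j => (hU j).smul (Real.exp_pos l))
      (fun i => (hV i).smul (Real.exp_pos l)) fun y => by
        simp only [_root_.smul_apply, real_inner_smul_left, mul_left_comm _ (Real.exp l),
          ← Finset.mul_sum]
        exact mul_le_mul_of_nonneg_left (hz.dual_le hd hπ hQ y) (Real.exp_pos l).le
    simp only [logGauss_smul (hU _) (Real.exp_pos l), logGauss_smul (hV _) (Real.exp_pos l),
      Real.log_exp, mul_sub, Finset.sum_sub_distrib, div_mul_eq_mul_div, mul_div_assoc',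
      ← Finset.sum_div, ← mul_assoc, ← Finset.sum_mul] at this
    linarith
  exact sub_eq_zero.1 (mul_le_of_forall_log key)

omit hB in
lemma FlowCond.adjoint_le {G : Type*} [NormedAddCommGroup G] [InnerProductSpace ℝ G]
    [FiniteDimensional ℝ G] [MeasurableSpace G] [BorelSpace G] {θ : ℝ} (hθ : 0 < θ)
    (hd : ∀ j, 0 < d j) {A : ∀ i j, E i →L[ℝ] F j} (hA : ∀ i j x, A i j x = c i • B i j x)
    {M : ∀ i, G →L[ℝ] E i} {N : ∀ j, G →L[ℝ] F j} (h : FlowCond (fun i => θ * c i) d A M N)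
    (y : ∀ j, F j) :
    ∑ i, c i * ‖ContinuousLinearMap.adjoint (M i)
      (∑ j, d j • LinearMap.adjoint (B i j) (y j))‖ ^ 2 ≤
      θ * ∑ j, d j * ‖ContinuousLinearMap.adjoint (N j) (y j)‖ ^ 2 := by
  set ξ : ∀ i, E i := fun i => ∑ j, d j • LinearMap.adjoint (B i j) (y j) with hξ
  obtain ⟨v, hv, hle⟩ := h.2 fun i => ContinuousLinearMap.adjoint (M i) (ξ i)
  have e1 : ∑ i, c i * ‖ContinuousLinearMap.adjoint (M i) (ξ i)‖ ^ 2 =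
      ∑ j, d j * ⟪v j, ContinuousLinearMap.adjoint (N j) (y j)⟫ := by
    simp only [ContinuousLinearMap.adjoint_inner_right, hv, hA]
    rw [← sum_inner_dual]
    refine Finset.sum_congr rfl fun i _ => ?_
    rw [← inner_mul_adjoint]
    rfl
  have e2 : ∑ j, d j * ⟪v j, ContinuousLinearMap.adjoint (N j) (y j)⟫ ≤
      ∑ j, d j * ((θ⁻¹ * ‖v j‖ ^ 2 + θ * ‖ContinuousLinearMap.adjoint (N j) (y j)‖ ^ 2) / 2) := by
    refine Finset.sum_le_sum fun j _ => mul_le_mul_of_nonneg_left ?_ (hd j).le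
    refine (real_inner_le_norm _ _).trans ?_
    have h1 : 0 ≤ θ⁻¹ * (‖v j‖ - θ * ‖ContinuousLinearMap.adjoint (N j) (y j)‖) ^ 2 := by
      positivity
    have h2 : θ⁻¹ * (‖v j‖ - θ * ‖ContinuousLinearMap.adjoint (N j) (y j)‖) ^ 2 =
      θ⁻¹ * ‖v j‖ ^ 2 + θ * ‖ContinuousLinearMap.adjoint (N j) (y j)‖ ^ 2 -
        2 * (‖v j‖ * ‖ContinuousLinearMap.adjoint (N j) (y j)‖) := by
      field_simp
      ring
    linarith
  have e3 : θ⁻¹ * ∑ j, d j * ‖v j‖ ^ 2 ≤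
      ∑ i, c i * ‖ContinuousLinearMap.adjoint (M i) (ξ i)‖ ^ 2 := by
    rw [inv_mul_le_iff₀ hθ, Finset.mul_sum]
    simpa only [mul_assoc] using hle
  simp only [mul_div_assoc', mul_add, ← Finset.sum_div, Finset.sum_add_distrib,
    mul_left_comm _ θ⁻¹, mul_left_comm _ θ, ← Finset.mul_sum] at e2
  rw [e1] at e3 ⊢
  linarith

lemma IsBound.logGauss_le {G : Type*} [NormedAddCommGroup G] [InnerProductSpace ℝ G]
    [FiniteDimensional ℝ G] [MeasurableSpace G] [BorelSpace G] {θ : ℝ} (hθ : 0 < θ)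
    (hd : ∀ j, 0 < d j) {A : ∀ i j, E i →L[ℝ] F j} (hA : ∀ i j x, A i j x = c i • B i j x)
    {M : ∀ i, G →L[ℝ] E i} {N : ∀ j, G →L[ℝ] F j} (h : FlowCond (fun i => θ * c i) d A M N)
    (hM : ∀ i, Pos (M i ∘L ContinuousLinearMap.adjoint (M i)))
    (hN : ∀ j, Pos (N j ∘L ContinuousLinearMap.adjoint (N j))) :
    ∑ j, d j * logGauss (N j ∘L ContinuousLinearMap.adjoint (N j)) ≤
      D₀ + ∑ i, c i * logGauss (M i ∘L ContinuousLinearMap.adjoint (M i)) +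
        (∑ i, c i * (Module.finrank ℝ (E i) : ℝ)) / 2 * Real.log θ := by
  have hθ' := inv_pos.2 hθ
  have := hB.gaussian_test hN (fun i => (hM i).smul hθ') fun y => by
    simp only [_root_.smul_apply, real_inner_smul_left, inner_mul_adjoint,
      mul_left_comm _ θ⁻¹, ← Finset.mul_sum]
    rw [inv_mul_le_iff₀ hθ]
    exact h.adjoint_le hθ hd hA y
  simp only [logGauss_smul (hM _) hθ', Real.log_inv, mul_sub, Finset.sum_sub_distrib, mul_neg,
    div_mul_eq_mul_div, mul_div_assoc', ← Finset.sum_div, ← mul_assoc, ← Finset.sum_mul,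
    Finset.sum_neg_distrib] at this
  linarith

end FRBL

namespace FRBL

section arithmetic

lemma near_critical_arith_left {c ε K w r a μ : ℝ} (hμ : 0 < μ) (hc : μ ≤ c) (hε : 0 < ε)
    (hK : 0 ≤ K) (hr : 0 ≤ r) (hrw : r ≤ w) (h : c * a = (c - ε) * w + ε * K * r) :
    (1 - (K + 1) * ε / μ) * w ≤ a ∧ a ≤ (1 + (K + 1) * ε / μ) * w := by
  have hc0 : 0 < c := hμ.trans_le hc
  have hw : 0 ≤ w := hr.trans hrw
  have h1 : (K + 1) * ε ≤ c * ((K + 1) * ε / μ) := by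
    rw [mul_div_assoc', le_div_iff₀ hμ]
    nlinarith [mul_nonneg (by linarith : 0 ≤ K + 1) hε.le]
  have h2 := mul_le_mul_of_nonneg_right h1 hw
  have h3 : ε * K * r ≤ ε * K * w := mul_le_mul_of_nonneg_left hrw (by positivity)
  have h4 : 0 ≤ ε * K * r := by positivity
  have h5 : 0 ≤ ε * w := by positivity
  have h6 : 0 ≤ ε * K * w := by positivity
  constructor
  · refine le_of_mul_le_mul_left ?_ hc0
    rw [h]
    linarith
  · refine le_of_mul_le_mul_left ?_ hc0
    rw [h]
    linarith

lemma near_critical_arith_right {d ε K w r a μ : ℝ} (hμ : 0 < μ) (hd : μ ≤ d) (hε : 0 < ε)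
    (hK : 0 ≤ K) (hr : 0 ≤ r) (hrw : r ≤ w) (h : d * a = (d + ε) * w - ε * K * r) :
    (1 - (K + 1) * ε / μ) * w ≤ a := by
  have hd0 : 0 < d := hμ.trans_le hd
  have hw : 0 ≤ w := hr.trans hrw
  have h1 : (K + 1) * ε ≤ d * ((K + 1) * ε / μ) := by
    rw [mul_div_assoc', le_div_iff₀ hμ]
    nlinarith [mul_nonneg (by linarith : 0 ≤ K + 1) hε.le]
  have h2 := mul_le_mul_of_nonneg_right h1 hw
  have h3 : ε * K * r ≤ ε * K * w := mul_le_mul_of_nonneg_left hrw (by positivity)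
  have h5 : 0 ≤ ε * w := by positivity
  refine le_of_mul_le_mul_left ?_ hd0
  rw [h]
  linarith

lemma Pos.norm_sq_div_le {X : Type*} [NormedAddCommGroup X] [InnerProductSpace ℝ X]
    [FiniteDimensional ℝ X] {A : X →L[ℝ] X} (hA : Pos A) (p : X) :
    0 ≤ ‖p‖ ^ 2 / (1 + tr A) ∧ ‖p‖ ^ 2 / (1 + tr A) ≤ ⟪opInv A p, p⟫ := by
  have h0 := hA.psd.tr_nonneg
  have h1 := hA.opInv_pos.psd.2 p
  refine ⟨by positivity, ?_⟩
  rw [div_le_iff₀ (by positivity)]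
  linarith [hA.norm_sq_le p]

end arithmetic

variable {k m : ℕ} {E : Fin k → Type*} {F : Fin m → Type*}
  [∀ i, NormedAddCommGroup (E i)] [∀ i, InnerProductSpace ℝ (E i)]
  [∀ i, FiniteDimensional ℝ (E i)]
  [∀ j, NormedAddCommGroup (F j)] [∀ j, InnerProductSpace ℝ (F j)]
  [∀ j, FiniteDimensional ℝ (F j)]
  {H : Type*} [NormedAddCommGroup H] [InnerProductSpace ℝ H] [FiniteDimensional ℝ H]
  {c : Fin k → ℝ} {d : Fin m → ℝ} {π : ∀ i, H →L[ℝ] E i} {Q : ∀ j, H →L[ℝ] F j}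

lemma exists_feas (hc : ∀ i, 0 < c i) (hπ : ∀ h : H, (∀ i, π i h = 0) → h = 0) (hd : ∀ j, 0 < d j)
    {L : ℝ} (hQ : ∀ j h, ‖Q j h‖ ^ 2 ≤ L * ∑ i, ‖π i h‖ ^ 2) :
    ∃ (V : ∀ i, E i →L[ℝ] E i) (U : ∀ j, F j →L[ℝ] F j), Feas c d π Q V U := by
  obtain ⟨μ, hμ, hμc⟩ := exists_pos_le hc
  have hD : 0 ≤ ∑ j, d j := Finset.sum_nonneg fun j _ => (hd j).le
  set r := ((∑ j, d j) * |L| + 1) / μ with hr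
  have hr0 : 0 < r := by positivity
  refine ⟨fun i => r • 1, fun j => 1, fun i => pos_one.smul hr0, fun j => pos_one,
    slack_symm (fun i => (pos_one.smul hr0).1) (fun j => pos_one.1), fun x hx => ?_⟩
  rw [inner_slack]
  simp only [_root_.smul_apply, one_apply_eq_self, real_inner_smul_left,
    real_inner_self_eq_norm_sq]
  have hs : 0 < ∑ i, ‖π i x‖ ^ 2 := by
    refine lt_of_le_of_ne (Finset.sum_nonneg fun i _ => by positivity)
      fun h0 => hx (hπ x fun i => ?_)
    have := (Finset.sum_eq_zero_iff_of_nonneg fun i _ => by positivity).1 h0.symm i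
      (Finset.mem_univ i)
    simpa using this
  have h1 : ∑ j, d j * ‖Q j x‖ ^ 2 ≤ (∑ j, d j) * (|L| * ∑ i, ‖π i x‖ ^ 2) := by
    rw [Finset.sum_mul]
    exact Finset.sum_le_sum fun j _ => mul_le_mul_of_nonneg_left
      ((hQ j x).trans (mul_le_mul_of_nonneg_right (le_abs_self L) hs.le)) (hd j).le
  have h2 : μ * (r * ∑ i, ‖π i x‖ ^ 2) ≤ ∑ i, c i * (r * ‖π i x‖ ^ 2) := by
    rw [Finset.mul_sum, Finset.mul_sum]
    exact Finset.sum_le_sum fun i _ => mul_le_mul_of_nonneg_right (hμc i) (by positivity)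
  have h3 : μ * (r * ∑ i, ‖π i x‖ ^ 2) = ((∑ j, d j) * |L| + 1) * ∑ i, ‖π i x‖ ^ 2 := by
    rw [← mul_assoc, hr, mul_div_cancel₀ _ hμ.ne']
  linarith

/-- Near-critical points of the gaussian problem produce driving maps. -/
lemma flowCond_of_near_critical {θ δ : ℝ} (hδ : 0 ≤ δ) (hδ1 : δ < 1)
    (hθ : θ = (1 + δ) / (1 - δ)) [MeasurableSpace H] [BorelSpace H]
    [∀ i, MeasurableSpace (E i)] [∀ i, BorelSpace (E i)]
    [∀ j, MeasurableSpace (F j)] [∀ j, BorelSpace (F j)] (hc : ∀ i, 0 < c i) (hd : ∀ j, 0 < d j)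
    (hπ : ∀ x : ∀ i, E i, ∃ h : H, ∀ i, π i h = x i)
    {A : ∀ i j, E i →L[ℝ] F j} (hQ : ∀ j h, Q j h = ∑ i, A i j (π i h))
    {V : ∀ i, E i →L[ℝ] E i} {U : ∀ j, F j →L[ℝ] F j} (hz : Feas c d π Q V U) {M₀ : H →L[ℝ] H}
    (hM : ∀ i p, (1 - δ) * ⟪opInv (V i) p, p⟫ ≤
        ‖ContinuousLinearMap.adjoint (π i ∘L M₀) p‖ ^ 2 ∧
      ‖ContinuousLinearMap.adjoint (π i ∘L M₀) p‖ ^ 2 ≤ (1 + δ) * ⟪opInv (V i) p, p⟫)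
    (hN : ∀ j p, (1 - δ) * ⟪opInv (U j) p, p⟫ ≤
      ‖ContinuousLinearMap.adjoint (Q j ∘L M₀) p‖ ^ 2) :
    (∀ i, Pos ((π i ∘L M₀) ∘L ContinuousLinearMap.adjoint (π i ∘L M₀))) ∧
    (∀ j, Pos ((Q j ∘L M₀) ∘L ContinuousLinearMap.adjoint (Q j ∘L M₀))) ∧
    FlowCond (fun i => θ * c i) d A (fun i => π i ∘L M₀) (fun j => Q j ∘L M₀) := by
  have hδ2 : 0 < 1 - δ := by linarith
  have hP : ∀ i, Pos ((π i ∘L M₀) ∘L ContinuousLinearMap.adjoint (π i ∘L M₀)) := fun i =>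
    pos_mul_adjoint fun p hp => (mul_pos hδ2 ((hz.1 i).opInv_pos.2 p hp)).trans_le (hM i p).1
  have hP' : ∀ j, Pos ((Q j ∘L M₀) ∘L ContinuousLinearMap.adjoint (Q j ∘L M₀)) := fun j =>
    pos_mul_adjoint fun p hp => (mul_pos hδ2 ((hz.2.1 j).opInv_pos.2 p hp)).trans_le (hN j p)
  refine ⟨hP, hP', fun j z => hQ j _, fun q => ?_⟩
  obtain ⟨h, hh⟩ := hπ fun i => π i (M₀ (q i))
  have hy : ∀ j, ∑ i, A i j ((π i ∘L M₀) (q i)) = Q j h := fun j => by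
    simp only [hQ, hh, ContinuousLinearMap.comp_apply]
  refine ⟨fun j => ContinuousLinearMap.adjoint (Q j ∘L M₀)
    (opInv ((Q j ∘L M₀) ∘L ContinuousLinearMap.adjoint (Q j ∘L M₀)) (Q j h)), fun j => ?_, ?_⟩
  · rw [hy]
    exact (hP' j).apply_opInv _
  have e1 : ∀ j, (1 - δ) * ‖ContinuousLinearMap.adjoint (Q j ∘L M₀)
      (opInv ((Q j ∘L M₀) ∘L ContinuousLinearMap.adjoint (Q j ∘L M₀)) (Q j h))‖ ^ 2 ≤
      ⟪U j (Q j h), Q j h⟫ := fun j => by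
    rw [← inner_mul_adjoint, (hP' j).apply_opInv, real_inner_comm]
    exact (hz.2.1 j).mul_inner_opInv_le (hP' j) hδ2
      (fun p => by rw [inner_mul_adjoint]; exact hN j p) _
  have e2 : ∀ i, ⟪V i (π i h), π i h⟫ ≤ (1 + δ) * ‖q i‖ ^ 2 := fun i => by
    rw [hh]
    exact (hz.1 i).inner_apply_le (M := π i ∘L M₀) (by linarith) (fun p => (hM i p).2) (q i)
  have e3 := hz.2.2.psd.2 h
  rw [inner_slack] at e3
  have e4 := Finset.sum_le_sum fun j (_ : j ∈ Finset.univ) =>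
    mul_le_mul_of_nonneg_left (e1 j) (hd j).le
  have e5 := Finset.sum_le_sum fun i (_ : i ∈ Finset.univ) =>
    mul_le_mul_of_nonneg_left (e2 i) (hc i).le
  simp only [mul_left_comm _ (1 - δ), mul_left_comm _ (1 + δ), ← Finset.mul_sum] at e4 e5
  simp only [mul_assoc θ, ← Finset.mul_sum]
  rw [hθ, div_mul_eq_mul_div, le_div_iff₀ hδ2]
  linarith

end FRBL

namespace FRBL

lemma norm_sq_adjoint_comp_sqrt {X H : Type*} [NormedAddCommGroup X] [InnerProductSpace ℝ X]
    [FiniteDimensional ℝ X] [NormedAddCommGroup H] [InnerProductSpace ℝ H] [FiniteDimensional ℝ H]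
    (p : H →L[ℝ] X) {R S : H →L[ℝ] H} (hR : Pos R) (hRS : R * R = S) {ε : ℝ} (hε : 0 ≤ ε) (x : X) :
    ‖ContinuousLinearMap.adjoint (p ∘L (√ε • R)) x‖ ^ 2 =
      ε * ⟪S (ContinuousLinearMap.adjoint p x), ContinuousLinearMap.adjoint p x⟫ := by
  have h : ContinuousLinearMap.adjoint (p ∘L (√ε • R)) x =
      √ε • R (ContinuousLinearMap.adjoint p x) := by
    refine ext_inner_right ℝ fun y => ?_
    simp [ContinuousLinearMap.adjoint_inner_left, real_inner_smul_left,
      hR.1 (ContinuousLinearMap.adjoint p x)]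
  rw [h, ← hRS, mul_apply_eq_comp, hR.1, real_inner_self_eq_norm_sq, norm_smul, mul_pow,
    Real.norm_eq_abs, sq_abs, Real.sq_sqrt hε]

variable {k m : ℕ} {E : Fin k → Type*} {F : Fin m → Type*}
  [∀ i, NormedAddCommGroup (E i)] [∀ i, InnerProductSpace ℝ (E i)]
  [∀ i, FiniteDimensional ℝ (E i)]
  [∀ i, MeasurableSpace (E i)] [∀ i, BorelSpace (E i)]
  [∀ j, NormedAddCommGroup (F j)] [∀ j, InnerProductSpace ℝ (F j)]
  [∀ j, FiniteDimensional ℝ (F j)]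
  [∀ j, MeasurableSpace (F j)] [∀ j, BorelSpace (F j)]
  {H : Type*} [NormedAddCommGroup H] [InnerProductSpace ℝ H] [FiniteDimensional ℝ H]
  {c : Fin k → ℝ} {d : Fin m → ℝ} {B : ∀ i j, E i →ₗ[ℝ] F j}
  {π : ∀ i, H →L[ℝ] E i} {Q : ∀ j, H →L[ℝ] F j} {A : ∀ i j, E i →L[ℝ] F j} {D₀ : ℝ}

lemma exists_norm_sq_sum_le (A : ∀ i j, E i →L[ℝ] F j) :
    ∃ L : ℝ, 0 ≤ L ∧ ∀ j (x : ∀ i, E i), ‖∑ i, A i j (x i)‖ ^ 2 ≤ L * ∑ i, ‖x i‖ ^ 2 := by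
  refine ⟨∑ j, ∑ i, ‖A i j‖ ^ 2, by positivity, fun j x => ?_⟩
  have h1 : ‖∑ i, A i j (x i)‖ ≤ ∑ i, ‖A i j‖ * ‖x i‖ :=
    (norm_sum_le _ _).trans (Finset.sum_le_sum fun i _ => (A i j).le_opNorm _)
  calc ‖∑ i, A i j (x i)‖ ^ 2 ≤ (∑ i, ‖A i j‖ * ‖x i‖) ^ 2 :=
        pow_le_pow_left₀ (norm_nonneg _) h1 2
    _ ≤ (∑ i, ‖A i j‖ ^ 2) * ∑ i, ‖x i‖ ^ 2 := Finset.sum_mul_sq_le_sq_mul_sq _ _ _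
    _ ≤ _ := mul_le_mul_of_nonneg_right
        (Finset.single_le_sum (f := fun j => ∑ i, ‖A i j‖ ^ 2) (fun j _ => by positivity)
          (Finset.mem_univ j)) (by positivity)

lemma exists_feas_of_sum (hc : ∀ i, 0 < c i) (hd : ∀ j, 0 < d j)
    (hπ0 : ∀ h : H, (∀ i, π i h = 0) → h = 0) (hQ : ∀ j h, Q j h = ∑ i, A i j (π i h)) :
    ∃ (V : ∀ i, E i →L[ℝ] E i) (U : ∀ j, F j →L[ℝ] F j), Feas c d π Q V U := by
  obtain ⟨L, -, hL⟩ := exists_norm_sq_sum_le A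
  exact exists_feas hc hπ0 hd (L := L) fun j h => by rw [hQ]; exact hL j _

variable (hB : IsBound F E d c (fun j i => LinearMap.adjoint (B i j)) D₀)
include hB

/-- Driving maps along which the heat flow realises the gaussian bound up to `η`. -/
theorem IsBound.exists_driving [MeasurableSpace H] [BorelSpace H] (hc : ∀ i, 0 < c i)
    (hd : ∀ j, 0 < d j) (hπ : ∀ x : ∀ i, E i, ∃ h : H, ∀ i, π i h = x i)
    (hπ0 : ∀ h : H, (∀ i, π i h = 0) → h = 0) (hA : ∀ i j x, A i j x = c i • B i j x)
    (hQ : ∀ j h, Q j h = ∑ i, A i j (π i h)) {η : ℝ} (hη : 0 < η) (hη1 : η ≤ 1) :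
    ∃ (θ T : ℝ) (M : ∀ i, H →L[ℝ] E i) (N : ∀ j, H →L[ℝ] F j),
      1 ≤ θ ∧ θ ≤ 1 + η ∧ 1 ≤ T ∧ (θ - 1) * Real.log T ≤ η ∧
      FlowCond (fun i => θ * c i) d A M N ∧
      (∀ i, Pos (M i ∘L ContinuousLinearMap.adjoint (M i))) ∧
      (∀ j, Pos (N j ∘L ContinuousLinearMap.adjoint (N j))) ∧
      (∀ i x, ⟪opInv (M i ∘L ContinuousLinearMap.adjoint (M i)) x, x⟫ ≤ 2 * η * T * ‖x‖ ^ 2) ∧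
      (∀ i, (θ - 1) * Real.log (M i ∘L ContinuousLinearMap.adjoint (M i)).det ≤ η) ∧
      ∑ j, d j * logGauss (N j ∘L ContinuousLinearMap.adjoint (N j)) ≤
        D₀ + ∑ i, c i * logGauss (M i ∘L ContinuousLinearMap.adjoint (M i)) +
          (∑ i, c i * (Module.finrank ℝ (E i) : ℝ)) / 2 * Real.log θ := by
  have hQB : ∀ j h, Q j h = ∑ i, c i • B i j (π i h) := fun j h => by simp only [hQ, hA]
  obtain ⟨μ₁, hμ₁, hμc⟩ := exists_pos_le hc
  obtain ⟨μ₂, hμ₂, hμd⟩ := exists_pos_le hd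
  obtain ⟨μ, hμ, hμ1, hμ2⟩ : ∃ μ, 0 < μ ∧ μ ≤ μ₁ ∧ μ ≤ μ₂ :=
    ⟨min μ₁ μ₂, lt_min hμ₁ hμ₂, min_le_left _ _, min_le_right _ _⟩
  set K := trWeight E F H with hK
  have hnK : ∀ i, (Module.finrank ℝ (E i) : ℝ) ≤ K := fun i => by
    have h1 := Finset.single_le_sum (f := fun i => (Module.finrank ℝ (E i) : ℝ))
      (fun i _ => by positivity) (Finset.mem_univ i)
    have h2 : 0 ≤ ∑ j, (Module.finrank ℝ (F j) : ℝ) := by positivity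
    have h3 : (0 : ℝ) ≤ Module.finrank ℝ H := by positivity
    simp only [hK, trWeight]
    linarith
  have hK0 : 0 ≤ K := by
    rw [hK, trWeight]
    positivity
  set Λ := 4 * (K + 1) / μ with hΛ
  have hΛ0 : 0 < Λ := by positivity
  obtain ⟨ε₀, hε₀, hε⟩ := exists_near_critical hc hd (exists_feas_of_sum hc hd hπ0 hQ)
    (fun V U hz => hB.obj_le hd hπ hQB hz) (η := η / (2 * Λ)) (by positivity)
  set W := 1 + |Real.log η| + K with hW
  have hW0 : 0 < W := by positivity
  obtain ⟨ε, hε0, hεlt, hεW⟩ : ∃ ε, 0 < ε ∧ ε < ε₀ ∧ Λ * ε * W ≤ η / 2 := by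
    refine ⟨min (ε₀ / 2) (η / (2 * Λ * W)), by positivity,
      (min_le_left _ _).trans_lt (by linarith), ?_⟩
    have : Λ * min (ε₀ / 2) (η / (2 * Λ * W)) * W ≤ Λ * (η / (2 * Λ * W)) * W := by
      gcongr
      exact min_le_right _ _
    refine this.trans_eq ?_
    field_simp
  obtain ⟨V, U, hz, hVc, hUc, hl0, hl1, hdet⟩ := hε ε hε0 hεlt
  have hΛε : Λ * ε ≤ η / 2 := by
    refine le_trans ?_ hεW
    have : (0 : ℝ) ≤ |Real.log η| := abs_nonneg _
    exact le_mul_of_one_le_right (by positivity) (by linarith)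
  set δ := (K + 1) * ε / μ with hδ
  have hδΛ : 4 * δ = Λ * ε := by
    rw [hδ, hΛ]
    ring
  have hδ0 : 0 ≤ δ := by positivity
  have hδ1 : δ ≤ 1 / 8 := by linarith
  have hδ2 : 0 < 1 - δ := by linarith
  obtain ⟨R, hR, hRS, -⟩ := hz.2.2.opInv_pos.exists_sqrt
  set M₀ : H →L[ℝ] H := √ε • R with hM₀
  have hsqE := fun i p => norm_sq_adjoint_comp_sqrt (π i) hR hRS hε0.le p
  have hsqF := fun j p => norm_sq_adjoint_comp_sqrt (Q j) hR hRS hε0.le p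
  have hM : ∀ i p, (1 - δ) * ⟪opInv (V i) p, p⟫ ≤
        ‖ContinuousLinearMap.adjoint (π i ∘L M₀) p‖ ^ 2 ∧
      ‖ContinuousLinearMap.adjoint (π i ∘L M₀) p‖ ^ 2 ≤ (1 + δ) * ⟪opInv (V i) p, p⟫ :=
    fun i p => by
    obtain ⟨h1, h2⟩ := (hz.1 i).norm_sq_div_le p
    refine near_critical_arith_left hμ (hμ1.trans (hμc i)) hε0 hK0 h1 h2 ?_
    rw [hsqE, ← mul_div_assoc, ← hVc]
    ring
  have hN : ∀ j p, (1 - δ) * ⟪opInv (U j) p, p⟫ ≤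
      ‖ContinuousLinearMap.adjoint (Q j ∘L M₀) p‖ ^ 2 := fun j p => by
    obtain ⟨h1, h2⟩ := (hz.2.1 j).norm_sq_div_le p
    refine near_critical_arith_right hμ (hμ2.trans (hμd j)) hε0 hK0 h1 h2 ?_
    rw [hsqF, ← mul_div_assoc, ← hUc]
    ring
  set θ := (1 + δ) / (1 - δ) with hθ
  have hθ1 : 1 ≤ θ := by
    rw [hθ, le_div_iff₀ hδ2]
    linarith
  have hθ2 : θ - 1 ≤ Λ * ε := by
    rw [← hδΛ, sub_le_iff_le_add, hθ, div_le_iff₀ hδ2]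
    nlinarith
  obtain ⟨hP, hP', hflow⟩ := flowCond_of_near_critical hδ0 (by linarith) hθ hc hd hπ hQ hz hM hN
  refine ⟨θ, Real.exp (logTr V U) / η, _, _, hθ1, by linarith, ?_, ?_, hflow, hP, hP',
    fun i x => ?_, fun i => ?_, hB.logGauss_le (by linarith) hd hA hflow hP hP'⟩
  · rw [le_div_iff₀ hη, one_mul]
    exact hη1.trans (Real.one_le_exp hl0)
  · rw [Real.log_div (Real.exp_pos _).ne' hη.ne', Real.log_exp]
    have h1 : 0 ≤ logTr V U + |Real.log η| := by positivity
    have h2 : (θ - 1) * (logTr V U - Real.log η) ≤ (θ - 1) * (logTr V U + |Real.log η|) :=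
      mul_le_mul_of_nonneg_left (by linarith [neg_le_abs (Real.log η)]) (by linarith)
    have h3 : (θ - 1) * (logTr V U + |Real.log η|) ≤ Λ * ε * (logTr V U + |Real.log η|) :=
      mul_le_mul_of_nonneg_right hθ2 h1
    have h4 : Λ * (ε * logTr V U) ≤ η / 2 := by
      refine (mul_le_mul_of_nonneg_left hl1 hΛ0.le).trans_eq ?_
      field_simp
    have h5 : Λ * ε * |Real.log η| ≤ Λ * ε * W :=
      mul_le_mul_of_nonneg_left (by linarith) (by positivity)
    linarith
  · have htr : tr (V i) ≤ Real.exp (logTr V U) := by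
      have h0 := fun i => (hz.1 i).psd.tr_nonneg
      have h0' := fun j => (hz.2.1 j).psd.tr_nonneg
      have h1 := Finset.single_le_sum (f := fun i => Real.log (1 + tr (V i)))
        (fun i _ => Real.log_nonneg (by linarith [h0 i])) (Finset.mem_univ i)
      have h2 : 0 ≤ ∑ j, Real.log (1 + tr (U j)) :=
        Finset.sum_nonneg fun j _ => Real.log_nonneg (by linarith [h0' j])
      have h3 : Real.log (1 + tr (V i)) ≤ logTr V U := by
        rw [logTr]
        linarith
      rw [Real.log_le_iff_le_exp (by linarith [h0 i])] at h3
      linarith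
    have h1 := (hz.1 i).mul_inner_opInv_le (hP i) (a := 1 - δ) hδ2
      (fun p => by rw [inner_mul_adjoint]; exact (hM i p).1) x
    have h2 := (hz.1 i).psd.inner_le_tr x
    have h3 := mul_le_mul_of_nonneg_right htr (sq_nonneg ‖x‖)
    have h4 := (hP i).opInv_pos.psd.2 x
    have h5 : 2 * η * (Real.exp (logTr V U) / η) = 2 * Real.exp (logTr V U) := by
      field_simp
    rw [h5]
    nlinarith
  · set P := (π i ∘L M₀) ∘L ContinuousLinearMap.adjoint (π i ∘L M₀) with hPdef
    have h1 : P.det * (V i).det ≤ (1 + δ) ^ Module.finrank ℝ (E i) :=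
      (hz.1 i).det_mul_det_le (hP i).psd fun p => by
        rw [inner_mul_adjoint]
        exact (hM i p).2
    have h2 : Real.log P.det + Real.log (V i).det ≤ K := by
      rw [← Real.log_mul (hP i).det_pos.ne' (hz.1 i).det_pos.ne']
      refine (Real.log_le_log (mul_pos (hP i).det_pos (hz.1 i).det_pos) h1).trans ?_
      rw [Real.log_pow]
      have h3 : Real.log (1 + δ) ≤ 1 := (Real.log_le_sub_one_of_pos (by linarith)).trans
        (by linarith)
      have h4 : 0 ≤ Real.log (1 + δ) := Real.log_nonneg (by linarith)
      nlinarith [hnK i]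
    have h3 : Real.log P.det ≤ K + η / (2 * Λ) / ε := by
      have : -Real.log (V i).det ≤ η / (2 * Λ) / ε := by
        rw [le_div_iff₀ hε0]
        linarith [hdet i]
      linarith
    calc (θ - 1) * Real.log P.det ≤ (θ - 1) * (K + η / (2 * Λ) / ε) :=
          mul_le_mul_of_nonneg_left h3 (by linarith)
      _ ≤ Λ * ε * (K + η / (2 * Λ) / ε) := mul_le_mul_of_nonneg_right hθ2 (by positivity)
      _ = Λ * ε * K + η / 2 := by field_simp
      _ ≤ Λ * ε * W + η / 2 := by
          have : (0 : ℝ) ≤ |Real.log η| := abs_nonneg _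
          gcongr
          linarith
      _ ≤ η := by linarith

end FRBL

namespace FRBL

section heatZero

variable {X G : Type*} [NormedAddCommGroup X] [InnerProductSpace ℝ X] [FiniteDimensional ℝ X]
  [MeasurableSpace X] [BorelSpace X]
  [NormedAddCommGroup G] [InnerProductSpace ℝ G] [FiniteDimensional ℝ G]
  [MeasurableSpace G] [BorelSpace G]

lemma heat_zero_eq {M : G →L[ℝ] X} (hP : Pos (M ∘L ContinuousLinearMap.adjoint M)) {T : ℝ}
    (hT : 0 < T) {f : X → ℝ} (hf : Measurable f) :
    heat M T f 0 = Real.exp (logGauss (M ∘L ContinuousLinearMap.adjoint M) -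
      (Module.finrank ℝ X : ℝ) * Real.log (2 * Real.pi) -
      (Module.finrank ℝ X : ℝ) / 2 * Real.log T) *
      ∫ x, Real.exp (-⟪opInv (M ∘L ContinuousLinearMap.adjoint M) x, x⟫ / (2 * T)) * f x := by
  set P := M ∘L ContinuousLinearMap.adjoint M with hPdef
  obtain ⟨R, hR, hRP, hdet⟩ := hP.exists_sqrt
  have hadj : ∀ x, ‖ContinuousLinearMap.adjoint M x‖ = ‖ContinuousLinearMap.adjoint R x‖ :=
    fun x => by
    have hR' : ContinuousLinearMap.adjoint R x = R x := ext_inner_right ℝ fun y => by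
      rw [ContinuousLinearMap.adjoint_inner_left, hR.1]
    rw [← sq_eq_sq₀ (norm_nonneg _) (norm_nonneg _), ← inner_mul_adjoint, ← hPdef, hR', ← hRP,
      mul_apply_eq_comp, hR.1, real_inner_self_eq_norm_sq]
  have hmap : (stdGaussian G).map (√T • M) = (stdGaussian X).map (√T • R) :=
    map_stdGaussian_eq_of_norm_adjoint _ _ fun x => by simp [norm_smul, hadj]
  have h1 := heat_eq_integral_map M T hf 0
  have h2 := heat_eq_integral_map R T hf 0
  rw [hmap, ← h2] at h1
  rw [h1, heat]
  simp only [zero_add]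
  rw [integral_stdGaussian_comp_of_sqrt hR hRP hT]
  congr 1
  have hp : gaussNorm X = Real.exp (-(Module.finrank ℝ X : ℝ) / 2 * Real.log (2 * Real.pi)) := by
    rw [gaussNorm, Real.rpow_def_of_pos (by positivity), mul_comm]
  have ht : (√T ^ Module.finrank ℝ X)⁻¹ =
      Real.exp (-((Module.finrank ℝ X : ℝ) / 2 * Real.log T)) := by
    rw [Real.exp_neg, ← Real.rpow_natCast, Real.rpow_def_of_pos (Real.sqrt_pos.2 hT),
      Real.log_sqrt hT.le]
    congr 2
    ring
  have hr : R.det⁻¹ = Real.exp (-(Real.log P.det / 2)) := by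
    rw [Real.exp_neg, ← Real.log_sqrt hP.det_pos.le, ← hdet, Real.exp_log hR.det_pos]
  rw [hp, ht, hr, ← Real.exp_add, ← Real.exp_add, logGauss]
  congr 1
  ring

lemma integrable_exp_mul {f : X → ℝ} (hf : Integrable f) {u : X → ℝ} (hu : Measurable u)
    (h0 : ∀ x, 0 ≤ u x) : Integrable fun x => Real.exp (-u x) * f x := by
  refine hf.bdd_mul (c := 1) (by fun_prop) (Filter.Eventually.of_forall fun x => ?_)
  rw [Real.norm_eq_abs, Real.abs_exp]
  exact Real.exp_le_one_iff.2 (by linarith [h0 x])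

lemma integral_exp_mul_pos {f : X → ℝ} (hf : Integrable f) (hf0 : ∀ x, 0 < f x) {u : X → ℝ}
    (hu : Measurable u) (h0 : ∀ x, 0 ≤ u x) : 0 < ∫ x, Real.exp (-u x) * f x :=
  integral_pos_of_forall_pos (integrable_exp_mul hf hu h0) fun x =>
    mul_pos (Real.exp_pos _) (hf0 x)

lemma le_log_heat_zero {M : G →L[ℝ] X} (hP : Pos (M ∘L ContinuousLinearMap.adjoint M)) {T η : ℝ}
    (hT : 0 < T) (hη : 0 ≤ η)
    (h : ∀ x, ⟪opInv (M ∘L ContinuousLinearMap.adjoint M) x, x⟫ ≤ 2 * η * T * ‖x‖ ^ 2)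
    {f : X → ℝ} (hf : Measurable f) (hfi : Integrable f) (hf0 : ∀ x, 0 < f x) :
    logGauss (M ∘L ContinuousLinearMap.adjoint M) -
      (Module.finrank ℝ X : ℝ) * Real.log (2 * Real.pi) -
      (Module.finrank ℝ X : ℝ) / 2 * Real.log T +
      Real.log (∫ x, Real.exp (-(η * ‖x‖ ^ 2)) * f x) ≤ Real.log (heat M T f 0) := by
  have h1 := integral_exp_mul_pos hfi hf0 (u := fun x => η * ‖x‖ ^ 2) (by fun_prop)
    fun x => by positivity
  have hle : ∫ x, Real.exp (-(η * ‖x‖ ^ 2)) * f x ≤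
      ∫ x, Real.exp (-⟪opInv (M ∘L ContinuousLinearMap.adjoint M) x, x⟫ / (2 * T)) * f x := by
    refine integral_mono (integrable_exp_mul hfi (by fun_prop) fun x => by positivity) ?_
      fun x => ?_
    · simp only [neg_div]
      refine integrable_exp_mul hfi (by fun_prop) fun x => ?_
      have := hP.opInv_pos.psd.2 x
      positivity
    · refine mul_le_mul_of_nonneg_right (Real.exp_le_exp.2 ?_) (hf0 x).le
      rw [neg_div, neg_le_neg_iff, div_le_iff₀ (by positivity)]
      linarith [h x]
  rw [heat_zero_eq hP hT hf, Real.log_mul (Real.exp_pos _).ne' (h1.trans_le hle).ne', Real.log_exp]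
  exact add_le_add le_rfl (Real.log_le_log h1 hle)

lemma log_heat_zero_le {M : G →L[ℝ] X} (hP : Pos (M ∘L ContinuousLinearMap.adjoint M)) {T : ℝ}
    (hT : 0 < T) {f : X → ℝ} (hf : Measurable f) (hfi : Integrable f) (hf0 : ∀ x, 0 < f x) :
    Real.log (heat M T f 0) ≤ logGauss (M ∘L ContinuousLinearMap.adjoint M) -
      (Module.finrank ℝ X : ℝ) * Real.log (2 * Real.pi) -
      (Module.finrank ℝ X : ℝ) / 2 * Real.log T + Real.log (∫ x, f x) := by
  have hu : ∀ x, 0 ≤ ⟪opInv (M ∘L ContinuousLinearMap.adjoint M) x, x⟫ / (2 * T) := fun x => by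
    have := hP.opInv_pos.psd.2 x
    positivity
  rw [heat_zero_eq hP hT hf]
  simp only [neg_div]
  have h1 := integral_exp_mul_pos hfi hf0 (by fun_prop) hu
  rw [Real.log_mul (Real.exp_pos _).ne' h1.ne', Real.log_exp]
  refine add_le_add le_rfl (Real.log_le_log h1 ?_)
  refine integral_mono (integrable_exp_mul hfi (by fun_prop) hu) hfi fun x => ?_
  exact mul_le_of_le_one_left (hf0 x).le (Real.exp_le_one_iff.2 (by linarith [hu x]))

lemma tendsto_log_integral_exp_mul {f : X → ℝ} (hf : Measurable f) (hfi : Integrable f)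
    (hf0 : ∀ x, 0 < f x) :
    Filter.Tendsto (fun η : ℝ => Real.log (∫ x, Real.exp (-(η * ‖x‖ ^ 2)) * f x))
      (nhdsWithin 0 (Set.Ioi 0)) (nhds (Real.log (∫ x, f x))) := by
  refine Filter.Tendsto.log ?_ (integral_pos_of_forall_pos hfi hf0).ne'
  refine tendsto_integral_filter_of_dominated_convergence (fun x => ‖f x‖)
    (Filter.Eventually.of_forall fun η => ?_) ?_ hfi.norm (Filter.Eventually.of_forall fun x => ?_)
  · have : Measurable fun x => Real.exp (-(η * ‖x‖ ^ 2)) * f x := by fun_prop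
    exact this.aestronglyMeasurable
  · filter_upwards [self_mem_nhdsWithin] with η hη
    refine Filter.Eventually.of_forall fun x => ?_
    rw [norm_mul, Real.norm_eq_abs, Real.abs_exp]
    refine mul_le_of_le_one_left (norm_nonneg _) (Real.exp_le_one_iff.2 ?_)
    have : 0 < η := hη
    have : 0 ≤ η * ‖x‖ ^ 2 := by positivity
    linarith
  · have h : Continuous fun η : ℝ => Real.exp (-(η * ‖x‖ ^ 2)) * f x := by fun_prop
    have := h.tendsto 0
    simp only [zero_mul, neg_zero, Real.exp_zero, one_mul] at this
    exact this.mono_left nhdsWithin_le_nhds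

end heatZero

variable {k m : ℕ} {E : Fin k → Type*} {F : Fin m → Type*}
  [∀ i, NormedAddCommGroup (E i)] [∀ i, InnerProductSpace ℝ (E i)]
  [∀ i, FiniteDimensional ℝ (E i)]
  [∀ i, MeasurableSpace (E i)] [∀ i, BorelSpace (E i)]
  [∀ j, NormedAddCommGroup (F j)] [∀ j, InnerProductSpace ℝ (F j)]
  [∀ j, FiniteDimensional ℝ (F j)]
  [∀ j, MeasurableSpace (F j)] [∀ j, BorelSpace (F j)]
  {H : Type*} [NormedAddCommGroup H] [InnerProductSpace ℝ H] [FiniteDimensional ℝ H]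
  [MeasurableSpace H] [BorelSpace H]
  {c : Fin k → ℝ} {d : Fin m → ℝ} {B : ∀ i j, E i →ₗ[ℝ] F j}
  {π : ∀ i, H →L[ℝ] E i} {Q : ∀ j, H →L[ℝ] F j} {A : ∀ i j, E i →L[ℝ] F j} {D₀ : ℝ}

/-- The inequality for regular functions, in logarithmic form. -/
theorem IsBound.log_integral_le
    (hB : IsBound F E d c (fun j i => LinearMap.adjoint (B i j)) D₀) (hc : ∀ i, 0 < c i)
    (hd : ∀ j, 0 < d j) (hπ : ∀ x : ∀ i, E i, ∃ h : H, ∀ i, π i h = x i)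
    (hπ0 : ∀ h : H, (∀ i, π i h = 0) → h = 0) (hA : ∀ i j x, A i j x = c i • B i j x)
    (hQ : ∀ j h, Q j h = ∑ i, A i j (π i h))
    {L K b e : ℝ} {f : ∀ i, E i → ℝ} {g : ∀ j, F j → ℝ}
    (hfm : ∀ i, Measurable (f i)) (hfb : ∀ i x, |f i x| ≤ b) (hfi : ∀ i, Integrable (f i))
    (hf : ∀ i (M : H →L[ℝ] E i) t, SemiSmooth L K (heat M t (f i))) (hf0 : ∀ i x, 0 < f i x)
    (hgm : ∀ j, Measurable (g j)) (hg0 : ∀ j y, 0 < g j y) (hgb : ∀ j y, |g j y| ≤ b)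
    (hgi : ∀ j, Integrable (g j))
    (hdom : ∀ x : ∀ i, E i, ∑ i, c i * Real.log (f i (x i)) ≤
      ∑ j, d j * Real.log (g j (∑ i, A i j (x i))) + e) :
    ∑ i, c i * Real.log (∫ x, f i x) ≤ D₀ + ∑ j, d j * Real.log (∫ y, g j y) + e := by
  have hQB : ∀ j h, Q j h = ∑ i, c i • B i j (π i h) := fun j h => by simp only [hQ, hA]
  obtain ⟨V, U, hz⟩ := exists_feas_of_sum hc hd hπ0 hQ
  have hS := hB.sum_finrank_eq hd hπ hQB hz
  set S := ∑ i, c i * (Module.finrank ℝ (E i) : ℝ) with hSdef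
  have hS0 : 0 ≤ S := Finset.sum_nonneg fun i _ => mul_nonneg (hc i).le (by positivity)
  set C := ∑ i, c i with hC
  have hC0 : 0 ≤ C := Finset.sum_nonneg fun i _ => (hc i).le
  have hl2 : 0 ≤ Real.log (2 * Real.pi) := Real.log_nonneg (by linarith [Real.pi_gt_three])
  set Z := S + C * |b| + S * Real.log (2 * Real.pi) + C / 2 with hZ
  let I : ℝ → ℝ := fun η => ∑ i, c i * Real.log (∫ x, Real.exp (-(η * ‖x‖ ^ 2)) * f i x)
  set J := ∑ j, d j * Real.log (∫ y, g j y) with hJ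
  have hI : Filter.Tendsto I (nhdsWithin 0 (Set.Ioi 0))
      (nhds (∑ i, c i * Real.log (∫ x, f i x))) :=
    tendsto_finsetSum _ fun i _ =>
      (tendsto_log_integral_exp_mul (hfm i) (hfi i) (hf0 i)).const_mul _
  have key : ∀ η, 0 < η → η ≤ 1 → I η ≤ D₀ + J + e + η * (Z + |I η|) := fun η hη hη1 => by
    obtain ⟨θ, T, M, N, hθ1, hθη, hT1, hlogT, hflow, hP, hP', hop, hdet, hG⟩ :=
      hB.exists_driving hc hd hπ hπ0 hA hQ hη hη1
    have hT : 0 < T := by linarith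
    have h1 := flow (a := fun i => θ * c i) (fun i => mul_pos (by linarith) (hc i)) hd hflow
      (e := e + (θ - 1) * (C * |b|)) hfm hfb (fun i t _ => hf i _ t) hgm hg0 hgb (fun x => by
        have : ∑ i, c i * Real.log (f i (x i)) ≤ C * |b| := by
          rw [hC, Finset.sum_mul]
          refine Finset.sum_le_sum fun i _ => mul_le_mul_of_nonneg_left ?_ (hc i).le
          have h1 := Real.log_le_sub_one_of_pos (hf0 i (x i))
          linarith [le_abs_self (f i (x i)), hfb i (x i), le_abs_self b]
        have h2 := mul_le_mul_of_nonneg_left this (sub_nonneg.2 hθ1)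
        have h3 := hdom x
        simp only [mul_assoc θ, ← Finset.mul_sum]
        linarith) hT 0
    simp only [Pi.zero_apply, map_zero, Finset.sum_const_zero, mul_assoc θ, ← Finset.mul_sum] at h1
    have h2 : ∑ i, c i * logGauss (M i ∘L ContinuousLinearMap.adjoint (M i)) -
        S * Real.log (2 * Real.pi) - S / 2 * Real.log T + I η ≤
        ∑ i, c i * Real.log (heat (M i) T (f i) 0) := by
      have := Finset.sum_le_sum fun i (_ : i ∈ Finset.univ) => mul_le_mul_of_nonneg_left
        (le_log_heat_zero (hP i) hT hη.le (hop i) (hfm i) (hfi i) (hf0 i)) (hc i).le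
      simp only [mul_add, mul_sub, Finset.sum_add_distrib, Finset.sum_sub_distrib,
        div_mul_eq_mul_div, mul_div_assoc', ← Finset.sum_div, ← mul_assoc,
        ← Finset.sum_mul] at this
      rw [div_mul_eq_mul_div]
      exact this
    have h3 : ∑ j, d j * Real.log (heat (N j) T (g j) 0) ≤
        ∑ j, d j * logGauss (N j ∘L ContinuousLinearMap.adjoint (N j)) -
        S * Real.log (2 * Real.pi) - S / 2 * Real.log T + J := by
      have := Finset.sum_le_sum fun j (_ : j ∈ Finset.univ) => mul_le_mul_of_nonneg_left
        (log_heat_zero_le (hP' j) hT (hgm j) (hgi j) (hg0 j)) (hd j).le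
      simp only [mul_add, mul_sub, Finset.sum_add_distrib, Finset.sum_sub_distrib,
        div_mul_eq_mul_div, mul_div_assoc', ← Finset.sum_div, ← mul_assoc,
        ← Finset.sum_mul, ← hS] at this
      rw [div_mul_eq_mul_div]
      exact this
    have h4 : (θ - 1) * -∑ i, c i * logGauss (M i ∘L ContinuousLinearMap.adjoint (M i)) ≤
        C / 2 * η := by
      rw [hC, Finset.sum_div, Finset.sum_mul, ← Finset.sum_neg_distrib, Finset.mul_sum]
      refine Finset.sum_le_sum fun i _ => ?_
      have e1 : 0 ≤ (θ - 1) * ((Module.finrank ℝ (E i) : ℝ) / 2 * Real.log (2 * Real.pi)) := by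
        have := sub_nonneg.2 hθ1
        positivity
      have e2 : (θ - 1) * -logGauss (M i ∘L ContinuousLinearMap.adjoint (M i)) ≤ η / 2 := by
        rw [logGauss]
        linarith [hdet i]
      linarith [mul_le_mul_of_nonneg_left e2 (hc i).le]
    have h5 : Real.log θ ≤ η := (Real.log_le_sub_one_of_pos (by linarith)).trans (by linarith)
    have h6 : S / 2 * Real.log θ ≤ S / 2 * η := mul_le_mul_of_nonneg_left h5 (by positivity)
    have h7 : S / 2 * ((θ - 1) * Real.log T) ≤ S / 2 * η :=
      mul_le_mul_of_nonneg_left hlogT (by positivity)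
    have h8 := mul_le_mul_of_nonneg_left h2 (by linarith : 0 ≤ θ)
    have h9 : (θ - 1) * (C * |b| + S * Real.log (2 * Real.pi)) ≤
        η * (C * |b| + S * Real.log (2 * Real.pi)) :=
      mul_le_mul_of_nonneg_right (by linarith) (by positivity)
    have h10 : -((θ - 1) * I η) ≤ η * |I η| := by
      rw [← mul_neg]
      exact (mul_le_mul_of_nonneg_left (neg_le_abs _) (by linarith)).trans
        (mul_le_mul_of_nonneg_right (by linarith) (abs_nonneg _))
    rw [hZ]
    linarith
  have hlim : Filter.Tendsto (fun η => D₀ + J + e + η * (Z + |I η|)) (nhdsWithin 0 (Set.Ioi 0))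
      (nhds (D₀ + J + e + 0 * (Z + |∑ i, c i * Real.log (∫ x, f i x)|))) :=
    ((Filter.tendsto_id.mono_left nhdsWithin_le_nhds).mul (hI.abs.const_add _)).const_add _
  rw [zero_mul, add_zero] at hlim
  refine le_of_tendsto_of_tendsto hI hlim ?_
  filter_upwards [Ioc_mem_nhdsGT (zero_lt_one' ℝ)] with η hη
  exact key η hη.1 hη.2

end FRBL

namespace FRBL

section Mollification

variable {X : Type*} [NormedAddCommGroup X] [InnerProductSpace ℝ X]
  [FiniteDimensional ℝ X] [MeasurableSpace X] [BorelSpace X]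

lemma integrable_ker {q : ℕ} (hq : Module.finrank ℝ X < 2 * q) :
    Integrable (ker (X := X) q 1) := by
  have h : (Module.finrank ℝ X : ℝ) < 2 * q := by exact_mod_cast hq
  refine (integrable_rpow_neg_one_add_norm_sq (μ := volume) h).congr
    (Filter.Eventually.of_forall fun x => ?_)
  have h1 : -(2 * (q : ℝ)) / 2 = -(q : ℝ) := by ring
  simp only [ker, inv_one, one_smul, h1]
  rw [Real.rpow_neg (by positivity), Real.rpow_natCast]

lemma ker_smul {δ : ℝ} (hδ : 0 < δ) (q : ℕ) (w : X) : ker q δ (δ • w) = ker q 1 w := by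
  simp [ker, smul_smul, hδ.ne']

/-- A bounded upper semicontinuous function of positive integral which vanishes outside the ball
of radius `r`. -/
structure IsBump (u : X → ℝ) (b r : ℝ) : Prop where
  usc : UpperSemicontinuous u
  nonneg : ∀ x, 0 ≤ u x
  le : ∀ x, u x ≤ b
  eq_zero : ∀ x, r < ‖x‖ → u x = 0
  pos : 0 < ∫ x, u x

lemma IsBump.measurable {u : X → ℝ} {b r : ℝ} (hu : IsBump u b r) : Measurable u :=
  hu.usc.measurable

lemma IsBump.integrable {u : X → ℝ} {b r : ℝ} (hu : IsBump u b r) : Integrable u := by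
  by_contra h
  exact hu.pos.ne' (integral_undef h)

lemma IsBump.abs_le {u : X → ℝ} {b r : ℝ} (hu : IsBump u b r) (x : X) : |u x| ≤ b := by
  rw [abs_of_nonneg (hu.nonneg x)]; exact hu.le x

lemma IsBump.bound_nonneg {u : X → ℝ} {b r : ℝ} (hu : IsBump u b r) : 0 ≤ b :=
  (hu.nonneg 0).trans (hu.le 0)

/-- Mollification by the normalized kernel `ker q` at scale `δ`. -/
def moll (q : ℕ) (u : X → ℝ) (δ : ℝ) (x : X) : ℝ :=
  (∫ w : X, ker q 1 w)⁻¹ * ∫ w, u (x - δ • w) * ker q 1 w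

variable {q : ℕ} {u : X → ℝ} {b r δ : ℝ}

lemma integral_ker_pos (hq : Module.finrank ℝ X < 2 * q) : 0 < ∫ w : X, ker q 1 w :=
  integral_pos_of_forall_pos (integrable_ker hq) (ker_pos q 1)

lemma integrable_mul_ker (hq : Module.finrank ℝ X < 2 * q) {v : X → ℝ} (hv : Measurable v)
    (hb : ∀ x, |v x| ≤ b) : Integrable fun w => v w * ker q 1 w :=
  (integrable_ker hq).bdd_mul hv.aestronglyMeasurable (Filter.Eventually.of_forall hb)

lemma moll_eq_integral (hδ : 0 < δ) (x : X) :
    moll q u δ x = (∫ w : X, ker q 1 w)⁻¹ * ((δ ^ Module.finrank ℝ X)⁻¹ *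
      ∫ t, u (x - t) * ker q δ t) := by
  have h := Measure.integral_comp_smul_of_nonneg volume (fun t : X => u (x - t) * ker q δ t) δ
    (hR := hδ.le)
  simp only [ker_smul hδ, smul_eq_mul] at h
  rw [moll, h]

lemma integral_ker_eq (hδ : 0 < δ) :
    ∫ t : X, ker q δ t = δ ^ Module.finrank ℝ X * ∫ w : X, ker q 1 w := by
  have h := Measure.integral_comp_smul_of_nonneg volume (fun t : X => ker q δ t) δ
    (hR := hδ.le)
  simp only [ker_smul hδ, smul_eq_mul] at h
  rw [h, mul_inv_cancel_left₀ (by positivity)]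

lemma integrable_ker_scale (hq : Module.finrank ℝ X < 2 * q) (hδ : 0 < δ) :
    Integrable (ker (X := X) q δ) := by
  by_contra h
  have h1 := integral_ker_eq (X := X) (q := q) hδ
  rw [integral_undef h] at h1
  have := integral_ker_pos hq
  have : 0 < δ ^ Module.finrank ℝ X * ∫ w : X, ker q 1 w := by positivity
  linarith

lemma moll_eq_convolution (hδ : 0 < δ) : moll q u δ = fun x =>
    (∫ w : X, ker q 1 w)⁻¹ * ((δ ^ Module.finrank ℝ X)⁻¹ *
      convolution (ker q δ) u (ContinuousLinearMap.lsmul ℝ ℝ) volume x) := by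
  funext x
  rw [moll_eq_integral hδ, convolution_def]
  simp [mul_comm]

lemma IsBump.integrable_moll (hu : IsBump u b r) (hq : Module.finrank ℝ X < 2 * q) (hδ : 0 < δ) :
    Integrable (moll q u δ) := by
  rw [moll_eq_convolution hδ]
  exact (((integrable_ker_scale hq hδ).integrable_convolution _ hu.integrable).const_mul _
    ).const_mul _

lemma IsBump.integral_moll (hu : IsBump u b r) (hq : Module.finrank ℝ X < 2 * q) (hδ : 0 < δ) :
    ∫ x, moll q u δ x = ∫ x, u x := by
  rw [moll_eq_convolution hδ, integral_const_mul, integral_const_mul,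
    integral_convolution _ (integrable_ker_scale hq hδ) hu.integrable, integral_ker_eq hδ]
  have := (integral_ker_pos hq).ne'
  have : δ ^ Module.finrank ℝ X ≠ 0 := by positivity
  simp only [ContinuousLinearMap.lsmul_apply, smul_eq_mul]
  field_simp

lemma IsBump.exists_moll_eq_mix (hu : IsBump u b r) (hq : Module.finrank ℝ X < 2 * q)
    (hδ : 0 < δ) : ∃ ρ : Measure X, IsFiniteMeasure ρ ∧ NeZero ρ ∧
      moll q u δ = mix (ker q δ) ρ := by
  set a : ℝ := (∫ w : X, ker q 1 w)⁻¹ * (δ ^ Module.finrank ℝ X)⁻¹ with ha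
  have ha0 : 0 < a := by have := integral_ker_pos hq; positivity
  have hm : Measurable fun y => a * u (-y) := (hu.measurable.comp measurable_neg).const_mul a
  have h0 : ∀ y, 0 ≤ a * u (-y) := fun y => mul_nonneg ha0.le (hu.nonneg _)
  have hint : Integrable fun y => a * u (-y) := hu.integrable.comp_neg.const_mul a
  have hval : ∫ y, a * u (-y) = a * ∫ y, u y := by
    rw [integral_const_mul, integral_neg_eq_self u]
  have hmass : ∫⁻ y, ENNReal.ofReal (a * u (-y)) = ENNReal.ofReal (a * ∫ y, u y) := by
    rw [← ofReal_integral_eq_lintegral_ofReal hint (Filter.Eventually.of_forall h0), hval]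
  refine ⟨volume.withDensity fun y => ENNReal.ofReal (a * u (-y)), ?_, ⟨?_⟩, ?_⟩
  · exact isFiniteMeasure_withDensity (by rw [hmass]; exact ENNReal.ofReal_ne_top)
  · intro h
    have h1 : (volume.withDensity fun y => ENNReal.ofReal (a * u (-y))) Set.univ = 0 := by
      rw [h]; simp
    rw [withDensity_apply _ MeasurableSet.univ, Measure.restrict_univ, hmass,
      ENNReal.ofReal_eq_zero] at h1
    exact absurd h1 (not_le.2 (mul_pos ha0 hu.pos))
  · funext x
    rw [mix, integral_withDensity_eq_integral_toReal_smul (by fun_prop)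
      (Filter.Eventually.of_forall fun _ => ENNReal.ofReal_lt_top), moll_eq_integral hδ,
      ← integral_add_left_eq_self (fun t => u (x - t) * ker q δ t) x, ← mul_assoc, ← ha,
      ← integral_const_mul]
    refine integral_congr_ae (Filter.Eventually.of_forall fun y => ?_)
    simp only [ENNReal.toReal_ofReal (h0 y), smul_eq_mul, sub_add_cancel_left]
    ring

lemma IsBump.measurable_moll (hu : IsBump u b r) (hq : Module.finrank ℝ X < 2 * q)
    (hδ : 0 < δ) : Measurable (moll q u δ) := by
  obtain ⟨ρ, h1, h2, h⟩ := hu.exists_moll_eq_mix hq hδ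
  rw [h]
  exact measurable_mix (continuous_ker q δ).measurable ρ

lemma IsBump.moll_pos (hu : IsBump u b r) (hq : Module.finrank ℝ X < 2 * q)
    (hδ : 0 < δ) (x : X) : 0 < moll q u δ x := by
  obtain ⟨ρ, h1, h2, h⟩ := hu.exists_moll_eq_mix hq hδ
  rw [h]
  exact integral_pos_of_forall_pos (integrable_of_bounded
    ((continuous_ker q δ).measurable.comp (by fun_prop)) (b := 1) fun y => by
      rw [abs_of_pos (ker_pos _ _ _)]; exact ker_le_one _ _ _) fun _ => ker_pos _ _ _

lemma integrable_translate_mul_ker (hq : Module.finrank ℝ X < 2 * q) (hu : IsBump u b r)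
    (δ : ℝ) (x : X) : Integrable fun w => u (x - δ • w) * ker q 1 w :=
  integrable_mul_ker hq (hu.measurable.comp (by fun_prop)) fun _ => hu.abs_le _

lemma IsBump.moll_le (hu : IsBump u b r) (hq : Module.finrank ℝ X < 2 * q) (x : X) :
    moll q u δ x ≤ b := by
  rw [moll, inv_mul_le_iff₀ (integral_ker_pos hq), ← integral_mul_const]
  refine integral_mono (integrable_translate_mul_ker hq hu δ x) ((integrable_ker hq).mul_const b)
    fun w => ?_
  simp only
  rw [mul_comm]
  exact mul_le_mul_of_nonneg_left (hu.le _) (ker_pos _ _ _).le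

lemma IsBump.mul_ker_le (hu : IsBump u b r) (hr : 1 ≤ r) (hδ : 0 < δ) {x : X}
    (hx : 2 * r ≤ ‖x‖) (w : X) :
    u (x - δ • w) * ker q 1 w ≤ (8 * δ ^ 2) ^ q * ker q 1 x * u (x - δ • w) := by
  by_cases h : r < ‖x - δ • w‖
  · simp [hu.eq_zero _ h]
  · rw [mul_comm]
    refine mul_le_mul_of_nonneg_right ?_ (hu.nonneg _)
    have h1 : ‖x‖ - δ * ‖w‖ ≤ r := by
      have := norm_sub_norm_le x (δ • w)
      rw [norm_smul, Real.norm_of_nonneg hδ.le] at this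
      linarith [not_lt.1 h]
    have h2 : ‖x‖ ≤ 2 * (δ * ‖w‖) := by linarith
    have h3 : ‖x‖ ^ 2 ≤ (2 * (δ * ‖w‖)) ^ 2 := pow_le_pow_left₀ (norm_nonneg _) h2 2
    have h4 : 1 + ‖x‖ ^ 2 ≤ 8 * δ ^ 2 * (1 + ‖w‖ ^ 2) := by nlinarith [sq_nonneg δ]
    have h5 := pow_le_pow_left₀ (by positivity) h4 q
    rw [mul_pow] at h5
    simp only [ker, inv_one, one_smul]
    rw [← div_eq_mul_inv, le_div_iff₀ (by positivity), inv_mul_le_iff₀ (by positivity),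
      mul_comm _ (_ ^ q)]
    exact h5

lemma IsBump.exists_moll_le (hu : IsBump u b r) (hq : Module.finrank ℝ X < 2 * q) (hr : 1 ≤ r) :
    ∃ C, 0 < C ∧ ∀ δ, 0 < δ → δ ≤ 1 → ∀ x, moll q u δ x ≤ C * ker q 1 x ∧
      (2 * r ≤ ‖x‖ → moll q u δ x ≤ C * δ * ker q 1 x) := by
  have hN := integral_ker_pos (X := X) hq
  set C₁ := (∫ w : X, ker q 1 w)⁻¹ * (8 ^ q * ∫ x, u x) with hC₁
  have hC₁0 : 0 < C₁ := by have := hu.pos; positivity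
  have hb := hu.bound_nonneg
  have htail : ∀ δ, 0 < δ → δ ≤ 1 → ∀ x, 2 * r ≤ ‖x‖ → moll q u δ x ≤ C₁ * δ * ker q 1 x := by
    intro δ hδ hδ1 x hx
    have hi : Integrable fun w => u (x - δ • w) := by
      have h1 : Integrable fun w => u (x - w) := hu.integrable.comp_sub_left x
      exact (integrable_comp_smul_iff volume (fun w => u (x - w)) hδ.ne').2 h1
    have hval : ∫ w, u (x - δ • w) = (δ ^ Module.finrank ℝ X)⁻¹ * ∫ x, u x := by
      have h := Measure.integral_comp_smul_of_nonneg volume (fun t : X => u (x - t)) δ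
        (hR := hδ.le)
      rw [h, integral_sub_left_eq_self u volume x, smul_eq_mul]
    have h1 : ∫ w, u (x - δ • w) * ker q 1 w ≤
        (8 * δ ^ 2) ^ q * ker q 1 x * ((δ ^ Module.finrank ℝ X)⁻¹ * ∫ x, u x) := by
      rw [← hval, ← integral_const_mul]
      exact integral_mono (integrable_translate_mul_ker hq hu δ x) (hi.const_mul _)
        (hu.mul_ker_le hr hδ hx)
    have h2 : (δ ^ 2) ^ q * (δ ^ Module.finrank ℝ X)⁻¹ ≤ δ := by
      rw [← div_eq_mul_inv, div_le_iff₀ (by positivity), ← pow_mul, ← pow_succ']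
      exact pow_le_pow_of_le_one hδ.le hδ1 hq
    rw [moll, hC₁, mul_assoc, mul_assoc]
    refine mul_le_mul_of_nonneg_left (h1.trans ?_) (by positivity)
    have h3 : (8 * δ ^ 2) ^ q * ker q 1 x * ((δ ^ Module.finrank ℝ X)⁻¹ * ∫ x, u x) =
        (8 ^ q * (∫ x, u x) * ker q 1 x) * ((δ ^ 2) ^ q * (δ ^ Module.finrank ℝ X)⁻¹) := by
      rw [mul_pow]; ring
    rw [h3]
    have h4 := mul_le_mul_of_nonneg_left h2 (a := 8 ^ q * (∫ x, u x) * ker q 1 x)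
      (by have := hu.pos; have := ker_pos q 1 x; positivity)
    linarith
  refine ⟨C₁ + b * (1 + (2 * r) ^ 2) ^ q, by positivity, fun δ hδ hδ1 x => ⟨?_, fun hx => ?_⟩⟩
  · have hk := ker_pos q 1 x
    rcases le_total (2 * r) ‖x‖ with hx | hx
    · refine (htail δ hδ hδ1 x hx).trans (mul_le_mul_of_nonneg_right ?_ hk.le)
      have : C₁ * δ ≤ C₁ * 1 := by gcongr
      have : 0 ≤ b * (1 + (2 * r) ^ 2) ^ q := by positivity
      linarith
    · have h1 : 1 ≤ (1 + (2 * r) ^ 2) ^ q * ker q 1 x := by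
        simp only [ker, inv_one, one_smul]
        rw [← div_eq_mul_inv, one_le_div (by positivity)]
        gcongr
      have h2 := mul_le_mul_of_nonneg_left h1 hb
      have h3 := hu.moll_le (δ := δ) hq x
      nlinarith [mul_pos hC₁0 hk]
  · refine (htail δ hδ hδ1 x hx).trans ?_
    have hk := ker_pos q 1 x
    gcongr
    have : 0 ≤ b * (1 + (2 * r) ^ 2) ^ q := by positivity
    linarith

lemma IsBump.eventually_moll_lt (hu : IsBump u b r) (hq : Module.finrank ℝ X < 2 * q) (x : X)
    {ε : ℝ} (hε : 0 < ε) :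
    ∀ᶠ p : ℝ × X in nhds (0, x), moll q u p.1 p.2 < u x + ε := by
  have hN := integral_ker_pos (X := X) hq
  have hmeas : ∀ p : ℝ × X, Measurable fun w => max (u (p.2 - p.1 • w)) (u x) := fun p =>
    (hu.measurable.comp (by fun_prop)).max measurable_const
  have hbd : ∀ (p : ℝ × X) w, |max (u (p.2 - p.1 • w)) (u x)| ≤ b := fun p w => by
    rw [abs_of_nonneg (le_max_of_le_left (hu.nonneg _))]
    exact max_le (hu.le _) (hu.le _)
  have hlim : Filter.Tendsto
      (fun p : ℝ × X => ∫ w, max (u (p.2 - p.1 • w)) (u x) * ker q 1 w) (nhds (0, x))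
      (nhds (∫ w : X, u x * ker q 1 w)) := by
    refine tendsto_integral_filter_of_dominated_convergence (fun w => b * ker q 1 w)
      (Filter.Eventually.of_forall fun p =>
        ((hmeas p).mul (continuous_ker q 1).measurable).aestronglyMeasurable)
      (Filter.Eventually.of_forall fun p => Filter.Eventually.of_forall fun w => ?_)
      ((integrable_ker hq).const_mul b) (Filter.Eventually.of_forall fun w => ?_)
    · rw [norm_mul, Real.norm_eq_abs, Real.norm_of_nonneg (ker_pos _ _ _).le]
      exact mul_le_mul_of_nonneg_right (hbd p w) (ker_pos q 1 w).le
    · refine Filter.Tendsto.mul_const _ ?_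
      have hc : Filter.Tendsto (fun p : ℝ × X => p.2 - p.1 • w) (nhds (0, x)) (nhds x) := by
        have : Continuous fun p : ℝ × X => p.2 - p.1 • w := by fun_prop
        simpa using this.tendsto (0, x)
      refine tendsto_order.2 ⟨fun a ha =>
      Filter.Eventually.of_forall fun p => lt_max_of_lt_right ha,
        fun a ha => ?_⟩
      filter_upwards [hc.eventually (hu.usc x a ha)] with p hp
      exact max_lt hp ha
  have hlim2 := hlim.const_mul (∫ w : X, ker q 1 w)⁻¹
  rw [integral_const_mul, mul_comm (u x), inv_mul_cancel_left₀ hN.ne'] at hlim2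
  filter_upwards [hlim2.eventually_lt_const (lt_add_of_pos_right (u x) hε)] with p hp
  refine lt_of_le_of_lt ?_ hp
  refine mul_le_mul_of_nonneg_left (integral_mono (integrable_translate_mul_ker hq hu _ _)
    (integrable_mul_ker hq (hmeas p) (hbd p)) fun w => ?_) (by positivity)
  exact mul_le_mul_of_nonneg_right (le_max_left _ _) (ker_pos _ _ _).le

end Mollification

end FRBL

namespace FRBL

section Domination

variable {k m : ℕ} {E : Fin k → Type*} {F : Fin m → Type*}
  [∀ i, NormedAddCommGroup (E i)] [∀ i, InnerProductSpace ℝ (E i)]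
  [∀ i, FiniteDimensional ℝ (E i)]
  [∀ i, MeasurableSpace (E i)] [∀ i, BorelSpace (E i)]
  [∀ j, NormedAddCommGroup (F j)] [∀ j, InnerProductSpace ℝ (F j)]
  [∀ j, FiniteDimensional ℝ (F j)]
  [∀ j, MeasurableSpace (F j)] [∀ j, BorelSpace (F j)]
  {c : Fin k → ℝ} {d : Fin m → ℝ} {A : ∀ i j, E i →L[ℝ] F j}
  {u : ∀ i, E i → ℝ} {b r η : ℝ} {q q' : ℕ} {G : ∀ j, ℝ → F j → ℝ}

lemma log_ker_one_sum_ge {L : ℝ} (hL0 : 0 ≤ L) {j : Fin m} {x : ∀ i, E i}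
    (hL : ‖∑ i, A i j (x i)‖ ^ 2 ≤ L * ∑ i, ‖x i‖ ^ 2) :
    -(q' * (Real.log (1 + L * k) + ∑ i, Real.log (1 + ‖x i‖ ^ 2))) ≤
      Real.log (ker q' 1 (∑ i, A i j (x i))) := by
  have hl : ∀ i, 0 ≤ Real.log (1 + ‖x i‖ ^ 2) := fun i =>
    Real.log_nonneg (by nlinarith [sq_nonneg ‖x i‖])
  set P := Real.exp (∑ i, Real.log (1 + ‖x i‖ ^ 2)) with hP
  have hP1 : 1 ≤ P := Real.one_le_exp (Finset.sum_nonneg fun i _ => hl i)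
  have hi : ∀ i, ‖x i‖ ^ 2 ≤ P := fun i => by
    have h1 : Real.exp (Real.log (1 + ‖x i‖ ^ 2)) ≤ P :=
      Real.exp_le_exp.2 (Finset.single_le_sum (f := fun i => Real.log (1 + ‖x i‖ ^ 2))
        (fun i _ => hl i) (Finset.mem_univ i))
    rw [Real.exp_log (by positivity)] at h1
    linarith
  have hs : ∑ i, ‖x i‖ ^ 2 ≤ k * P := by
    refine (Finset.sum_le_sum fun i _ => hi i).trans ?_
    simp
  have h1 : 1 + ‖∑ i, A i j (x i)‖ ^ 2 ≤ (1 + L * k) * P := by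
    nlinarith [mul_le_mul_of_nonneg_left hs hL0]
  have h2 := Real.log_le_log (by positivity) h1
  rw [Real.log_mul (by positivity) (by positivity), hP, Real.log_exp] at h2
  rw [log_ker, inv_one, one_smul, neg_le_neg_iff]
  gcongr

lemma exists_tail_dominated (hc : ∀ i, 0 < c i) (hd : ∀ j, 0 < d j)
    (hu : ∀ i, IsBump (u i) b r) (hq : ∀ i, Module.finrank ℝ (E i) < 2 * q) (hr : 1 ≤ r)
    (hη : 0 < η) (hqq : ∀ i, (q' : ℝ) * ∑ j, d j ≤ q * c i)
    (hG : ∀ j δ, 0 < δ → δ ≤ 1 → ∀ y, η * ker q' 1 y ≤ G j δ y) :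
    ∃ δ₁, 0 < δ₁ ∧ δ₁ ≤ 1 ∧ ∀ δ, 0 < δ → δ ≤ δ₁ → ∀ x : ∀ i, E i, (∃ i, 2 * r ≤ ‖x i‖) →
      ∑ i, c i * Real.log (moll q (u i) δ (x i)) ≤
        ∑ j, d j * Real.log (G j δ (∑ i, A i j (x i))) := by
  obtain ⟨L, hL0, hL⟩ := exists_norm_sq_sum_le A
  obtain ⟨μ, hμ, hμc⟩ := exists_pos_le hc
  choose C hC0 hC using fun i => (hu i).exists_moll_le (hq i) hr
  set s := (∑ j, d j) * (Real.log η - q' * Real.log (1 + L * k)) - ∑ i, c i * Real.log (C i) with hs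
  refine ⟨min 1 (Real.exp (s / μ)), by positivity, min_le_left _ _, fun δ hδ hδ1 x ⟨i₀, hi₀⟩ => ?_⟩
  have hδ2 : δ ≤ 1 := hδ1.trans (min_le_left _ _)
  have hlogδ : Real.log δ ≤ 0 := Real.log_nonpos hδ.le hδ2
  have hμs : μ * Real.log δ ≤ s := by
    have := (Real.log_le_iff_le_exp hδ).2 (hδ1.trans (min_le_right _ _))
    rwa [le_div_iff₀ hμ, mul_comm] at this
  have hl : ∀ i, 0 ≤ Real.log (1 + ‖x i‖ ^ 2) := fun i =>
    Real.log_nonneg (by nlinarith [sq_nonneg ‖x i‖])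
  have hf : ∀ i, c i * Real.log (moll q (u i) δ (x i)) ≤
      c i * Real.log (C i) - q * c i * Real.log (1 + ‖x i‖ ^ 2) +
        if i = i₀ then μ * Real.log δ else 0 := by
    intro i
    have hmp := (hu i).moll_pos (hq i) hδ (x i)
    have hk := ker_pos q 1 (x i)
    have hlk : Real.log (ker q 1 (x i)) = -(q * Real.log (1 + ‖x i‖ ^ 2)) := by
      rw [log_ker, inv_one, one_smul]
    obtain ⟨h1, h2⟩ := hC i δ hδ hδ2 (x i)
    split_ifs with hi
    · subst hi
      have h3 := Real.log_le_log hmp (h2 hi₀)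
      rw [Real.log_mul (by have := hC0 i; positivity) hk.ne',
        Real.log_mul (hC0 i).ne' hδ.ne', hlk] at h3
      have h4 := mul_le_mul_of_nonneg_left h3 (hc i).le
      have h5 := mul_le_mul_of_nonpos_right (hμc i) hlogδ
      linarith
    · have h3 := Real.log_le_log hmp h1
      rw [Real.log_mul (hC0 i).ne' hk.ne', hlk] at h3
      have h4 := mul_le_mul_of_nonneg_left h3 (hc i).le
      linarith
  have hf' := Finset.sum_le_sum fun i (_ : i ∈ Finset.univ) => hf i
  rw [Finset.sum_add_distrib, Finset.sum_sub_distrib, Finset.sum_ite_eq' Finset.univ i₀,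
    if_pos (Finset.mem_univ _)] at hf'
  have hg : ∀ j, d j * (Real.log η - q' * Real.log (1 + L * k)) -
      d j * (q' * ∑ i, Real.log (1 + ‖x i‖ ^ 2)) ≤ d j * Real.log (G j δ (∑ i, A i j (x i))) := by
    intro j
    have hk := ker_pos q' 1 (∑ i, A i j (x i))
    have h1 := Real.log_le_log (by positivity) (hG j δ hδ hδ2 (∑ i, A i j (x i)))
    rw [Real.log_mul hη.ne' hk.ne'] at h1
    have h2 := log_ker_one_sum_ge (q' := q') hL0 (hL j x)
    have h3 := mul_le_mul_of_nonneg_left (h1.trans' (add_le_add_right h2 _)) (hd j).le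
    linarith
  have hg' := Finset.sum_le_sum fun j (_ : j ∈ Finset.univ) => hg j
  rw [Finset.sum_sub_distrib, ← Finset.sum_mul, ← Finset.sum_mul] at hg'
  have hl' : (∑ j, d j) * (q' * ∑ i, Real.log (1 + ‖x i‖ ^ 2)) ≤
      ∑ i, q * c i * Real.log (1 + ‖x i‖ ^ 2) := by
    rw [← mul_assoc, Finset.mul_sum]
    refine Finset.sum_le_sum fun i _ => mul_le_mul_of_nonneg_right ?_ (hl i)
    linarith [hqq i]
  linarith

lemma eventually_local_dominated (hc : ∀ i, 0 < c i) (hu : ∀ i, IsBump (u i) b r)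
    (hd : ∀ j, 0 < d j) (hq : ∀ i, Module.finrank ℝ (E i) < 2 * q) (hη : 0 < η) (x : ∀ i, E i)
    (hG : ∃ v : Fin m → ℝ, (∀ j, 0 < v j) ∧ ∏ i, u i (x i) ^ c i ≤ ∏ j, v j ^ d j ∧
      ∀ j, ∀ᶠ p : ℝ × F j in nhds (0, ∑ i, A i j (x i)), 0 < p.1 → v j < G j p.1 p.2) :
    ∀ᶠ p : ℝ × (∀ i, E i) in nhds (0, x), 0 < p.1 →
      ∑ i, c i * Real.log (moll q (u i) p.1 (p.2 i)) ≤
        ∑ j, d j * Real.log (G j p.1 (∑ i, A i j (p.2 i))) + η := by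
  obtain ⟨v, hv, huv, hvG⟩ := hG
  have hvp : 0 < ∏ j, v j ^ d j := Finset.prod_pos fun j _ => Real.rpow_pos_of_pos (hv j) _
  have hcont : Continuous fun ε : ℝ => ∏ i, (u i (x i) + ε) ^ c i :=
    continuous_finsetProd _ fun i _ =>
      (continuous_const.add continuous_id).rpow_const fun _ => Or.inr (hc i).le
  have hlt : ∏ i, (u i (x i) + 0) ^ c i < (∏ j, v j ^ d j) * Real.exp η := by
    simp only [add_zero]
    nlinarith [Real.add_one_le_exp η]
  obtain ⟨ε, hε, hε0⟩ := (((hcont.tendsto 0).eventually_lt_const hlt).filter_mono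
    nhdsWithin_le_nhds |>.and (self_mem_nhdsWithin (s := Set.Ioi 0))).exists
  have hε0 : 0 < ε := hε0
  have hpos : ∀ i, 0 < u i (x i) + ε := fun i => add_pos_of_nonneg_of_pos ((hu i).nonneg _) hε0
  have hlog : ∑ i, c i * Real.log (u i (x i) + ε) ≤ ∑ j, d j * Real.log (v j) + η := by
    have h1 := Real.log_le_log
      (Finset.prod_pos fun i _ => Real.rpow_pos_of_pos (hpos i) (c i)) hε.le
    rw [Real.log_mul hvp.ne' (Real.exp_pos _).ne', Real.log_exp,
      Real.log_prod fun i _ => (Real.rpow_pos_of_pos (hpos i) _).ne',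
      Real.log_prod fun j _ => (Real.rpow_pos_of_pos (hv j) _).ne'] at h1
    simpa only [Real.log_rpow (hpos _), Real.log_rpow (hv _)] using h1
  have hf : ∀ i, ∀ᶠ p : ℝ × (∀ i, E i) in nhds (0, x),
      moll q (u i) p.1 (p.2 i) < u i (x i) + ε := fun i => by
    have h : Filter.Tendsto (fun p : ℝ × (∀ i, E i) => (p.1, p.2 i)) (nhds (0, x))
        (nhds (0, x i)) := by
      have : Continuous fun p : ℝ × (∀ i, E i) => (p.1, p.2 i) := by fun_prop
      exact this.tendsto (0, x)
    exact h.eventually ((hu i).eventually_moll_lt (hq i) (x i) hε0)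
  have hg : ∀ j, ∀ᶠ p : ℝ × (∀ i, E i) in nhds (0, x), 0 < p.1 →
      v j < G j p.1 (∑ i, A i j (p.2 i)) := fun j => by
    have h : Filter.Tendsto (fun p : ℝ × (∀ i, E i) => (p.1, ∑ i, A i j (p.2 i))) (nhds (0, x))
        (nhds (0, ∑ i, A i j (x i))) := by
      have : Continuous fun p : ℝ × (∀ i, E i) => (p.1, ∑ i, A i j (p.2 i)) := by fun_prop
      exact this.tendsto (0, x)
    exact h.eventually (hvG j)
  filter_upwards [Filter.eventually_all.2 hf, Filter.eventually_all.2 hg] with p hp1 hp2 hp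
  have h1 : ∑ i, c i * Real.log (moll q (u i) p.1 (p.2 i)) ≤
      ∑ i, c i * Real.log (u i (x i) + ε) := Finset.sum_le_sum fun i _ =>
    mul_le_mul_of_nonneg_left (Real.log_le_log ((hu i).moll_pos (hq i) hp _) (hp1 i).le) (hc i).le
  have h2 : ∑ j, d j * Real.log (v j) ≤ ∑ j, d j * Real.log (G j p.1 (∑ i, A i j (p.2 i))) :=
    Finset.sum_le_sum fun j _ =>
      mul_le_mul_of_nonneg_left (Real.log_le_log (hv j) (hp2 j hp).le) (hd j).le
  linarith

lemma exists_dominated (hc : ∀ i, 0 < c i) (hd : ∀ j, 0 < d j)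
    (hu : ∀ i, IsBump (u i) b r) (hq : ∀ i, Module.finrank ℝ (E i) < 2 * q) (hr : 1 ≤ r)
    (hη : 0 < η) (hqq : ∀ i, (q' : ℝ) * ∑ j, d j ≤ q * c i)
    (hG : ∀ j δ, 0 < δ → δ ≤ 1 → ∀ y, η * ker q' 1 y ≤ G j δ y)
    (hG' : ∀ x : ∀ i, E i, ∃ v : Fin m → ℝ, (∀ j, 0 < v j) ∧ ∏ i, u i (x i) ^ c i ≤ ∏ j, v j ^ d j ∧
      ∀ j, ∀ᶠ p : ℝ × F j in nhds (0, ∑ i, A i j (x i)), 0 < p.1 → v j < G j p.1 p.2) :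
    ∃ δ, 0 < δ ∧ δ ≤ 1 ∧ ∀ x : ∀ i, E i,
      ∑ i, c i * Real.log (moll q (u i) δ (x i)) ≤
        ∑ j, d j * Real.log (G j δ (∑ i, A i j (x i))) + η := by
  obtain ⟨δ₁, hδ₁, hδ₁1, htail⟩ := exists_tail_dominated (A := A) hc hd hu hq hr hη hqq hG
  have hK : IsCompact (Set.univ.pi fun i => Metric.closedBall (0 : E i) (2 * r)) :=
    isCompact_univ_pi fun i => isCompact_closedBall _ _
  have hloc := hK.eventually_forall_of_forall_eventually (x₀ := (0 : ℝ))
    (P := fun δ x => 0 < δ → ∑ i, c i * Real.log (moll q (u i) δ (x i)) ≤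
        ∑ j, d j * Real.log (G j δ (∑ i, A i j (x i))) + η) fun x _ =>
    eventually_local_dominated hc hu hd hq hη x (hG' x)
  obtain ⟨δ, ⟨hδ, hδ0⟩, hδ1⟩ := ((hloc.filter_mono nhdsWithin_le_nhds).and
    (self_mem_nhdsWithin (s := Set.Ioi (0 : ℝ))) |>.and
      ((eventually_le_nhds hδ₁).filter_mono nhdsWithin_le_nhds)).exists
  refine ⟨δ, hδ0, hδ1.trans hδ₁1, fun x => ?_⟩
  by_cases hx : ∃ i, 2 * r ≤ ‖x i‖
  · linarith [htail δ hδ0 hδ1 x hx]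
  · push Not at hx
    exact hδ x (fun i _ => by simpa using (hx i).le) hδ0

end Domination

end FRBL

namespace FRBL

lemma SemiSmooth.mono {X : Type*} [NormedAddCommGroup X] [InnerProductSpace ℝ X]
    {L K L' K' : ℝ} {f : X → ℝ} (hf : SemiSmooth L K f) (hL : L ≤ L') (hK : K ≤ K') :
    SemiSmooth L' K' f :=
  ⟨hf.1, fun x => by
    obtain ⟨p, hp, h⟩ := hf.2 x
    exact ⟨p, hp.trans hL, fun w => (h w).trans (by gcongr)⟩⟩

lemma exists_lower_approx {Y : Type*} [NormedAddCommGroup Y] [InnerProductSpace ℝ Y]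
    [FiniteDimensional ℝ Y] [MeasurableSpace Y] [BorelSpace Y] {q : ℕ}
    (hq : Module.finrank ℝ Y < 2 * q) {g : Y → ℝ≥0} (hg : Measurable g)
    (hgi : ∫⁻ y, (g y : ℝ≥0∞) ≠ ⊤) {η : ℝ} (hη : 0 < η) (hη1 : η ≤ 1) :
    ∃ G : ℝ → Y → ℝ, (∀ δ, 0 < δ → Measurable (G δ) ∧ Integrable (G δ) ∧
        (∀ y, 0 ≤ G δ y ∧ G δ y ≤ 1 / δ) ∧
        ∫ y, G δ y ≤ (∫⁻ y, (g y : ℝ≥0∞)).toReal + η * (1 + ∫ y : Y, ker q 1 y)) ∧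
      (∀ δ, 0 < δ → δ ≤ 1 → ∀ y, η * ker q 1 y ≤ G δ y) ∧
      ∀ y, ∀ᶠ p : ℝ × Y in nhds (0, y), 0 < p.1 → g y + η / 2 * ker q 1 y < G p.1 p.2 := by
  obtain ⟨g', hgg', hlsc, hint⟩ := exists_le_lowerSemicontinuous_lintegral_ge volume
    (fun y => (g y : ℝ≥0∞)) (by fun_prop) (ε := ENNReal.ofReal η) (by simpa using hη)
  set h : Y → ℝ≥0∞ := fun y => g' y + ENNReal.ofReal (η * ker q 1 y) with hh
  have hkc : Continuous fun y : Y => ENNReal.ofReal (η * ker q 1 y) :=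
    ENNReal.continuous_ofReal.comp (continuous_const.mul (continuous_ker q 1))
  have hhl : LowerSemicontinuous h := hlsc.add hkc.lowerSemicontinuous
  have hW := integral_ker_pos hq
  have hhi : ∫⁻ y, h y ≤ (∫⁻ y, (g y : ℝ≥0∞)) +
      ENNReal.ofReal (η * (1 + ∫ y : Y, ker q 1 y)) := by
    rw [hh, lintegral_add_right _ hkc.measurable, ← ofReal_integral_eq_lintegral_ofReal
      ((integrable_ker hq).const_mul η)
      (Filter.Eventually.of_forall fun y => mul_nonneg hη.le (ker_pos q 1 y).le),
      integral_const_mul, mul_add, mul_one, ENNReal.ofReal_add hη.le (by positivity), ← add_assoc]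
    gcongr
  have hhi' : ∫⁻ y, h y ≠ ⊤ :=
    (hhi.trans_lt (ENNReal.add_lt_top.2 ⟨hgi.lt_top, ENNReal.ofReal_lt_top⟩)).ne
  have hmin : ∀ δ y, min (h y) (ENNReal.ofReal (1 / δ)) ≠ ⊤ := fun δ y =>
    ne_top_of_le_ne_top ENNReal.ofReal_ne_top (min_le_right _ _)
  refine ⟨fun δ y => (min (h y) (ENNReal.ofReal (1 / δ))).toReal, fun δ hδ => ?_,
    fun δ hδ hδ1 y => ?_, fun y => ?_⟩
  · have hm : Measurable fun y => min (h y) (ENNReal.ofReal (1 / δ)) :=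
      hhl.measurable.min measurable_const
    have hle : ∫⁻ y, min (h y) (ENNReal.ofReal (1 / δ)) ≤ ∫⁻ y, h y :=
      lintegral_mono fun y => min_le_left _ _
    refine ⟨hm.ennreal_toReal, integrable_toReal_of_lintegral_ne_top hm.aemeasurable
      (ne_top_of_le_ne_top hhi' hle), fun y => ⟨ENNReal.toReal_nonneg, ?_⟩, ?_⟩
    · exact ENNReal.toReal_le_of_le_ofReal (by positivity) (min_le_right _ _)
    · rw [integral_toReal hm.aemeasurable (Filter.Eventually.of_forall fun y => (hmin δ y).lt_top),
        ← ENNReal.toReal_ofReal (r := η * (1 + ∫ y : Y, ker q 1 y)) (by positivity),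
        ← ENNReal.toReal_add hgi ENNReal.ofReal_ne_top]
      exact ENNReal.toReal_mono (by simp [hgi]) (hle.trans hhi)
  · refine (ENNReal.ofReal_le_iff_le_toReal (hmin δ y)).1 (le_min le_add_self ?_)
    refine ENNReal.ofReal_le_ofReal ?_
    have h1 : 1 ≤ 1 / δ := (one_le_div hδ).2 hδ1
    nlinarith [ker_le_one q 1 y, ker_pos q 1 y]
  · have hk := ker_pos q 1 y
    set v : ℝ := g y + η / 2 * ker q 1 y with hv
    have hv0 : 0 < v := by positivity
    have h1 : ENNReal.ofReal v < h y := by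
      rw [hv, ENNReal.ofReal_add (by positivity) (by positivity), ENNReal.ofReal_coe_nnreal]
      refine ENNReal.add_lt_add_of_le_of_lt ENNReal.coe_ne_top (hgg' y) ?_
      rw [ENNReal.ofReal_lt_ofReal_iff (by positivity)]
      nlinarith
    have h2 := (continuous_snd.tendsto ((0 : ℝ), y)).eventually (hhl y _ h1)
    have h3 : ∀ᶠ p : ℝ × Y in nhds (0, y), p.1 < 1 / v :=
      (continuous_fst.tendsto ((0 : ℝ), y)).eventually (eventually_lt_nhds (by positivity))
    filter_upwards [h2, h3] with p hp2 hp3 hp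
    refine (ENNReal.ofReal_lt_iff_lt_toReal hv0.le (hmin _ _)).1 (lt_min hp2 ?_)
    rw [ENNReal.ofReal_lt_ofReal_iff (by positivity)]
    exact (lt_one_div hp hv0).1 hp3

section BumpBound

variable {k m : ℕ} {E : Fin k → Type*} {F : Fin m → Type*}
  [∀ i, NormedAddCommGroup (E i)] [∀ i, InnerProductSpace ℝ (E i)]
  [∀ i, FiniteDimensional ℝ (E i)]
  [∀ i, MeasurableSpace (E i)] [∀ i, BorelSpace (E i)]
  [∀ j, NormedAddCommGroup (F j)] [∀ j, InnerProductSpace ℝ (F j)]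
  [∀ j, FiniteDimensional ℝ (F j)]
  [∀ j, MeasurableSpace (F j)] [∀ j, BorelSpace (F j)]
  {c : Fin k → ℝ} {d : Fin m → ℝ} {B : ∀ i j, E i →ₗ[ℝ] F j} {D₀ : ℝ}

lemma exists_common_semiSmooth (q : ℕ) (δ : ℝ) : ∃ L K, ∀ i (ρ : Measure (E i))
    [IsFiniteMeasure ρ] [NeZero ρ] (M : PiLp 2 E →L[ℝ] E i) (t : ℝ),
    SemiSmooth L K (heat M t (mix (ker q δ) ρ)) := by
  choose L K hL hK h using fun i =>
    exists_semiSmooth_heat_mix_ker (G := PiLp 2 E) (X := E i) q δ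
  refine ⟨∑ i, L i, ∑ i, K i, fun i ρ _ _ M t => (h i ρ M t).mono ?_ ?_⟩
  · exact Finset.single_le_sum (fun i _ => hL i) (Finset.mem_univ i)
  · exact Finset.single_le_sum (fun i _ => hK i) (Finset.mem_univ i)

lemma exists_exponents (c : Fin k → ℝ) (d : Fin m → ℝ) (hc : ∀ i, 0 < c i) (n : Fin k → ℕ)
    (n' : Fin m → ℕ) : ∃ q q' : ℕ, (∀ i, n i < 2 * q) ∧ (∀ j, n' j < 2 * q') ∧
      ∀ i, (q' : ℝ) * ∑ j, d j ≤ q * c i := by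
  obtain ⟨μ, hμ, hμc⟩ := exists_pos_le hc
  set q' := ∑ j, n' j + 1 with hq'
  obtain ⟨p, hp⟩ := exists_nat_ge ((q' : ℝ) * ∑ j, d j / μ)
  refine ⟨∑ i, n i + 1 + p, q', fun i => ?_, fun j => ?_, fun i => ?_⟩
  · have := Finset.single_le_sum (f := n) (fun i _ => Nat.zero_le _) (Finset.mem_univ i)
    omega
  · have := Finset.single_le_sum (f := n') (fun i _ => Nat.zero_le _) (Finset.mem_univ j)
    omega
  · rw [← Finset.sum_div, ← mul_div_assoc, div_le_iff₀ hμ] at hp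
    have h1 : (p : ℝ) ≤ ((∑ i, n i + 1 + p : ℕ) : ℝ) := by exact_mod_cast Nat.le_add_left _ _
    exact hp.trans (mul_le_mul h1 (hμc i) hμ.le (by positivity))

variable (hB : IsBound F E d c (fun j i => LinearMap.adjoint (B i j)) D₀)
include hB

lemma IsBound.log_integral_bump_le (hc : ∀ i, 0 < c i) (hd : ∀ j, 0 < d j)
    {u : ∀ i, E i → ℝ} {b r : ℝ} (hu : ∀ i, IsBump (u i) b r) (hr : 1 ≤ r)
    {g : ∀ j, F j → ℝ≥0} (hg : ∀ j, Measurable (g j)) (hgi : ∀ j, ∫⁻ y, (g j y : ℝ≥0∞) ≠ ⊤)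
    (hug : ∀ x : ∀ i, E i, ∏ i, u i (x i) ^ c i ≤
      ∏ j, (g j (∑ i, c i • B i j (x i)) : ℝ) ^ d j) :
    ∃ W : Fin m → ℝ, (∀ j, 0 ≤ W j) ∧ ∀ η, 0 < η → η ≤ 1 →
    ∏ i, (∫ x, u i x) ^ c i ≤ Real.exp (D₀ + η) *
      ∏ j, ((∫⁻ y, (g j y : ℝ≥0∞)).toReal + η * W j) ^ d j := by
  obtain ⟨q, q', hq, hq', hqq⟩ := exists_exponents c d hc (fun i => Module.finrank ℝ (E i))
    fun j => Module.finrank ℝ (F j)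
  have hW := fun j => integral_ker_pos (hq' j)
  refine ⟨fun j => 1 + ∫ y : F j, ker q' 1 y, fun j => by linarith [hW j], fun η hη hη1 => ?_⟩
  choose G hG hGt hGl using fun j => exists_lower_approx (hq' j) (hg j) (hgi j) hη hη1
  set A : ∀ i j, E i →L[ℝ] F j := fun i j => c i • LinearMap.toContinuousLinearMap (B i j)
    with hAdef
  have hA : ∀ i j x, A i j x = c i • B i j x := fun i j x => by simp [hAdef]
  obtain ⟨δ, hδ, hδ1, hdom⟩ := exists_dominated (A := A) (G := G) hc hd hu hq hr hη hqq hGt fun x =>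
    ⟨fun j => g j (∑ i, A i j (x i)) + η / 2 * ker q' 1 (∑ i, A i j (x i)),
      fun j => by have := ker_pos q' 1 (∑ i, A i j (x i)); positivity,
      (hug x).trans (Finset.prod_le_prod (fun j _ => by positivity) fun j _ => by
        simp only [hA]
        have := ker_pos q' 1 (∑ i, c i • B i j (x i))
        refine Real.rpow_le_rpow (by positivity) ?_ (hd j).le
        linarith [mul_pos (half_pos hη) this]), fun j => hGl j _⟩
  obtain ⟨L, K, hLK⟩ := exists_common_semiSmooth (E := E) q δ
  have hG0 : ∀ j y, 0 < G j δ y := fun j y =>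
    (mul_pos hη (ker_pos q' 1 y)).trans_le (hGt j δ hδ hδ1 y)
  have key := hB.log_integral_le (H := PiLp 2 E) (A := A) (π := fun i => PiLp.proj 2 E i)
    (Q := fun j => ∑ i, (A i j).comp (PiLp.proj 2 E i)) (L := L) (K := K) (b := max b (1 / δ))
    (e := η) (f := fun i => moll q (u i) δ) (g := fun j => G j δ) hc hd
    (fun x => ⟨WithLp.toLp 2 x, fun i => rfl⟩) (fun h hh => PiLp.ext hh) hA
    (fun j h => by simp)
    (fun i => (hu i).measurable_moll (hq i) hδ)
    (fun i x => by
      rw [abs_of_pos ((hu i).moll_pos (hq i) hδ x)]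
      exact ((hu i).moll_le (hq i) x).trans (le_max_left _ _))
    (fun i => (hu i).integrable_moll (hq i) hδ)
    (fun i M t => by
      obtain ⟨ρ, h1, h2, h⟩ := (hu i).exists_moll_eq_mix (hq i) hδ
      rw [h]
      exact hLK i ρ M t)
    (fun i => (hu i).moll_pos (hq i) hδ) (fun j => (hG j δ hδ).1) hG0
    (fun j y => by
      rw [abs_of_pos (hG0 j y)]
      exact ((hG j δ hδ).2.2.1 y).2.trans (le_max_right _ _))
    (fun j => (hG j δ hδ).2.1) hdom
  simp only [(hu _).integral_moll (hq _) hδ] at key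
  have hGi : ∀ j, 0 < ∫ y, G j δ y := fun j =>
    integral_pos_of_forall_pos (hG j δ hδ).2.1 (hG0 j)
  have h1 : ∏ i, (∫ x, u i x) ^ c i ≤ Real.exp (D₀ + η) * ∏ j, (∫ y, G j δ y) ^ d j := by
    have hp : ∀ i, 0 < (∫ x, u i x) ^ c i := fun i => Real.rpow_pos_of_pos (hu i).pos _
    have hp' : ∀ j, 0 < (∫ y, G j δ y) ^ d j := fun j => Real.rpow_pos_of_pos (hGi j) _
    rw [← Real.log_le_log_iff (Finset.prod_pos fun i _ => hp i)
      (mul_pos (Real.exp_pos _) (Finset.prod_pos fun j _ => hp' j)),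
      Real.log_mul (Real.exp_pos _).ne' (Finset.prod_pos fun j _ => hp' j).ne', Real.log_exp,
      Real.log_prod fun i _ => (hp i).ne', Real.log_prod fun j _ => (hp' j).ne']
    simp only [Real.log_rpow (hu _).pos, Real.log_rpow (hGi _)]
    linarith
  refine h1.trans (mul_le_mul_of_nonneg_left ?_ (Real.exp_pos _).le)
  exact Finset.prod_le_prod (fun j _ => Real.rpow_nonneg (hGi j).le _) fun j _ =>
    Real.rpow_le_rpow (hGi j).le (hG j δ hδ).2.2.2 (hd j).le

lemma IsBound.integral_bump_le (hc : ∀ i, 0 < c i) (hd : ∀ j, 0 < d j)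
    {u : ∀ i, E i → ℝ} {b r : ℝ} (hu : ∀ i, IsBump (u i) b r) (hr : 1 ≤ r)
    {g : ∀ j, F j → ℝ≥0} (hg : ∀ j, Measurable (g j)) (hgi : ∀ j, ∫⁻ y, (g j y : ℝ≥0∞) ≠ ⊤)
    (hug : ∀ x : ∀ i, E i, ∏ i, u i (x i) ^ c i ≤
      ∏ j, (g j (∑ i, c i • B i j (x i)) : ℝ) ^ d j) :
    ∏ i, (∫ x, u i x) ^ c i ≤ Real.exp D₀ * ∏ j, (∫⁻ y, (g j y : ℝ≥0∞)).toReal ^ d j := by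
  obtain ⟨W, hW, h⟩ := hB.log_integral_bump_le hc hd hu hr hg hgi hug
  have hcont : Continuous fun η : ℝ => Real.exp (D₀ + η) *
      ∏ j, ((∫⁻ y, (g j y : ℝ≥0∞)).toReal + η * W j) ^ d j :=
    (by fun_prop : Continuous fun η : ℝ => Real.exp (D₀ + η)).mul <|
      continuous_finsetProd _ fun j _ =>
        (by fun_prop : Continuous fun η : ℝ => (∫⁻ y, (g j y : ℝ≥0∞)).toReal + η * W j).rpow_const
          fun _ => Or.inr (hd j).le
  have hlim := (hcont.tendsto 0).mono_left (nhdsWithin_le_nhds (s := Set.Ioi 0))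
  simp only [add_zero, zero_mul] at hlim
  refine ge_of_tendsto hlim ?_
  filter_upwards [self_mem_nhdsWithin, Ioc_mem_nhdsGT (zero_lt_one (α := ℝ))] with η hη hη1
  exact h η hη hη1.2

end BumpBound

end FRBL

namespace FRBL

section SingleSpace

variable {X : Type*} [NormedAddCommGroup X] [InnerProductSpace ℝ X]
  [FiniteDimensional ℝ X] [MeasurableSpace X] [BorelSpace X]

lemma IsBump.mono {u : X → ℝ} {b r b' r' : ℝ} (hu : IsBump u b r) (hb : b ≤ b') (hr : r ≤ r') :
    IsBump u b' r' :=
  ⟨hu.usc, hu.nonneg, fun x => (hu.le x).trans hb, fun x hx => hu.eq_zero x (hr.trans_lt hx),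
    hu.pos⟩

lemma exists_bump_of_bounded {f : X → ℝ≥0} {n : ℕ} (hfn : ∀ x, f x ≤ n)
    (hfn' : ∀ x, (n : ℝ) < ‖x‖ → f x = 0) {s : ℝ≥0∞} (hs : s < ∫⁻ x, (f x : ℝ≥0∞)) :
    ∃ u : X → ℝ, IsBump u n n ∧ (∀ x, u x ≤ f x) ∧ s < ENNReal.ofReal (∫ x, u x) := by
  have hfin : ∫⁻ x, (f x : ℝ≥0∞) ≠ ⊤ := by
    have h1 : ∫⁻ x, (f x : ℝ≥0∞) ≤ ∫⁻ x, (Metric.closedBall (0 : X) n).indicator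
        (fun _ => (n : ℝ≥0∞)) x := by
      refine lintegral_mono fun x => ?_
      by_cases hx : x ∈ Metric.closedBall (0 : X) n
      · rw [Set.indicator_of_mem hx]
        exact ENNReal.coe_le_coe.2 (hfn x)
      · rw [hfn' x (by simpa using hx)]
        simp
    rw [lintegral_indicator_const measurableSet_closedBall] at h1
    exact ne_top_of_le_ne_top
      (ENNReal.mul_ne_top (by simp) (isCompact_closedBall _ _).measure_lt_top.ne) h1
  obtain ⟨t, hst, ht⟩ := exists_between hs
  obtain ⟨g, hgf, hg, hint⟩ := exists_upperSemicontinuous_le_lintegral_le f hfin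
    (tsub_pos_of_lt ht).ne'
  have hgm : Measurable fun x => (g x : ℝ≥0∞) := hg.measurable.coe_nnreal_ennreal
  have htg : t ≤ ∫⁻ x, (g x : ℝ≥0∞) := by
    rw [← ENNReal.add_le_add_iff_right (ne_top_of_le_ne_top hfin tsub_le_self),
      add_tsub_cancel_of_le ht.le]
    exact hint
  have hgfin : ∫⁻ x, (g x : ℝ≥0∞) ≠ ⊤ :=
    ne_top_of_le_ne_top hfin (lintegral_mono fun x => ENNReal.coe_le_coe.2 (hgf x))
  have hval : ENNReal.ofReal (∫ x, (g x : ℝ)) = ∫⁻ x, (g x : ℝ≥0∞) := by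
    have h := integral_toReal (μ := volume) hgm.aemeasurable
      (Filter.Eventually.of_forall fun x : X =>
      ENNReal.coe_lt_top (r := g x))
    simp only [ENNReal.coe_toReal] at h
    rw [h, ENNReal.ofReal_toReal hgfin]
  have hlt : s < ENNReal.ofReal (∫ x, (g x : ℝ)) := by rw [hval]; exact hst.trans_le htg
  refine ⟨fun x => g x, ⟨?_, fun x => (g x).2, fun x => ?_, fun x hx => ?_, ?_⟩,
    fun x => NNReal.coe_le_coe.2 (hgf x), hlt⟩
  · exact NNReal.continuous_coe.comp_upperSemicontinuous hg NNReal.coe_mono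
  · exact_mod_cast (hgf x).trans (hfn x)
  · have h := hgf x
    rw [hfn' x hx] at h
    simpa using h
  · exact ENNReal.ofReal_pos.1 (zero_le.trans_lt hlt)

lemma exists_bump_le {f : X → ℝ≥0} (hf : Measurable f) {s : ℝ≥0∞}
    (hs : s < ∫⁻ x, (f x : ℝ≥0∞)) : ∃ (n : ℕ) (u : X → ℝ), IsBump u n n ∧
      (∀ x, u x ≤ f x) ∧ s < ENNReal.ofReal (∫ x, u x) := by
  set φ : ℕ → X → ℝ≥0 := fun n => (Metric.closedBall (0 : X) n).indicator fun x => min (f x) n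
    with hφ
  have hmono : Monotone φ := fun a b hab x => by
    have hcast : (a : ℝ≥0) ≤ b := by exact_mod_cast hab
    have hcast' : (a : ℝ) ≤ b := by exact_mod_cast hab
    by_cases hx : x ∈ Metric.closedBall (0 : X) a
    · simp only [hφ, Set.indicator_of_mem hx,
        Set.indicator_of_mem (Metric.closedBall_subset_closedBall hcast' hx)]
      exact min_le_min_left _ hcast
    · simp [hφ, Set.indicator_of_notMem hx]
  have hle : ∀ n x, φ n x ≤ f x := fun n x =>
    (Set.indicator_le_self' (fun _ _ => zero_le) x).trans (min_le_left _ _)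
  have hsup : ∀ x, ⨆ n, (φ n x : ℝ≥0∞) = f x := fun x => by
    refine le_antisymm (iSup_le fun n => ENNReal.coe_le_coe.2 (hle n x)) ?_
    obtain ⟨n, hn⟩ := exists_nat_ge (max ‖x‖ (f x))
    refine le_iSup_of_le n (ENNReal.coe_le_coe.2 ?_)
    have h1 : f x ≤ n := by exact_mod_cast (le_max_right _ _).trans hn
    have h2 : x ∈ Metric.closedBall (0 : X) n := by simpa using (le_max_left _ _).trans hn
    simp [hφ, Set.indicator_of_mem h2, h1]
  have hφm : ∀ n, Measurable (φ n) := fun n =>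
    (hf.min measurable_const).indicator measurableSet_closedBall
  have hlim : ∫⁻ x, (f x : ℝ≥0∞) = ⨆ n, ∫⁻ x, (φ n x : ℝ≥0∞) := by
    rw [← lintegral_iSup (fun n => (hφm n).coe_nnreal_ennreal)
      fun a b hab x => ENNReal.coe_le_coe.2 (hmono hab x)]
    simp only [hsup]
  rw [hlim] at hs
  obtain ⟨n, hn⟩ := lt_iSup_iff.1 hs
  obtain ⟨u, hu, huf, hus⟩ := exists_bump_of_bounded (n := n) (f := φ n)
    (fun x => by
      by_cases hx : x ∈ Metric.closedBall (0 : X) n <;> simp [hφ, hx])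
    (fun x hx => Set.indicator_of_notMem (by simpa using hx) _) hn
  refine ⟨n, u, hu, fun x => (huf x).trans (NNReal.coe_le_coe.2 (hle n x)), hus⟩

end SingleSpace

lemma tendsto_finset_prod_of_ne_zero {ι α : Type*} {l : Filter α} {f : ι → α → ℝ≥0∞}
    {a : ι → ℝ≥0∞} (s : Finset ι) (hf : ∀ i ∈ s, Filter.Tendsto (f i) l (nhds (a i)))
    (ha : ∀ i ∈ s, a i ≠ 0) :
    Filter.Tendsto (fun x => ∏ i ∈ s, f i x) l (nhds (∏ i ∈ s, a i)) := by
  classical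
  induction s using Finset.induction_on with
  | empty => simpa using tendsto_const_nhds
  | insert i s hi ih =>
    simp only [Finset.prod_insert hi]
    have h1 : ∏ i ∈ s, a i ≠ 0 :=
      Finset.prod_ne_zero_iff.2 fun j hj => ha j (Finset.mem_insert_of_mem hj)
    exact ENNReal.Tendsto.mul (hf i (Finset.mem_insert_self i s))
      (Or.inl (ha i (Finset.mem_insert_self i s)))
      (ih (fun j hj => hf j (Finset.mem_insert_of_mem hj))
        fun j hj => ha j (Finset.mem_insert_of_mem hj)) (Or.inl h1)

section Duality

variable {k m : ℕ} {E : Fin k → Type*} {F : Fin m → Type*}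
  [∀ i, NormedAddCommGroup (E i)] [∀ i, InnerProductSpace ℝ (E i)]
  [∀ i, FiniteDimensional ℝ (E i)]
  [∀ i, MeasurableSpace (E i)] [∀ i, BorelSpace (E i)]
  [∀ j, NormedAddCommGroup (F j)] [∀ j, InnerProductSpace ℝ (F j)]
  [∀ j, FiniteDimensional ℝ (F j)]
  [∀ j, MeasurableSpace (F j)] [∀ j, BorelSpace (F j)]
  {c : Fin k → ℝ} {d : Fin m → ℝ} {B : ∀ i j, E i →ₗ[ℝ] F j} {D₀ : ℝ}

section

variable (hB : IsBound F E d c (fun j i => LinearMap.adjoint (B i j)) D₀)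
include hB

lemma IsBound.prod_le_of_lt (hc : ∀ i, 0 < c i) (hd : ∀ j, 0 < d j)
    {f : ∀ i, E i → ℝ≥0} {g : ∀ j, F j → ℝ≥0} (hf : ∀ i, Measurable (f i))
    (hg : ∀ j, Measurable (g j)) (hfg : Hyp E F c d B f g)
    (hgi : ∀ j, ∫⁻ y, (g j y : ℝ≥0∞) ≠ ⊤) {s : Fin k → ℝ≥0∞}
    (hs : ∀ i, s i < ∫⁻ x, (f i x : ℝ≥0∞)) :
    ∏ i, s i ^ c i ≤
      ENNReal.ofReal (Real.exp D₀) * ∏ j, (∫⁻ y, (g j y : ℝ≥0∞)) ^ d j := by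
  choose n u hu huf hus using fun i => exists_bump_le (hf i) (hs i)
  have hn : ∀ i, (n i : ℝ) ≤ 1 + ∑ i, (n i : ℝ) := fun i => by
    have := Finset.single_le_sum (f := fun i => (n i : ℝ)) (fun i _ => Nat.cast_nonneg _)
      (Finset.mem_univ i)
    linarith
  have h := hB.integral_bump_le hc hd (fun i => (hu i).mono (hn i) (hn i))
    (le_add_of_nonneg_right (by positivity)) hg hgi fun x => by
      have h1 : ∏ i, (f i (x i) : ℝ) ^ c i ≤ ∏ j, (g j (∑ i, c i • B i j (x i)) : ℝ) ^ d j := by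
        exact_mod_cast hfg x
      refine (Finset.prod_le_prod (fun i _ => Real.rpow_nonneg ((hu i).nonneg _) _)
        fun i _ => ?_).trans h1
      exact Real.rpow_le_rpow ((hu i).nonneg _) (huf i _) (hc i).le
  have h2 := ENNReal.ofReal_le_ofReal h
  rw [ENNReal.ofReal_mul (Real.exp_pos _).le,
    ENNReal.ofReal_prod_of_nonneg fun i _ => Real.rpow_nonneg (hu i).pos.le _,
    ENNReal.ofReal_prod_of_nonneg fun j _ => Real.rpow_nonneg ENNReal.toReal_nonneg _] at h2
  simp only [← ENNReal.ofReal_rpow_of_nonneg (hu _).pos.le (hc _).le,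
    ← ENNReal.ofReal_rpow_of_nonneg ENNReal.toReal_nonneg (hd _).le,
    ENNReal.ofReal_toReal (hgi _)] at h2
  exact (Finset.prod_le_prod' fun i _ => ENNReal.rpow_le_rpow (hus i).le (hc i).le).trans h2

lemma IsBound.prod_lintegral_le_of_ne (hc : ∀ i, 0 < c i) (hd : ∀ j, 0 < d j)
    {f : ∀ i, E i → ℝ≥0} {g : ∀ j, F j → ℝ≥0} (hf : ∀ i, Measurable (f i))
    (hg : ∀ j, Measurable (g j)) (hfg : Hyp E F c d B f g)
    (hfi : ∀ i, ∫⁻ x, (f i x : ℝ≥0∞) ≠ 0) (hgi : ∀ j, ∫⁻ y, (g j y : ℝ≥0∞) ≠ ⊤) :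
    ∏ i, (∫⁻ x, (f i x : ℝ≥0∞)) ^ c i ≤
      ENNReal.ofReal (Real.exp D₀) * ∏ j, (∫⁻ y, (g j y : ℝ≥0∞)) ^ d j := by
  choose s _ hs hlim using fun i => exists_seq_strictMono_tendsto' (pos_iff_ne_zero.2 (hfi i))
  refine le_of_tendsto' (tendsto_finset_prod_of_ne_zero Finset.univ
    (fun i _ => (hlim i).ennrpow_const (c i))
    fun i _ => ?_) fun n => hB.prod_le_of_lt hc hd hf hg hfg hgi fun i => (hs i n).2
  simp [hfi i, (hc i).le]

lemma IsBound.lintegral_ne_zero (hc : ∀ i, 0 < c i) (hd : ∀ j, 0 < d j)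
    {f : ∀ i, E i → ℝ≥0} {g : ∀ j, F j → ℝ≥0} (hf : ∀ i, Measurable (f i))
    (hg : ∀ j, Measurable (g j)) (hfg : Hyp E F c d B f g)
    (hfi : ∀ i, ∫⁻ x, (f i x : ℝ≥0∞) ≠ 0) (j₀ : Fin m) : ∫⁻ y, (g j₀ y : ℝ≥0∞) ≠ 0 := by
  intro hj₀
  have hK : ∀ i, ∃ K ⊆ {x | f i x ≠ 0}, IsCompact K ∧ 0 < volume K := fun i => by
    refine (hf i (measurableSet_singleton 0).compl).exists_lt_isCompact (pos_iff_ne_zero.2 ?_)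
    intro h
    refine hfi i ((lintegral_eq_zero_iff (hf i).coe_nnreal_ennreal).2 ?_)
    filter_upwards [compl_mem_ae_iff.2 h] with x hx
    simpa using hx
  choose K hKf hKc hKv using hK
  set T : ∀ j, Set (F j) := fun j =>
    (fun x : ∀ i, E i => ∑ i, c i • B i j (x i)) '' Set.univ.pi K with hT
  have hTc : ∀ j, IsCompact (T j) := fun j => by
    refine (isCompact_univ_pi hKc).image ?_
    exact continuous_finsetSum _ fun i _ =>
      ((LinearMap.continuous_of_finiteDimensional (B i j)).comp (continuous_apply i)).const_smul _
  have hKi : ∀ i, ∫⁻ x, (((K i).indicator (fun _ => (1 : ℝ≥0)) x : ℝ≥0) : ℝ≥0∞) =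
      volume (K i) := fun i => by
    simp [ENNReal.coe_indicator, lintegral_indicator_const (hKc i).measurableSet]
  have hTi : ∀ j, ∫⁻ y, (((T j).indicator (fun _ => (1 : ℝ≥0)) y : ℝ≥0) : ℝ≥0∞) =
      volume (T j) := fun j => by
    simp [ENNReal.coe_indicator, lintegral_indicator_const (hTc j).measurableSet]
  have h := hB.prod_lintegral_le_of_ne hc hd (f := fun i => (K i).indicator fun _ => 1)
    (g := fun j => (T j).indicator fun _ => 1)
    (fun i => measurable_const.indicator (hKc i).measurableSet)
    (fun j => measurable_const.indicator (hTc j).measurableSet)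
    (fun x => by
      by_cases hx : ∀ i, x i ∈ K i
      · refine le_of_eq ?_
        have hxT : ∀ j, ∑ i, c i • B i j (x i) ∈ T j := fun j => ⟨x, fun i _ => hx i, rfl⟩
        simp [hx, hxT]
      · push Not at hx
        obtain ⟨i, hi⟩ := hx
        rw [Finset.prod_eq_zero (Finset.mem_univ i) (by
          simp [hi, (hc i).ne'])]
        exact zero_le)
    (fun i => by rw [hKi]; exact (hKv i).ne')
    (fun j => by rw [hTi]; exact (hTc j).measure_lt_top.ne)
  simp only [hKi, hTi] at h
  have hT0 : volume (T j₀) = 0 := by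
    refine measure_mono_null ?_ (ae_iff.1 ((lintegral_eq_zero_iff
      (hg j₀).coe_nnreal_ennreal).1 hj₀))
    rintro _ ⟨x, hx, rfl⟩ h0
    have h1 := hfg x
    rw [Finset.prod_eq_zero (Finset.mem_univ j₀) (by
      have : g j₀ (∑ i, c i • B i j₀ (x i)) = 0 := by simpa using h0
      rw [this, NNReal.zero_rpow (hd j₀).ne'])] at h1
    refine absurd h1 (not_le.2 (Finset.prod_pos fun i _ => ?_))
    exact NNReal.rpow_pos (pos_iff_ne_zero.2 (hKf i (hx i trivial)))
  rw [Finset.prod_eq_zero (Finset.mem_univ j₀) (by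
    rw [hT0, ENNReal.zero_rpow_of_pos (hd j₀)]), mul_zero, nonpos_iff_eq_zero,
    Finset.prod_eq_zero_iff] at h
  obtain ⟨i, -, hi⟩ := h
  rw [ENNReal.rpow_eq_zero_iff_of_pos (hc i)] at hi
  exact (hKv i).ne' hi

theorem IsBound.of_adjoint (hc : ∀ i, 0 < c i) (hd : ∀ j, 0 < d j) : IsBound E F c d B D₀ := by
  intro f g hf hg hfg
  by_cases hfi : ∀ i, ∫⁻ x, (f i x : ℝ≥0∞) ≠ 0
  · by_cases hgi : ∀ j, ∫⁻ y, (g j y : ℝ≥0∞) ≠ ⊤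
    · exact hB.prod_lintegral_le_of_ne hc hd hf hg hfg hfi hgi
    · push Not at hgi
      obtain ⟨j, hj⟩ := hgi
      have h0 := fun j => hB.lintegral_ne_zero hc hd hf hg hfg hfi j
      have h1 : ∏ j ∈ Finset.univ.erase j, (∫⁻ y, (g j y : ℝ≥0∞)) ^ d j ≠ 0 :=
        Finset.prod_ne_zero_iff.2 fun j _ => by simp [h0 j, (hd j).le]
      rw [← Finset.mul_prod_erase _ _ (Finset.mem_univ j), hj, ENNReal.top_rpow_of_pos (hd j),
        ENNReal.top_mul h1, ENNReal.mul_top (by simpa using Real.exp_pos _)]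
      exact le_top
  · push Not at hfi
    obtain ⟨i, hi⟩ := hfi
    rw [Finset.prod_eq_zero (Finset.mem_univ i) (by rw [hi, ENNReal.zero_rpow_of_pos (hc i)])]
    exact zero_le

end

lemma isBound_iff_adjoint (hc : ∀ i, 0 < c i) (hd : ∀ j, 0 < d j) :
    IsBound E F c d B D₀ ↔ IsBound F E d c (fun j i => LinearMap.adjoint (B i j)) D₀ := by
  refine ⟨fun h => IsBound.of_adjoint ?_ hd hc, fun h => h.of_adjoint hc hd⟩
  simpa only [LinearMap.adjoint_adjoint] using h

end Duality

end FRBL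

namespace FRBL

variable {k m : ℕ}
  (E : Fin k → Type*) (F : Fin m → Type*)
  [∀ i, NormedAddCommGroup (E i)] [∀ i, InnerProductSpace ℝ (E i)]
  [∀ i, FiniteDimensional ℝ (E i)]
  [∀ i, MeasurableSpace (E i)] [∀ i, BorelSpace (E i)]
  [∀ j, NormedAddCommGroup (F j)] [∀ j, InnerProductSpace ℝ (F j)]
  [∀ j, FiniteDimensional ℝ (F j)]
  [∀ j, MeasurableSpace (F j)] [∀ j, BorelSpace (F j)]

/-- **Theorem (duality of best constants).** For every datum `(c,d,B)`, the best constants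
in the forward-reverse Brascamp-Lieb inequality for the datum and for its dual datum
coincide: `D(c,d,B) = D(d,c,B*)`. -/
theorem D_eq_D_dual
    (c : Fin k → ℝ) (d : Fin m → ℝ) (B : ∀ i j, E i →ₗ[ℝ] F j)
    (hc : ∀ i, 0 < c i) (hd : ∀ j, 0 < d j) :
    D E F c d B = D F E d c (fun j i => LinearMap.adjoint (B i j)) := by
  simp only [D, isBound_iff_adjoint hc hd]

end FRBL
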